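/- arXiv:2008.03490 — 4 statements merged into one kernel-verified Lean document; each statement's English description precedes it below -/
import Mathlib

section
/- Let p be a prime, F an algebraically closed field of characteristic p, and G a finite group possessing a normal p'-subgroup N with C_G(N) ≤ N (equivalently, the generalized Fitting subgroup F*(G) is a p'-group). If A is an abelian p-subgroup of G of maximal order, then there exists a simple FG-module S with dim_F(S) ≥ |A|. -/
/-- The dimension over `F` of a module over the group algebra `F[G]`. -/
noncomputable def fdim (F : Type) [Field F] (G : Type) [Group G] (S : Type)
    [AddCommGroup S] [Module (MonoidAlgebra F G) S] : ℕ :=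
  letI : Module F S := Module.compHom S (algebraMap F (MonoidAlgebra F G))
  Module.finrank F S

open Module MonoidAlgebra

section GroupAlgebraAction

variable {F : Type} [Field F] {N : Type} [Group N] {A : Type} [CommGroup A]

/-- The action on the group algebra `F[N]` induced by an action `φ` of `A` on `N`. -/
noncomputable def act (F : Type) [Field F] {N : Type} [Group N] {A : Type} [CommGroup A]
    (φ : A →* MulAut N) (a : A) : F[N] ≃ₐ[F] F[N] :=
  domCongr F F (φ a)

@[simp] lemma act_single (φ : A →* MulAut N) (a : A) (n : N) (r : F) :
    act F φ a (single n r) = single (φ a n) r := by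
  simp [act]

lemma act_act (φ : A →* MulAut N) (a b : A) (x : F[N]) :
    act F φ a (act F φ b x) = act F φ (a * b) x := by
  induction x using MonoidAlgebra.induction_linear with
  | zero => simp
  | add x y hx hy => simp only [map_add, hx, hy]
  | single n r => simp

@[simp] lemma act_one (φ : A →* MulAut N) (x : F[N]) : act F φ 1 x = x := by
  induction x using MonoidAlgebra.induction_linear with
  | zero => simp
  | add x y hx hy => simp only [map_add, hx, hy]
  | single n r => simp

@[simp] lemma act_inv_act (φ : A →* MulAut N) (a : A) (x : F[N]) :
    act F φ a⁻¹ (act F φ a x) = x := by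
  simp [act_act]

@[simp] lemma act_act_inv (φ : A →* MulAut N) (a : A) (x : F[N]) :
    act F φ a (act F φ a⁻¹ x) = x := by
  simp [act_act]

lemma act_of_mem_ker (φ : A →* MulAut N) {a : A} (ha : a ∈ φ.ker) (x : F[N]) :
    act F φ a x = x := by
  rw [MonoidHom.mem_ker] at ha
  induction x using MonoidAlgebra.induction_linear with
  | zero => simp
  | add x y hx hy => simp only [map_add, hx, hy]
  | single n r => simp [ha]

/-- A matrix block of the group algebra `F[N]`: an irreducible representation `σ` on `F ^ d`
together with a multiplicative section `s` onto a two-sided ideal of `F[N]`. -/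
structure Block (F : Type) [Field F] (N : Type) [Group N] (d : ℕ) where
  σ : F[N] →ₐ[F] End F (Fin d → F)
  s : End F (Fin d → F) →ₗ[F] F[N]
  pos : 0 < d
  s_mul : ∀ S T, s (S * T) = s S * s T
  σ_s : ∀ T, σ (s T) = T
  s_σ : ∀ x, s (σ x) = s 1 * x
  central : ∀ x, s 1 * x = x * s 1

namespace Block

variable {d : ℕ} (β : Block F N d)

/-- The central idempotent of a block. -/
noncomputable def c : F[N] := β.s 1

lemma c_mul_c : β.c * β.c = β.c := by rw [c, ← β.s_mul, one_mul]

lemma c_comm (x : F[N]) : β.c * x = x * β.c := β.central x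

lemma σ_c : β.σ β.c = 1 := β.σ_s 1

lemma s_σ' (x : F[N]) : β.s (β.σ x) = β.c * x := β.s_σ x

lemma c_mul_s (T) : β.c * β.s T = β.s T := by rw [c, ← β.s_mul, one_mul]

lemma s_mul_c (T) : β.s T * β.c = β.s T := by rw [c, ← β.s_mul, mul_one]

lemma nontriv {d : ℕ} (β : Block F N d) : Nontrivial (Fin d → F) :=
  haveI : Nonempty (Fin d) := ⟨⟨0, β.pos⟩⟩
  inferInstance

lemma c_ne_zero : β.c ≠ 0 := by
  intro h
  have := β.nontriv
  have := β.σ_c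
  rw [h, map_zero] at this
  exact zero_ne_one this

lemma c_mul_eq_zero_iff (x : F[N]) : β.c * x = 0 ↔ β.σ x = 0 := by
  constructor
  · intro h
    have := congrArg β.σ h
    simpa [β.σ_c] using this
  · intro h
    rw [← β.s_σ', h, map_zero]

lemma c_mul_eq_c_iff (x : F[N]) : β.c * x = β.c ↔ β.σ x = 1 := by
  constructor
  · intro h
    have := congrArg β.σ h
    simpa [β.σ_c] using this
  · intro h
    rw [← β.s_σ', h, c]

lemma central_idem (z : F[N]) (hz : ∀ x, z * x = x * z) (hzz : z * z = z) :
    β.c * z = 0 ∨ β.c * z = β.c := by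
  have := β.nontriv
  have h1 : β.σ z ∈ Subalgebra.center F (End F (Fin d → F)) := by
    rw [Subalgebra.mem_center_iff]
    intro T
    rw [← β.σ_s T, ← map_mul, ← map_mul, hz]
  rw [Module.End.mem_subalgebraCenter_iff] at h1
  obtain ⟨α, hα, h1⟩ := h1
  have h2 : β.σ z = algebraMap F _ α := by
    rw [h1]
    ext1 x
    rfl
  have h3 := congrArg β.σ hzz
  rw [map_mul, h2, ← map_mul] at h3
  have h4 : α * α = α := FaithfulSMul.algebraMap_injective F (End F (Fin d → F)) h3
  have h5 : α * (α - 1) = 0 := by linear_combination h4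
  rcases mul_eq_zero.1 h5 with h | h
  · left
    rw [β.c_mul_eq_zero_iff, h2, h, map_zero]
  · right
    rw [β.c_mul_eq_c_iff, h2, sub_eq_zero.1 h, map_one]

/-- The stabilizer of a block under the action `φ`. -/
noncomputable def stab (φ : A →* MulAut N) : Subgroup A where
  carrier := {a | act F φ a β.c = β.c}
  one_mem' := by simp
  mul_mem' := by
    intro a b ha hb
    simp only [Set.mem_ofPred_eq] at *
    rw [← act_act, hb, ha]
  inv_mem' := by
    intro a ha
    simp only [Set.mem_ofPred_eq] at *
    conv_lhs => rw [← ha]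
    simp

lemma mem_stab (φ : A →* MulAut N) (a : A) : a ∈ β.stab φ ↔ act F φ a β.c = β.c := Iff.rfl

lemma ker_le_stab (φ : A →* MulAut N) : φ.ker ≤ β.stab φ := by
  intro a ha
  rw [mem_stab, act_of_mem_ker φ ha]

lemma act_c_comm (φ : A →* MulAut N) (a : A) (x : F[N]) :
    act F φ a β.c * x = x * act F φ a β.c := by
  have h := congrArg (act F φ a) (β.c_comm (act F φ a⁻¹ x))
  simpa using h

lemma act_c_idem (φ : A →* MulAut N) (a : A) :
    act F φ a β.c * act F φ a β.c = act F φ a β.c := by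
  rw [← map_mul, c_mul_c]

lemma c_mul_act_c (φ : A →* MulAut N) (a : A) (ha : a ∉ β.stab φ) :
    β.c * act F φ a β.c = 0 := by
  rcases β.central_idem _ (β.act_c_comm φ a) (β.act_c_idem φ a) with h | h
  · exact h
  rcases β.central_idem _ (β.act_c_comm φ a⁻¹) (β.act_c_idem φ a⁻¹) with h' | h'
  all_goals
    have h2 := congrArg (act F φ a) h'
    simp only [map_mul, act_act_inv, map_zero] at h2
  · rw [← β.c_comm, h] at h2
    exact absurd h2 β.c_ne_zero
  · rw [← β.c_comm, h] at h2
    exact absurd h2.symm ha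

end Block

lemma exists_block [IsAlgClosed F] [Finite N] [NeZero (Nat.card N : F)] (x : F[N]) (hx : x ≠ 0) :
    ∃ d, ∃ β : Block F N d, β.σ x ≠ 0 := by
  classical
  obtain ⟨n, d, hd, ⟨Φ⟩⟩ :=
    IsSemisimpleRing.exists_algEquiv_pi_matrix_of_isAlgClosed F F[N]
  have h1 : Φ x ≠ 0 := by simpa using hx
  obtain ⟨i, hi⟩ := Function.ne_iff.1 h1
  let L := Matrix.toLinAlgEquiv' (R := F) (n := Fin (d i))
  refine ⟨d i, ⟨(L.toAlgHom.comp ((Pi.evalAlgHom F _ i).comp Φ.toAlgHom)),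
    Φ.symm.toLinearMap ∘ₗ LinearMap.single F _ i ∘ₗ L.symm.toLinearMap, ?_, ?_, ?_, ?_, ?_⟩, ?_⟩
  · exact Nat.pos_of_ne_zero (hd i).ne
  · intro S T
    simp [← map_mul, ← Pi.single_mul]
  · intro T
    simp
  · intro x
    apply Φ.injective
    simp only [AlgHom.coe_comp, LinearMap.coe_comp, Function.comp_apply,
      map_mul]
    ext1 j
    by_cases h : j = i
    · subst h; simp
    · simp [h]
  · intro x
    apply Φ.injective
    simp only [LinearMap.coe_comp, Function.comp_apply, map_mul]
    ext1 j
    by_cases h : j = i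
    · subst h; simp
    · simp [h]
  · simpa using hi

end GroupAlgebraAction

section Lifting

variable {F : Type} [Field F] {V : Type} [AddCommGroup V] [Module F V]

/-- The unit `x` induces the algebra automorphism `a` of `End F V` by conjugation. -/
def Induces (x : (End F V)ˣ) (a : End F V ≃ₐ[F] End F V) : Prop :=
  ∀ T : End F V, (x : End F V) * T = a T * x

lemma Induces.mul {x y : (End F V)ˣ} {a b : End F V ≃ₐ[F] End F V} (hx : Induces x a)
    (hy : Induces y b) : Induces (x * y) (a * b) := by
  intro T
  rw [Units.val_mul, mul_assoc, hy T, ← mul_assoc, hx, mul_assoc]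
  rfl

lemma Induces.inv {x : (End F V)ˣ} {a : End F V ≃ₐ[F] End F V} (hx : Induces x a) :
    Induces x⁻¹ a⁻¹ := by
  intro T
  have h := hx (a⁻¹ T)
  have h' : a (a⁻¹ T) = T := a.apply_symm_apply T
  rw [h'] at h
  rw [Units.inv_mul_eq_iff_eq_mul, ← mul_assoc, h, mul_assoc, Units.mul_inv, mul_one]

lemma Induces.pow {x : (End F V)ˣ} {a : End F V ≃ₐ[F] End F V} (hx : Induces x a) (n : ℕ) :
    Induces (x ^ n) (a ^ n) := by
  induction n with
  | zero => intro T; simp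
  | succ n ih => rw [pow_succ, pow_succ]; exact ih.mul hx

lemma Induces.exists_scalar {x : (End F V)ˣ} (hx : Induces x 1) :
    ∃ α : F, (x : End F V) = algebraMap F _ α := by
  have h1 : (x : End F V) ∈ Subalgebra.center F (End F V) := by
    rw [Subalgebra.mem_center_iff]
    intro T
    exact (hx T).symm
  rw [Module.End.mem_subalgebraCenter_iff] at h1
  obtain ⟨α, hα, h1⟩ := h1
  refine ⟨α, ?_⟩
  rw [h1]
  ext1 x
  rfl

lemma Induces.eq_one [Nontrivial V] {p : ℕ} [ExpChar F p] {n : ℕ} {x : (End F V)ˣ}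
    (hx : Induces x 1) (hq : x ^ p ^ n = 1) : x = 1 := by
  obtain ⟨α, hα⟩ := hx.exists_scalar
  have h := congrArg (fun y : (End F V)ˣ => (y : End F V)) hq
  simp only [Units.val_pow_eq_pow_val, Units.val_one] at h
  rw [hα, ← map_pow, ← map_one (algebraMap F (End F V))] at h
  have h4 := FaithfulSMul.algebraMap_injective F (End F V) h
  have h5 : α = 1 := by
    rw [← mul_one (p ^ n), ExpChar.pow_prime_pow_mul_eq_one_iff] at h4
    simpa using h4
  apply Units.ext
  rw [hα, h5, map_one, Units.val_one]

lemma exists_induces [FiniteDimensional F V] [IsAlgClosed F] [Nontrivial V]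
    (a : End F V ≃ₐ[F] End F V) {q : ℕ} (hq : 0 < q) (ha : a ^ q = 1) :
    ∃ x : (End F V)ˣ, Induces x a ∧ x ^ q = 1 := by
  obtain ⟨T, hT⟩ := AlgEquiv.eq_linearEquivConjAlgEquiv a
  let g : (End F V)ˣ := ⟨T.toLinearMap, T.symm.toLinearMap, by ext; simp, by ext; simp⟩
  have hg : Induces g a := by
    intro S
    rw [hT]
    ext v
    simp [g]
  obtain ⟨l, hl⟩ := Induces.exists_scalar (ha ▸ hg.pow q)
  obtain ⟨μ, hμ⟩ := IsAlgClosed.exists_pow_nat_eq l hq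
  have hl0 : l ≠ 0 := by
    rintro rfl
    rw [map_zero] at hl
    exact (g ^ q).ne_zero hl
  have hμ0 : μ ≠ 0 := by
    rintro rfl
    rw [zero_pow hq.ne'] at hμ
    exact hl0 hμ.symm
  let m : (End F V)ˣ := Units.map (algebraMap F (End F V)).toMonoidHom (Units.mk0 μ hμ0)⁻¹
  have hm : ∀ S : End F V, (m : End F V) * S = S * m := by
    intro S
    exact Algebra.commutes _ S
  have hm1 : Induces m 1 := hm
  refine ⟨m * g, by simpa using hm1.mul hg, ?_⟩
  have hc : Commute m g := Units.ext (hm g)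
  rw [hc.mul_pow]
  apply Units.ext
  rw [Units.val_mul, hl, ← hμ, ← map_pow, Units.val_one]
  simp only [Units.coe_map, RingHom.toMonoidHom_eq_coe, MonoidHom.coe_coe, ← map_mul]
  simp [hμ0]

lemma exists_lift [FiniteDimensional F V] [IsAlgClosed F] [Nontrivial V] {p : ℕ} [ExpChar F p]
    {B : Type} [CommGroup B] {n : ℕ} (hB : ∀ b : B, b ^ p ^ n = 1)
    (α : B →* (End F V ≃ₐ[F] End F V)) :
    ∃ u : B →* End F V, ∀ b T, u b * T = α b T * u b := by
  have h := fun b => exists_induces (α b) (pow_pos (expChar_pos F p) n)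
    (by rw [← map_pow, hB, map_one])
  choose u hu hu1 using h
  have hcomm : ∀ a b, Commute (u a) (u b) := by
    intro a b
    set w := u a * u b * (u a)⁻¹ * (u b)⁻¹ with hw
    have h1 : Induces w 1 := by
      have := (((hu a).mul (hu b)).mul (hu a).inv).mul (hu b).inv
      rw [← map_inv, ← map_inv, ← map_mul, ← map_mul, ← map_mul] at this
      rw [show a * b * a⁻¹ * b⁻¹ = 1 by rw [mul_comm a b]; group, map_one] at this
      exact this
    have h2 : w * u b = u a * u b * (u a)⁻¹ := by rw [hw]; group
    have h3 : Commute w (u b) := Units.ext (h1 (u b))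
    have h4 := congrArg (· ^ p ^ n) h2
    simp only [h3.mul_pow, conj_pow, hu1, mul_one, mul_inv_cancel] at h4
    have h5 := h1.eq_one h4
    rw [h5, one_mul, eq_mul_inv_iff_mul_eq] at h2
    exact h2.symm
  have hmul : ∀ a b, u (a * b) = u a * u b := by
    intro a b
    set w := u a * u b * (u (a * b))⁻¹ with hw
    have h1 : Induces w 1 := by
      have := ((hu a).mul (hu b)).mul (hu (a * b)).inv
      rw [map_mul, mul_inv_cancel] at this
      exact this
    have h2 : w * u (a * b) = u a * u b := by rw [hw]; group
    have h3 : Commute w (u (a * b)) := Units.ext (h1 _)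
    have h4 := congrArg (· ^ p ^ n) h2
    simp only [h3.mul_pow, (hcomm a b).mul_pow, hu1, mul_one] at h4
    rw [h1.eq_one h4, one_mul] at h2
    exact h2
  refine ⟨(Units.coeHom _).comp (MonoidHom.mk' u hmul), fun b T => ?_⟩
  exact hu b T

end Lifting

section Compatible

variable {F : Type} [Field F] {N : Type} [Group N] {A : Type} [CommGroup A]

/-- `ρ` and `u` together form a representation of the semidirect product of `N` by `B`. -/
def Compat (φ : A →* MulAut N) (B : Subgroup A) {M : Type} [AddCommGroup M] [Module F M]
    (ρ : F[N] →ₐ[F] End F M) (u : B →* End F M) : Prop :=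
  ∀ (b : B) (x : F[N]), u b * ρ x = ρ (act F φ b x) * u b

lemma Block.exists_compat [IsAlgClosed F] {p : ℕ} [ExpChar F p] {n : ℕ}
    (hA : ∀ a : A, a ^ p ^ n = 1) (φ : A →* MulAut N) {d : ℕ} (β : Block F N d) :
    ∃ u : β.stab φ →* End F (Fin d → F), Compat φ (β.stab φ) β.σ u := by
  have := β.nontriv
  have key : ∀ (a b : A), b ∈ β.stab φ → ∀ T, β.σ (act F φ a (β.s (β.σ (act F φ b (β.s T)))))
      = β.σ (act F φ (a * b) (β.s T)) := by
    intro a b hb T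
    rw [β.s_σ']
    conv_lhs => rw [← (β.mem_stab φ b).1 hb, ← map_mul, β.c_mul_s]
    rw [act_act]
  have key1 : ∀ (a b : A), a ∈ β.stab φ → b ∈ β.stab φ → a * b = 1 → ∀ T,
      β.σ (act F φ a (β.s (β.σ (act F φ b (β.s T))))) = T := by
    intro a b ha hb hab T
    rw [key a b hb, hab, act_one, β.σ_s]
  let α0 : β.stab φ → (End F (Fin d → F) ≃ₐ[F] End F (Fin d → F)) := fun b =>
    { toFun := fun T => β.σ (act F φ b (β.s T))
      invFun := fun T => β.σ (act F φ (b⁻¹ : A) (β.s T))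
      left_inv := fun T => key1 _ _ (inv_mem b.2) b.2 (by simp) T
      right_inv := fun T => key1 _ _ b.2 (inv_mem b.2) (by simp) T
      map_mul' := fun S T => by simp only [β.s_mul, map_mul]
      map_add' := fun S T => by simp only [map_add]
      commutes' := fun r => by
        rw [Algebra.algebraMap_eq_smul_one, map_smul, map_smul, map_smul]
        have : act F φ b (β.s 1) = β.s 1 := b.2
        rw [this, β.σ_s] }
  let α : β.stab φ →* (End F (Fin d → F) ≃ₐ[F] End F (Fin d → F)) :=
    { toFun := α0
      map_one' := by
        ext1 T
        change β.σ (act F φ 1 (β.s T)) = T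
        rw [act_one, β.σ_s]
      map_mul' := fun a b => by
        ext1 T
        exact (key a b b.2 T).symm }
  obtain ⟨u, hu⟩ := exists_lift (p := p) (n := n) (fun b : β.stab φ => Subtype.ext (hA b)) α
  refine ⟨u, fun b x => ?_⟩
  rw [hu]
  congr 1
  change β.σ (act F φ b (β.s (β.σ x))) = _
  rw [β.s_σ']
  rw [map_mul, (β.mem_stab φ b).1 b.2, map_mul, β.σ_c, one_mul]

end Compatible

section Rank

variable {F : Type} [Field F] {M : Type} [AddCommGroup M] [Module F M]

/-- The rank of an endomorphism as a natural number. -/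
noncomputable def rk (T : End F M) : ℕ := finrank F (LinearMap.range T)

variable [FiniteDimensional F M]

lemma rk_mul_le_left (S T : End F M) : rk (S * T) ≤ rk S := by
  apply Submodule.finrank_mono
  rintro _ ⟨v, rfl⟩
  exact ⟨T v, rfl⟩

lemma rk_mul_le_right (S T : End F M) : rk (S * T) ≤ rk T := by
  unfold rk
  rw [Module.End.mul_eq_comp, LinearMap.range_comp]
  exact Submodule.finrank_map_le _ _

lemma rk_conj_le (S T U : End F M) : rk (S * T * U) ≤ rk T :=
  (rk_mul_le_left _ _).trans (rk_mul_le_right _ _)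

lemma rk_le_finrank (T : End F M) : rk T ≤ finrank F M := Submodule.finrank_le _

lemma rk_pos {T : End F M} (hT : T ≠ 0) : 0 < rk T := by
  rw [rk, Module.finrank_pos_iff, Submodule.nontrivial_iff_ne_bot, Ne, LinearMap.range_eq_bot]
  exact hT

lemma card_mul_le_rk {ι : Type} [Finite ι] (P : ι → End F M) (E : End F M)
    (hP : ∀ i j, i ≠ j → P i * P j = 0) (hi : ∀ i, P i * P i = P i)
    (hE : ∀ i, E * P i = P i * E) (r : ℕ) (hr : ∀ i, r ≤ rk (P i * E)) :
    Nat.card ι * r ≤ rk E := by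
  classical
  have := Fintype.ofFinite ι
  let f : (Π i, LinearMap.range (P i * E)) →ₗ[F] M :=
    LinearMap.lsum F (fun i => LinearMap.range (P i * E)) F
      (fun i => (LinearMap.range (P i * E)).subtype)
  have hf : ∀ w, f w = ∑ i, (w i : M) := by intro w; simp [f]
  have hw : ∀ j w, P j (f w) = w j := by
    intro j w
    rw [hf, map_sum, Finset.sum_eq_single j]
    · obtain ⟨v, hv⟩ := (w j).2
      rw [← hv, ← Module.End.mul_apply, ← mul_assoc, hi]
    · intro i _ hij
      obtain ⟨v, hv⟩ := (w i).2
      rw [← hv, ← Module.End.mul_apply, ← mul_assoc, hP j i hij.symm, zero_mul]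
      rfl
    · simp
  have hfr : ∀ w, f w ∈ LinearMap.range E := by
    intro w
    rw [hf]
    refine Submodule.sum_mem _ fun i _ => ?_
    obtain ⟨v, hv⟩ := (w i).2
    exact ⟨P i v, by rw [← hv, ← hE]; rfl⟩
  have hinj : Function.Injective (LinearMap.codRestrict (LinearMap.range E) f hfr) := by
    intro w w' h
    have h' : f w = f w' := congrArg Subtype.val h
    funext j
    apply Subtype.ext
    rw [← hw, ← hw, h']
  have h := LinearMap.finrank_le_finrank_of_injective hinj
  rw [finrank_pi_fintype] at h
  calc Nat.card ι * r = ∑ _i : ι, r := by simp [Nat.card_eq_fintype_card]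
    _ ≤ _ := Finset.sum_le_sum fun i _ => hr i
    _ ≤ _ := h

end Rank

namespace Block

variable {F : Type} [Field F] {N : Type} [Group N] {d : ℕ} (β : Block F N d)

/-- The matrix units of a block. -/
noncomputable def e (i j : Fin d) : F[N] :=
  β.s (Matrix.toLinAlgEquiv' (Matrix.single i j 1))

lemma e_mul_e (i j k : Fin d) : β.e i j * β.e j k = β.e i k := by
  rw [e, e, e, ← β.s_mul, ← map_mul, Matrix.single_mul_single_same, one_mul]

lemma e_mul_e_of_ne (i k : Fin d) {j l : Fin d} (h : j ≠ l) : β.e i j * β.e l k = 0 := by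
  rw [e, e, ← β.s_mul, ← map_mul, Matrix.single_mul_single_of_ne _ _ _ _ h, map_zero, map_zero]

lemma sum_e : ∑ i, β.e i i = β.c := by
  simp only [e, c]
  rw [← map_sum, ← map_sum, Matrix.sum_single_one, map_one]

lemma c_mul_e (i j : Fin d) : β.c * β.e i j = β.e i j := β.c_mul_s _

lemma e_mul_c (i j : Fin d) : β.e i j * β.c = β.e i j := β.s_mul_c _

lemma e_ne_zero (i j : Fin d) : β.e i j ≠ 0 := by
  intro h
  have := congrArg β.σ h
  rw [e, β.σ_s, map_zero, EmbeddingLike.map_eq_zero_iff] at this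
  have := congrFun (congrFun this i) j
  simp at this

lemma e_mul_mul_e (i j : Fin d) (x : F[N]) :
    ∃ α : F, β.e i i * x * β.e j j = α • β.e i j := by
  refine ⟨Matrix.toLinAlgEquiv'.symm (β.σ x) i j, ?_⟩
  rw [← β.c_mul_e i i, ← β.c_mul_e j j, β.c_comm (β.e j j), ← mul_assoc, β.c_comm (β.e i i),
    mul_assoc _ β.c, ← β.s_σ', mul_assoc, mul_assoc, β.e_mul_c, e, e, e, ← β.s_mul, ← β.s_mul,
    ← map_smul, ← map_smul]
  obtain ⟨X, hX⟩ := (Matrix.toLinAlgEquiv' (R := F) (n := Fin d)).surjective (β.σ x)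
  rw [← hX, ← map_mul, ← map_mul, AlgEquiv.symm_apply_apply]
  congr 2
  rw [← mul_assoc, Matrix.single_mul_mul_single]
  simp [Matrix.smul_single]

end Block

section Count

variable {F : Type} [Field F] {N : Type} [Group N] {A : Type} [CommGroup A]

lemma card_inf_mul_relIndex {G : Type} [Group G] (H K : Subgroup G) :
    Nat.card (H ⊓ K : Subgroup G) * H.relIndex K = Nat.card K := by
  rw [← Subgroup.relIndex_bot_left, ← Subgroup.relIndex_bot_left, ← Subgroup.inf_relIndex_right H K]
  exact Subgroup.relIndex_mul_relIndex _ _ _ bot_le inf_le_right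

/-- Commutes with all operators of a compatible pair. -/
def CommutesWith {B M : Type} [Group B] [AddCommGroup M] [Module F M]
    (ρ : F[N] →ₐ[F] End F M) (u : B →* End F M) (E : End F M) : Prop :=
  (∀ x, E * ρ x = ρ x * E) ∧ ∀ b, E * u b = u b * E

lemma CommutesWith.one {B M : Type} [Group B] [AddCommGroup M] [Module F M]
    (ρ : F[N] →ₐ[F] End F M) (u : B →* End F M) : CommutesWith ρ u 1 :=
  ⟨fun _ => by rw [one_mul, mul_one], fun _ => by rw [one_mul, mul_one]⟩

lemma Compat.conj {φ : A →* MulAut N} {B : Subgroup A} {M : Type} [AddCommGroup M] [Module F M]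
    {ρ : F[N] →ₐ[F] End F M} {u : B →* End F M} (h : Compat φ B ρ u) (b : B) (x : F[N]) :
    ρ (act F φ b x) = u b * ρ x * u b⁻¹ := by
  rw [h b x, mul_assoc, ← map_mul, mul_inv_cancel, map_one, mul_one]

variable [Finite A]

lemma Block.card_mul_rk_le (φ : A →* MulAut N) {d : ℕ} (β : Block F N d) (B : Subgroup A)
    {M : Type} [AddCommGroup M] [Module F M] [FiniteDimensional F M]
    (ρ : F[N] →ₐ[F] End F M) (u : B →* End F M) (h : Compat φ B ρ u) (E : End F M)
    (hE : CommutesWith ρ u E) (i₀ : Fin d) :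
    Nat.card B * (d * rk (ρ (β.e i₀ i₀) * E)) ≤
      rk E * Nat.card (β.stab φ ⊓ B : Subgroup A) := by
  set H := (β.stab φ).subgroupOf B with hH
  let P : (B ⧸ H) × Fin d → End F M := fun q => ρ (act F φ (q.1.out : B) (β.e q.2 q.2))
  have key := card_mul_le_rk P E ?_ ?_ ?_ (rk (ρ (β.e i₀ i₀) * E)) ?_
  · rw [Nat.card_prod, Nat.card_fin] at key
    have h1 : Nat.card (B ⧸ H) = (β.stab φ).relIndex B := rfl
    rw [h1] at key
    rw [← card_inf_mul_relIndex (β.stab φ) B]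
    calc _ = (β.stab φ).relIndex B * d * rk (ρ (β.e i₀ i₀) * E) *
          Nat.card (β.stab φ ⊓ B : Subgroup A) := by ring
      _ ≤ _ := Nat.mul_le_mul_right _ key
  · rintro ⟨q, i⟩ ⟨q', j⟩ hne
    simp only [P]
    rw [← map_mul]
    by_cases hq : q = q'
    · subst hq
      have hij : i ≠ j := fun hij => hne (by rw [hij])
      rw [← map_mul, β.e_mul_e_of_ne _ _ hij, map_zero, map_zero]
    · have hs : ((q.out⁻¹ * q'.out : B) : A) ∉ β.stab φ := by
        intro hmem
        apply hq
        rw [← q.out_eq', ← q'.out_eq']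
        exact QuotientGroup.eq.2 (Subgroup.mem_subgroupOf.2 hmem)
      have h0 := congrArg (act F φ (q.out : B)) (β.c_mul_act_c φ _ hs)
      simp only [map_mul, map_zero, act_act, Subgroup.coe_mul, Subgroup.coe_inv,
        mul_inv_cancel_left] at h0
      rw [← β.e_mul_c i, ← β.c_mul_e j, map_mul (act F φ _), map_mul (act F φ _), mul_assoc,
        ← mul_assoc _ _ (act F φ _ (β.e j j)), h0, zero_mul, mul_zero, map_zero]
  · intro q
    simp only [P]
    rw [← map_mul, ← map_mul, β.e_mul_e]
  · intro q
    exact hE.1 _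
  · rintro ⟨q, j⟩
    simp only [P]
    rw [h.conj]
    set b := q.out
    have h1 : u b⁻¹ * u b = 1 := by rw [← map_mul, inv_mul_cancel, map_one]
    have h2 : ρ (β.e i₀ i₀) * E = (ρ (β.e i₀ j) * u b⁻¹) * (u b * ρ (β.e j j) * u b⁻¹ * E) *
        (u b * ρ (β.e j i₀)) := by
      have h3 : E * (u b * ρ (β.e j i₀)) = u b * ρ (β.e j i₀) * E := by
        rw [← mul_assoc, hE.2, mul_assoc, hE.1, mul_assoc]
      calc ρ (β.e i₀ i₀) * E = ρ (β.e i₀ j * β.e j j * β.e j i₀) * E := by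
            rw [β.e_mul_e, β.e_mul_e]
        _ = ρ (β.e i₀ j) * (1 : End F M) * ρ (β.e j j) * 1 * ρ (β.e j i₀) * E := by
            simp only [map_mul, mul_one]
        _ = ρ (β.e i₀ j) * (u b⁻¹ * u b) * ρ (β.e j j) * (u b⁻¹ * u b) * ρ (β.e j i₀) * E := by
            rw [h1]
        _ = (ρ (β.e i₀ j) * u b⁻¹) * (u b * ρ (β.e j j) * u b⁻¹) *
              (u b * ρ (β.e j i₀) * E) := by simp only [mul_assoc]
        _ = _ := by rw [← h3]; simp only [mul_assoc]
    conv_lhs => rw [h2]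
    exact rk_conj_le _ _ _

/-- Whenever `x` acts nontrivially on a (submodule of a) representation of `N ⋊ B`, the group `B`
is small compared to its dimension. -/
def Good (φ : A →* MulAut N) (x : F[N]) : Prop :=
  ∀ (B : Subgroup A) (M : Type) [AddCommGroup M] [Module F M] [FiniteDimensional F M]
    (ρ : F[N] →ₐ[F] End F M) (u : B →* End F M) (E : End F M), Compat φ B ρ u →
    CommutesWith ρ u E → ρ x * E ≠ 0 →
    Nat.card B ≤ rk E * Nat.card (φ.ker ⊓ B : Subgroup A)

/-- The action `φ` has a block with large dimension compared to its stabilizer. -/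
def HasBigBlock (F : Type) [Field F] (φ : A →* MulAut N) : Prop :=
  ∃ d, ∃ β : Block F N d, Nat.card (β.stab φ) ≤ d * Nat.card φ.ker

lemma Block.rho_e_mul_ne_zero {d : ℕ} (β : Block F N d) {M : Type} [AddCommGroup M] [Module F M]
    (ρ : F[N] →ₐ[F] End F M) (E : End F M) (hE : ∀ x, E * ρ x = ρ x * E)
    (h : ρ β.c * E ≠ 0) (i₀ : Fin d) : ρ (β.e i₀ i₀) * E ≠ 0 := by
  intro h0
  apply h
  rw [← β.sum_e, map_sum, Finset.sum_mul]
  refine Finset.sum_eq_zero fun i _ => ?_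
  rw [← β.e_mul_e i i₀ i, ← β.e_mul_e i₀ i₀ i, map_mul, map_mul, mul_assoc, mul_assoc, ← hE,
    ← mul_assoc (ρ (β.e i₀ i₀)), h0, zero_mul, mul_zero]

lemma Block.card_stab_inf_le (φ : A →* MulAut N) {d : ℕ} (β : Block F N d)
    (hβ : Nat.card (β.stab φ) ≤ d * Nat.card φ.ker) (B : Subgroup A) :
    Nat.card (β.stab φ ⊓ B : Subgroup A) ≤ Nat.card (φ.ker ⊓ B : Subgroup A) * d := by
  have h3 := card_inf_mul_relIndex φ.ker (β.stab φ)
  rw [inf_eq_left.2 (β.ker_le_stab φ)] at h3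
  have h4 : φ.ker.relIndex (β.stab φ) ≤ d := by
    rw [← h3, mul_comm] at hβ
    exact Nat.le_of_mul_le_mul_right hβ Nat.card_pos
  have h5 : φ.ker.relIndex (β.stab φ ⊓ B) ≤ φ.ker.relIndex (β.stab φ) :=
    Subgroup.relIndex_le_of_le_right inf_le_left Subgroup.index_ne_zero_of_finite
  have h6 := card_inf_mul_relIndex φ.ker (β.stab φ ⊓ B)
  rw [← inf_assoc, inf_eq_left.2 (β.ker_le_stab φ)] at h6
  rw [← h6]
  gcongr
  exact h5.trans h4

lemma Block.good (φ : A →* MulAut N) {d : ℕ} (β : Block F N d)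
    (hβ : Nat.card (β.stab φ) ≤ d * Nat.card φ.ker) : Good φ β.c := by
  intro B M _ _ _ ρ u E h hE hne
  let i₀ : Fin d := ⟨0, β.pos⟩
  have h1 := β.card_mul_rk_le φ B ρ u h E hE i₀
  have h2 := rk_pos (β.rho_e_mul_ne_zero ρ E hE.1 hne i₀)
  have h7 : d * Nat.card B ≤ d * (rk E * Nat.card (φ.ker ⊓ B : Subgroup A)) := by
    calc d * Nat.card B = Nat.card B * (d * 1) := by ring
      _ ≤ Nat.card B * (d * rk (ρ (β.e i₀ i₀) * E)) := by gcongr; exact h2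
      _ ≤ _ := h1
      _ ≤ rk E * (Nat.card (φ.ker ⊓ B : Subgroup A) * d) := by
          gcongr; exact β.card_stab_inf_le φ hβ B
      _ = _ := by ring
  exact Nat.le_of_mul_le_mul_left h7 β.pos

end Count

section Restriction

variable {F : Type} [Field F] {N : Type} [Group N] {A : Type} [CommGroup A]

/-- The subgroup `R` is invariant under the action `φ`. -/
def Invt (φ : A →* MulAut N) (R : Subgroup N) : Prop := ∀ a, ∀ n ∈ R, φ a n ∈ R

/-- The restriction of an action to an invariant subgroup. -/
def res (φ : A →* MulAut N) (R : Subgroup N) (h : Invt φ R) : A →* MulAut R where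
  toFun a :=
    { toFun := fun n => ⟨φ a n, h a n n.2⟩
      invFun := fun n => ⟨φ a⁻¹ n, h a⁻¹ n n.2⟩
      left_inv := fun n => by simp
      right_inv := fun n => by simp
      map_mul' := fun m n => by simp }
  map_one' := by ext; simp
  map_mul' a b := by ext; simp

@[simp] lemma coe_res (φ : A →* MulAut N) (R : Subgroup N) (h : Invt φ R) (a : A) (n : R) :
    (res φ R h a n : N) = φ a n := rfl

lemma mem_ker_res (φ : A →* MulAut N) (R : Subgroup N) (h : Invt φ R) (a : A) :
    a ∈ (res φ R h).ker ↔ ∀ n ∈ R, φ a n = n := by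
  rw [MonoidHom.mem_ker]
  constructor
  · intro h n hn
    have := DFunLike.congr_fun h (⟨n, hn⟩ : R)
    simpa using congrArg Subtype.val this
  · intro h
    ext n
    simpa using h n n.2

/-- The inclusion of group algebras induced by a subgroup. -/
noncomputable def inc (F : Type) [Field F] {N : Type} [Group N] (R : Subgroup N) :
    F[R] →ₐ[F] F[N] :=
  mapDomainAlgHom F F R.subtype

@[simp] lemma inc_single (R : Subgroup N) (n : R) (r : F) :
    inc F R (single n r) = single (n : N) r := by
  simp [inc]

lemma inc_injective (R : Subgroup N) : Function.Injective (inc F R) :=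
  mapDomain_injective R.subtype_injective

lemma act_inc (φ : A →* MulAut N) (R : Subgroup N) (h : Invt φ R) (a : A) (x : F[R]) :
    act F φ a (inc F R x) = inc F R (act F (res φ R h) a x) := by
  induction x using MonoidAlgebra.induction_linear with
  | zero => simp
  | add x y hx hy => simp only [map_add, hx, hy]
  | single n r => simp

/-- The projection onto the group algebra of a subgroup, forgetting the other coefficients. -/
noncomputable def proj (F : Type) [Field F] {N : Type} [Group N] (R : Subgroup N) :
    F[N] →ₗ[F] F[R] where
  toFun x := comapDomain R.subtype R.subtype_injective x
  map_add' x y := comapDomain_add _ _ _ _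
  map_smul' r x := by ext; simp

lemma coeff_proj (R : Subgroup N) (x : F[N]) (n : R) : (proj F R x).coeff n = x.coeff n := by
  simp [proj]

lemma proj_single_of_mem (R : Subgroup N) {n : N} (hn : n ∈ R) (r : F) :
    proj F R (single n r) = single ⟨n, hn⟩ r :=
  comapDomain_single_map R.subtype R.subtype_injective ⟨n, hn⟩ r

lemma proj_single_of_notMem (R : Subgroup N) {n : N} (hn : n ∉ R) (r : F) :
    proj F R (single n r) = 0 :=
  comapDomain_single_of_not_mem_range (by simpa using hn) R.subtype_injective

lemma proj_inc_mul (R : Subgroup N) (x : F[R]) (y : F[N]) :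
    proj F R (inc F R x * y) = x * proj F R y := by
  induction x using MonoidAlgebra.induction_linear with
  | zero => simp
  | add x x' hx hx' => simp only [map_add, add_mul, hx, hx']
  | single n r =>
    induction y using MonoidAlgebra.induction_linear with
    | zero => simp
    | add y y' hy hy' => simp only [map_add, mul_add, hy, hy']
    | single m s =>
      rw [inc_single, single_mul_single]
      by_cases hm : m ∈ R
      · rw [proj_single_of_mem R (mul_mem n.2 hm), proj_single_of_mem R hm, single_mul_single]
        rfl
      · rw [proj_single_of_notMem R hm, mul_zero, proj_single_of_notMem]
        rwa [Subgroup.mul_mem_cancel_left _ n.2]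

lemma proj_mul_inc (R : Subgroup N) (x : F[R]) (y : F[N]) :
    proj F R (y * inc F R x) = proj F R y * x := by
  induction x using MonoidAlgebra.induction_linear with
  | zero => simp
  | add x x' hx hx' => simp only [map_add, mul_add, hx, hx']
  | single n r =>
    induction y using MonoidAlgebra.induction_linear with
    | zero => simp
    | add y y' hy hy' => simp only [map_add, add_mul, hy, hy']
    | single m s =>
      rw [inc_single, single_mul_single]
      by_cases hm : m ∈ R
      · rw [proj_single_of_mem R (mul_mem hm n.2), proj_single_of_mem R hm, single_mul_single]
        rfl
      · rw [proj_single_of_notMem R hm, zero_mul, proj_single_of_notMem]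
        rwa [Subgroup.mul_mem_cancel_right _ n.2]

lemma proj_one (R : Subgroup N) : proj F R 1 = 1 :=
  proj_single_of_mem R R.one_mem 1

lemma proj_inc (R : Subgroup N) (x : F[R]) : proj F R (inc F R x) = x := by
  rw [← mul_one (inc F R x), proj_inc_mul, proj_one, mul_one]

lemma proj_act (φ : A →* MulAut N) (R : Subgroup N) (h : Invt φ R) (a : A) (x : F[N]) :
    proj F R (act F φ a x) = act F (res φ R h) a (proj F R x) := by
  induction x using MonoidAlgebra.induction_linear with
  | zero => simp
  | add x y hx hy => simp only [map_add, hx, hy]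
  | single n r =>
    rw [act_single]
    by_cases hn : n ∈ R
    · rw [proj_single_of_mem R hn, proj_single_of_mem R (h a n hn), act_single]
      rfl
    · rw [proj_single_of_notMem R hn, map_zero, proj_single_of_notMem]
      intro h'
      apply hn
      simpa using h a⁻¹ _ h'

lemma proj_inc_of_disjoint (R S : Subgroup N) (h : R ⊓ S = ⊥) (x : F[S]) :
    proj F R (inc F S x) = single 1 (x.coeff 1) := by
  induction x using MonoidAlgebra.induction_linear with
  | zero => simp
  | add x y hx hy => simp [map_add, hx, hy]
  | single n r =>
    rw [inc_single]
    by_cases hn : (n : N) ∈ R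
    · have h1 : (n : N) ∈ R ⊓ S := ⟨hn, n.2⟩
      rw [h, Subgroup.mem_bot] at h1
      have h2 : n = 1 := Subtype.ext h1
      subst h2
      rw [proj_single_of_mem R hn]
      simp
      rfl
    · rw [proj_single_of_notMem R hn]
      have : n ≠ 1 := by
        rintro rfl
        exact hn R.one_mem
      simp [this]

lemma inc_mul_inc_ne_zero (R S : Subgroup N) (h : R ⊓ S = ⊥) {x : F[R]} {y : F[S]} (hx : x ≠ 0)
    (hy : y ≠ 0) : inc F R x * inc F S y ≠ 0 := by
  intro h0
  have hy' : ∃ s, y.coeff s ≠ 0 := by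
    by_contra! hs
    apply hy
    ext s
    simpa using hs s
  obtain ⟨s, hs⟩ := hy'
  have h1 := proj_inc_mul R x (inc F S (y * single s⁻¹ 1))
  rw [map_mul (inc F S), ← mul_assoc, h0, zero_mul, map_zero, ← map_mul,
    proj_inc_of_disjoint R S h] at h1
  have h2 : (y * single s⁻¹ (1 : F)).coeff 1 = y.coeff s := by
    rw [coeff_mul_single_apply]; simp
  rw [h2] at h1
  have h3 : single (1 : R) (y.coeff s) = y.coeff s • (1 : F[R]) := by
    simp [one_def]
  rw [h3, mul_smul_comm, mul_one] at h1
  exact (smul_ne_zero hs hx) h1.symm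

lemma neZero_card_subgroup [NeZero (Nat.card N : F)] (R : Subgroup N) :
    NeZero (Nat.card R : F) := by
  refine ⟨fun h => NeZero.ne (Nat.card N : F) ?_⟩
  obtain ⟨k, hk⟩ := R.card_subgroup_dvd_card
  rw [hk, Nat.cast_mul, h, zero_mul]

lemma Compat.restrict {φ : A →* MulAut N} {B : Subgroup A} {M : Type} [AddCommGroup M]
    [Module F M] {ρ : F[N] →ₐ[F] End F M} {u : B →* End F M} (h : Compat φ B ρ u)
    (R : Subgroup N) (hR : Invt φ R) : Compat (res φ R hR) B (ρ.comp (inc F R)) u := by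
  intro b x
  rw [AlgHom.comp_apply, h, act_inc φ R hR]
  rfl

lemma Compat.mono {φ : A →* MulAut N} {B : Subgroup A} {M : Type} [AddCommGroup M]
    [Module F M] {ρ : F[N] →ₐ[F] End F M} {u : B →* End F M} (h : Compat φ B ρ u)
    {C : Subgroup A} (hC : C ≤ B) : Compat φ C ρ (u.comp (Subgroup.inclusion hC)) := by
  intro b x
  exact h (Subgroup.inclusion hC b) x

variable [Finite A]

lemma HasBigBlock.of_good {d : ℕ} (φ : A →* MulAut N) (β : Block F N d)
    (h : Nat.card (β.stab φ) ≤ d) : HasBigBlock F φ :=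
  ⟨d, β, h.trans (Nat.le_mul_of_pos_right _ Nat.card_pos)⟩

lemma rk_one_fun (d : ℕ) : rk (1 : End F (Fin d → F)) = d := by
  rw [rk, Module.End.one_eq_id, LinearMap.range_id, finrank_top, Module.finrank_fin_fun]

variable [Finite N] [NeZero (Nat.card N : F)]
variable [IsAlgClosed F] {p : ℕ} [ExpChar F p] {n : ℕ}

lemma HasBigBlock.of_subgroup (hA : ∀ a : A, a ^ p ^ n = 1) (φ : A →* MulAut N)
    (R : Subgroup N) (hR : Invt φ R) (hker : (res φ R hR).ker = ⊥)
    (h : HasBigBlock F (res φ R hR)) : HasBigBlock F φ := by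
  obtain ⟨d₀, β₀, h₀⟩ := h
  have hne : inc F R β₀.c ≠ 0 := by
    rw [Ne, map_eq_zero_iff _ (inc_injective R)]
    exact β₀.c_ne_zero
  obtain ⟨d, β, hβ⟩ := exists_block _ hne
  obtain ⟨u, hu⟩ := β.exists_compat hA φ
  refine .of_good φ β ?_
  have := β₀.good _ h₀ (β.stab φ) _ _ u 1 (hu.restrict R hR) (.one _ _) (by simpa using hβ)
  rwa [hker, bot_inf_eq, Subgroup.card_bot, mul_one, rk_one_fun] at this

lemma HasBigBlock.of_prod (hA : ∀ a : A, a ^ p ^ n = 1) (φ : A →* MulAut N)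
    (R S : Subgroup N) (hR : Invt φ R) (hS : Invt φ S) (hRS : R ⊓ S = ⊥)
    (hcomm : ∀ r ∈ R, ∀ s ∈ S, r * s = s * r)
    (hker : (res φ R hR).ker ⊓ (res φ S hS).ker = ⊥)
    (h₁ : HasBigBlock F (res φ R hR)) (h₂ : HasBigBlock F (res φ S hS)) : HasBigBlock F φ := by
  obtain ⟨d₁, β₁, h₁⟩ := h₁
  obtain ⟨d₂, β₂, h₂⟩ := h₂
  let i₀ : Fin d₁ := ⟨0, β₁.pos⟩
  set e := β₁.e i₀ i₀ with he
  obtain ⟨d, β, hβ⟩ := exists_block _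
    (inc_mul_inc_ne_zero R S hRS (β₁.e_ne_zero i₀ i₀) β₂.c_ne_zero)
  set B := β.stab φ with hB
  obtain ⟨u, hu⟩ := β.exists_compat hA φ
  refine .of_good φ β ?_
  have hc : ∀ x y, inc F R x * inc F S y = inc F S y * inc F R x := by
    intro x y
    induction x using MonoidAlgebra.induction_linear with
    | zero => simp
    | add x x' hx hx' => simp only [map_add, add_mul, mul_add, hx, hx']
    | single r a =>
      induction y using MonoidAlgebra.induction_linear with
      | zero => simp
      | add y y' hy hy' => simp only [map_add, mul_add, add_mul, hy, hy']
      | single s b =>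
        simp only [inc_single, single_mul_single, hcomm r r.2 s s.2, mul_comm]
  set L := (res φ R hR).ker
  set E := β.σ (inc F R e)
  have hE : E ≠ 0 := by
    intro h0
    apply hβ
    rw [map_mul]
    exact (congrArg (· * _) h0).trans (zero_mul _)
  have k1 := β₁.card_mul_rk_le _ B _ u
    (hu.restrict R hR) 1 (.one _ _) i₀
  rw [rk_one_fun, mul_one, AlgHom.comp_apply] at k1
  have k2 := β₁.card_stab_inf_le _ h₁ B
  have k3 := β₂.good _ h₂ (L ⊓ B) _ _ _ E ((hu.mono (C := L ⊓ B) inf_le_right).restrict S hS)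
    ⟨fun x => ?_, fun b => ?_⟩ ?_
  · rw [← inf_assoc, inf_comm _ L, hker, bot_inf_eq, Subgroup.card_bot, mul_one] at k3
    have k4 : Nat.card B * (d₁ * rk E) ≤ d * (d₁ * rk E) := by
      calc _ ≤ d * Nat.card (β₁.stab (res φ R hR) ⊓ B : Subgroup A) := k1
        _ ≤ d * (Nat.card (L ⊓ B : Subgroup A) * d₁) := by gcongr
        _ ≤ d * (rk E * d₁) := by gcongr
        _ = _ := by ring
    exact Nat.le_of_mul_le_mul_right k4 (Nat.mul_pos β₁.pos (rk_pos hE))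
  · rw [AlgHom.comp_apply, ← map_mul, ← map_mul, hc]
  · have := hu (Subgroup.inclusion inf_le_right b) (inc F R e)
    rw [act_inc φ R hR, Subgroup.coe_inclusion, act_of_mem_ker (res φ R hR) b.2.1] at this
    exact this.symm
  · rw [AlgHom.comp_apply, ← map_mul, ← hc]
    exact hβ

end Restriction

section Quotient

variable {F : Type} [Field F] {N : Type} [Group N] {A : Type} [CommGroup A]

/-- The action induced on the quotient by an invariant normal subgroup. -/
def quo (φ : A →* MulAut N) (Y : Subgroup N) [Y.Normal] (h : Invt φ Y) : A →* MulAut (N ⧸ Y) where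
  toFun a :=
    { toFun := QuotientGroup.map Y Y (φ a).toMonoidHom (fun n hn => h a n hn)
      invFun := QuotientGroup.map Y Y (φ a⁻¹).toMonoidHom (fun n hn => h a⁻¹ n hn)
      left_inv := fun x => by
        induction x using QuotientGroup.induction_on with | H n => simp
      right_inv := fun x => by
        induction x using QuotientGroup.induction_on with | H n => simp
      map_mul' := map_mul _ }
  map_one' := by
    ext x
    induction x using QuotientGroup.induction_on with | H n => simp
  map_mul' a b := by
    ext x
    induction x using QuotientGroup.induction_on with | H n => simp

lemma quo_mk (φ : A →* MulAut N) (Y : Subgroup N) [Y.Normal] (h : Invt φ Y) (a : A) (n : N) :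
    quo φ Y h a (n : N ⧸ Y) = ((φ a n : N) : N ⧸ Y) := rfl

lemma exists_map_eq (Y : Subgroup N) [Y.Normal] (x : F[N ⧸ Y]) :
    ∃ y, mapDomainAlgHom F F (QuotientGroup.mk' Y) y = x := by
  induction x using MonoidAlgebra.induction_linear with
  | zero => exact ⟨0, map_zero _⟩
  | add x y hx hy =>
    obtain ⟨x', rfl⟩ := hx
    obtain ⟨y', rfl⟩ := hy
    exact ⟨x' + y', map_add _ _ _⟩
  | single n r =>
    obtain ⟨n, rfl⟩ := QuotientGroup.mk_surjective n
    exact ⟨single n r, by rw [mapDomainAlgHom_apply, mapDomain_single]; rfl⟩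

lemma map_act (φ : A →* MulAut N) (Y : Subgroup N) [Y.Normal] (h : Invt φ Y) (a : A) (x : F[N]) :
    mapDomainAlgHom F F (QuotientGroup.mk' Y) (act F φ a x) =
      act F (quo φ Y h) a (mapDomainAlgHom F F (QuotientGroup.mk' Y) x) := by
  induction x using MonoidAlgebra.induction_linear with
  | zero => simp
  | add x y hx hy => rw [map_add, map_add, map_add, map_add, hx, hy]
  | single n r =>
    simp only [act_single, mapDomainAlgHom_apply, mapDomain_single]
    rfl

/-- The idempotent averaging over a subgroup. -/
noncomputable def avg (F : Type) [Field F] {N : Type} [Group N] [Finite N] (Y : Subgroup N) :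
    F[N] :=
  letI := Fintype.ofFinite Y
  (Nat.card Y : F)⁻¹ • ∑ y : Y, single (y : N) 1

variable [Finite N]

lemma single_mul_avg (Y : Subgroup N) {y : N} (hy : y ∈ Y) :
    single y (1 : F) * avg F Y = avg F Y := by
  let _ := Fintype.ofFinite Y
  rw [avg, mul_smul_comm, Finset.mul_sum]
  congr 1
  simp only [single_mul_single, one_mul]
  exact Fintype.sum_equiv (Equiv.mulLeft (⟨y, hy⟩ : Y)) _ _ (fun x => rfl)

lemma avg_mul_single (Y : Subgroup N) {y : N} (hy : y ∈ Y) :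
    avg F Y * single y (1 : F) = avg F Y := by
  let _ := Fintype.ofFinite Y
  rw [avg, smul_mul_assoc, Finset.sum_mul]
  congr 1
  simp only [single_mul_single, one_mul]
  exact Fintype.sum_equiv (Equiv.mulRight (⟨y, hy⟩ : Y)) _ _ (fun x => rfl)

lemma avg_mul_avg (Y : Subgroup N) (hY : (Nat.card Y : F) ≠ 0) : avg F Y * avg F Y = avg F Y := by
  let _ := Fintype.ofFinite Y
  conv_lhs => enter [1]; rw [avg]
  rw [smul_mul_assoc, Finset.sum_mul, Finset.sum_congr rfl (fun y _ => single_mul_avg Y y.2)]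
  rw [Finset.sum_const, Finset.card_univ, ← Nat.card_eq_fintype_card, ← Nat.cast_smul_eq_nsmul F,
    smul_smul, inv_mul_cancel₀ hY, one_smul]

lemma avg_comm (Y : Subgroup N) [hn : Y.Normal] (x : F[N]) : avg F Y * x = x * avg F Y := by
  let _ := Fintype.ofFinite Y
  induction x using MonoidAlgebra.induction_linear with
  | zero => simp
  | add x y hx hy => rw [add_mul, mul_add, hx, hy]
  | single n r =>
    rw [avg, smul_mul_assoc, mul_smul_comm, Finset.sum_mul, Finset.mul_sum]
    congr 1
    simp only [single_mul_single, mul_one, one_mul]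
    refine Fintype.sum_equiv (MulAut.conjNormal (n⁻¹ : N)).toEquiv _ _ (fun y => ?_)
    congr 1
    simp [mul_assoc]

lemma map_avg (Y : Subgroup N) [Y.Normal] (hY : (Nat.card Y : F) ≠ 0) :
    mapDomainAlgHom F F (QuotientGroup.mk' Y) (avg F Y) = 1 := by
  let _ := Fintype.ofFinite Y
  rw [avg, map_smul, map_sum]
  have : ∀ y : Y, mapDomainAlgHom F F (QuotientGroup.mk' Y) (single (y : N) (1 : F)) = 1 := by
    intro y
    rw [mapDomainAlgHom_apply, mapDomain_single, QuotientGroup.mk'_apply,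
      (QuotientGroup.eq_one_iff _).2 y.2]
    rfl
  rw [Finset.sum_congr rfl (fun y _ => this y), Finset.sum_const, Finset.card_univ,
    ← Nat.card_eq_fintype_card, ← Nat.cast_smul_eq_nsmul F, smul_smul, inv_mul_cancel₀ hY, one_smul]

/-- The multiplicative section of `F[N] → F[N ⧸ Y]` obtained by averaging over `Y`. -/
noncomputable def inflate (F : Type) [Field F] {N : Type} [Group N] [Finite N] (Y : Subgroup N)
    [Y.Normal] : F[N ⧸ Y] →ₗ[F] F[N] where
  toFun x := mapDomain Quotient.out x * avg F Y
  map_add' x y := by rw [mapDomain_add, add_mul]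
  map_smul' r x := by
    rw [← smul_mul_assoc, RingHom.id_apply]
    congr 1
    induction x using MonoidAlgebra.induction_linear with
    | zero => simp
    | add x y hx hy => rw [smul_add, mapDomain_add, hx, hy, mapDomain_add, smul_add]
    | single n s => simp

lemma inflate_single (Y : Subgroup N) [Y.Normal] (n : N) (r : F) :
    inflate F Y (single (n : N ⧸ Y) r) = single n r * avg F Y := by
  change mapDomain Quotient.out (single (n : N ⧸ Y) r) * avg F Y = _
  rw [mapDomain_single]
  obtain ⟨y, hy⟩ := QuotientGroup.mk_out_eq_mul Y n
  have h1 : (Quotient.out (n : N ⧸ Y) : N) = n * y := hy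
  rw [h1, ← mul_one r, ← single_mul_single, mul_assoc, single_mul_avg Y y.2, mul_one]

lemma inflate_map (Y : Subgroup N) [Y.Normal] (x : F[N]) :
    inflate F Y (mapDomainAlgHom F F (QuotientGroup.mk' Y) x) = x * avg F Y := by
  induction x using MonoidAlgebra.induction_linear with
  | zero => simp
  | add x y hx hy => rw [map_add, map_add, add_mul, hx, hy]
  | single n r =>
    rw [← inflate_single, mapDomainAlgHom_apply, mapDomain_single]
    rfl

lemma HasBigBlock.of_quotient [Finite A] [NeZero (Nat.card N : F)] (φ : A →* MulAut N)
    (Y : Subgroup N) [Y.Normal] (hY : Invt φ Y) (hker : (quo φ Y hY).ker = ⊥)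
    (h : HasBigBlock F (quo φ Y hY)) : HasBigBlock F φ := by
  obtain ⟨d, β, hβ⟩ := h
  have hYF : (Nat.card Y : F) ≠ 0 := (neZero_card_subgroup Y).ne
  set q := mapDomainAlgHom F F (QuotientGroup.mk' Y) with hq
  have hmul : ∀ x y, inflate F Y (x * y) = inflate F Y x * inflate F Y y := by
    intro x y
    obtain ⟨x, rfl⟩ := exists_map_eq Y x
    obtain ⟨y, rfl⟩ := exists_map_eq Y y
    rw [← map_mul, inflate_map, inflate_map, inflate_map, mul_assoc x (avg F Y),
      ← mul_assoc (avg F Y) y, avg_comm Y y, mul_assoc y, avg_mul_avg Y hYF, mul_assoc]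
  have hqi : ∀ x, q (inflate F Y x) = x := by
    intro x
    obtain ⟨x, rfl⟩ := exists_map_eq Y x
    rw [inflate_map, map_mul, map_avg Y hYF, mul_one]
  have hia : ∀ x y, inflate F Y x * inflate F Y (q y) = inflate F Y x * y := by
    intro x y
    obtain ⟨x, rfl⟩ := exists_map_eq Y x
    rw [inflate_map, inflate_map, mul_assoc, ← avg_comm, ← mul_assoc (avg F Y), avg_mul_avg Y hYF,
      mul_assoc]
  have hai : ∀ x y, inflate F Y (q y) * inflate F Y x = y * inflate F Y x := by
    intro x y
    obtain ⟨x, rfl⟩ := exists_map_eq Y x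
    rw [inflate_map, inflate_map, mul_assoc, ← mul_assoc _ x, avg_comm, mul_assoc x,
      avg_mul_avg Y hYF]
  let γ : Block F N d :=
    { σ := β.σ.comp q
      s := inflate F Y ∘ₗ β.s
      pos := β.pos
      s_mul := fun S T => by
        simp only [LinearMap.comp_apply]
        rw [β.s_mul, hmul]
      σ_s := fun T => by
        simp only [LinearMap.comp_apply, AlgHom.comp_apply]
        rw [hqi, β.σ_s]
      s_σ := fun x => by
        simp only [LinearMap.comp_apply, AlgHom.comp_apply]
        rw [β.s_σ, hmul, hia]
      central := fun x => by
        simp only [LinearMap.comp_apply]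
        rw [← hia (β.s 1) x, ← hai (β.s 1) x, ← hmul, ← hmul, β.central] }
  have hγ : γ.c = inflate F Y β.c := rfl
  refine .of_good φ γ ?_
  rw [hker, Subgroup.card_bot, mul_one] at hβ
  refine le_trans (Subgroup.card_le_of_le fun a ha => ?_) hβ
  rw [Block.mem_stab] at ha ⊢
  rw [← hqi β.c, ← map_act φ Y hY, ← hγ, ha]

lemma HasBigBlock.of_faithful [Finite A] (φ : A →* MulAut N)
    (h : HasBigBlock F (QuotientGroup.kerLift φ)) : HasBigBlock F φ := by
  obtain ⟨d, β, hβ⟩ := h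
  refine ⟨d, β, ?_⟩
  have h1 : (QuotientGroup.kerLift φ).ker = ⊥ :=
    (MonoidHom.ker_eq_bot_iff _).2 (QuotientGroup.kerLift_injective φ)
  rw [h1, Subgroup.card_bot, mul_one] at hβ
  have h2 : β.stab φ = (β.stab (QuotientGroup.kerLift φ)).comap (QuotientGroup.mk' φ.ker) := by
    ext a
    rw [Subgroup.mem_comap, Block.mem_stab, Block.mem_stab]
    rfl
  have h3 := card_inf_mul_relIndex φ.ker (β.stab φ)
  rw [inf_eq_left.2 (β.ker_le_stab φ)] at h3
  rw [← h3, mul_comm]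
  refine Nat.mul_le_mul_right _ ?_
  have h4 := Subgroup.relIndex_ker (β.stab φ) (QuotientGroup.mk' φ.ker)
  rw [QuotientGroup.ker_mk'] at h4
  rw [h4]
  refine le_trans (Subgroup.card_le_of_le ?_) hβ
  rw [h2]
  exact Subgroup.map_comap_le _ _

end Quotient

section FreeOrbits

variable {N : Type} [Group N] {A : Type} [CommGroup A]

/-- Nontrivial elements of `K` only fix elements of `R`. -/
def FreeOff (φ : A →* MulAut N) (K : Subgroup A) (R : Subgroup N) : Prop :=
  ∀ k ∈ K, k ≠ 1 → ∀ n, φ k n = n → n ∈ R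

lemma FreeOff.mono {φ : A →* MulAut N} {K K' : Subgroup A} {R : Subgroup N}
    (h : FreeOff φ K R) (hK : K' ≤ K) : FreeOff φ K' R :=
  fun k hk => h k (hK hk)

lemma FreeOff.exists_reps {φ : A →* MulAut N} {K : Subgroup A} {R : Subgroup N}
    (h : FreeOff φ K R) : ∃ T : Set N, ∀ n ∉ R, ∃! k : K, φ k n ∈ T := by
  let s : Setoid N :=
    { r := fun m n => ∃ k : K, φ k m = n
      iseqv :=
        { refl := fun n => ⟨1, by simp⟩
          symm := by
            rintro m n ⟨k, rfl⟩
            exact ⟨k⁻¹, by simp⟩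
          trans := by
            rintro m n o ⟨k, rfl⟩ ⟨l, rfl⟩
            exact ⟨l * k, by simp⟩ } }
  refine ⟨Set.range (Quotient.out : Quotient s → N), fun n hn => ?_⟩
  obtain ⟨k, hk⟩ : s.r n (Quotient.mk s n).out := s.symm (Quotient.mk_out n)
  refine ⟨k, ⟨_, hk.symm⟩, ?_⟩
  rintro l ⟨q, hq⟩
  have h1 : q = Quotient.mk s n := by
    rw [← Quotient.out_eq q, hq]
    exact Quotient.sound (s.symm ⟨l, rfl⟩)
  rw [h1, ← hk] at hq
  by_contra hne
  refine hn (h (l⁻¹ * k : K) (l⁻¹ * k : K).2 ?_ n ?_)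
  · intro h2
    exact hne (inv_mul_eq_one.1 (Subtype.ext h2))
  · simp [hq]

lemma FreeOff.index_modEq [Finite N] {φ : A →* MulAut N} {K : Subgroup A}
    {R : Subgroup N} (h : FreeOff φ K R) (hKR : ∀ k ∈ K, ∀ n ∈ R, φ k n = n) {H : Subgroup N}
    (hH : ∀ k ∈ K, ∀ n ∈ H, φ k n ∈ H) (hcop : (Nat.card N).Coprime (Nat.card K)) :
    R.relIndex H ≡ 1 [MOD Nat.card K] := by
  obtain ⟨T, hT⟩ := h.exists_reps
  have hKR' : ∀ k : K, ∀ n, φ k n ∈ R → n ∈ R := by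
    intro k n hn
    have := hKR (k⁻¹ : K) (k⁻¹ : K).2 _ hn
    rw [← this] at hn
    simpa using hn
  let e : {n : H // (n : N) ∉ R} ≃ K × {n : N // n ∈ T ∧ n ∈ H ∧ n ∉ R} :=
    { toFun := fun n => ((hT n n.2).choose, ⟨φ (hT n n.2).choose n,
        (hT n n.2).choose_spec.1, hH _ (hT n n.2).choose.2 _ n.1.2, fun hn => n.2 (hKR' _ _ hn)⟩)
      invFun := fun x => ⟨⟨φ (x.1⁻¹ : K) x.2, hH _ (x.1⁻¹ : K).2 _ x.2.2.2.1⟩,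
        fun hn => x.2.2.2.2 (hKR' _ _ hn)⟩
      left_inv := fun n => by
        ext
        simp
      right_inv := by
        rintro ⟨k, n, hnT, hnH, hnR⟩
        have h1 : ((φ (k⁻¹ : K)) n : N) ∉ R := fun hn => hnR (hKR' _ _ hn)
        have h2 := (hT _ h1).choose_spec
        have h3 : k = (hT _ h1).choose := h2.2 k (by simpa using hnT)
        refine Prod.ext h3.symm (Subtype.ext ?_)
        change φ ((hT _ h1).choose : A) _ = n
        rw [← h3]
        simp }
  have h1 : Nat.card K ∣ Nat.card {n : H // (n : N) ∉ R} := by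
    rw [Nat.card_congr e, Nat.card_prod]
    exact dvd_mul_right _ _
  classical
  have h2 : Nat.card H = Nat.card (R.subgroupOf H) + Nat.card {n : H // (n : N) ∉ R} := by
    rw [← Nat.card_congr (Equiv.sumCompl (fun n : H => (n : N) ∈ R)), Nat.card_sum]
    rfl
  have h3 : Nat.card H = Nat.card (R.subgroupOf H) * R.relIndex H :=
    (Subgroup.card_mul_index _).symm
  have h4 : Nat.card (R.subgroupOf H) * R.relIndex H ≡ Nat.card (R.subgroupOf H) * 1
      [MOD Nat.card K] := by
    rw [← h3, h2, mul_one]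
    exact (Nat.modEq_iff_dvd' (Nat.le_add_right _ _)).2 (by simpa using h1) |>.symm
  refine Nat.ModEq.cancel_left_of_coprime ?_ h4
  rw [Nat.gcd_comm]
  have h5 : Nat.card (R.subgroupOf H) ∣ Nat.card N :=
    (Subgroup.card_subgroup_dvd_card _).trans (Subgroup.card_subgroup_dvd_card _)
  exact Nat.Coprime.coprime_dvd_left h5 hcop

end FreeOrbits

section Trace

variable {F : Type} [Field F] {N : Type} [Group N] {A : Type} [CommGroup A] [Finite A]

/-- The sum of the translates of an element of `F[N]` under a subgroup of `A`. -/
noncomputable def tr (F : Type) [Field F] {N : Type} [Group N] {A : Type} [CommGroup A] [Finite A]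
    (φ : A →* MulAut N) (K : Subgroup A) (z : F[N]) : F[N] :=
  letI := Fintype.ofFinite K
  ∑ k : K, act F φ k z

lemma tr_mul (φ : A →* MulAut N) (K : Subgroup A) (z : F[N]) {x : F[N]}
    (hx : ∀ k ∈ K, act F φ k x = x) : tr F φ K z * x = tr F φ K (z * x) := by
  rw [tr, tr, Finset.sum_mul]
  refine Finset.sum_congr rfl fun k _ => ?_
  rw [map_mul (act F φ (k : A)), hx k k.2]

lemma proj_tr (φ : A →* MulAut N) (R : Subgroup N) (hR : Invt φ R) (K : Subgroup A)
    (hK : K ≤ (res φ R hR).ker) (hKF : (Nat.card K : F) = 0) (z : F[N]) :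
    proj F R (tr F φ K z) = 0 := by
  let _ := Fintype.ofFinite K
  rw [tr, map_sum]
  have : ∀ k : K, proj F R (act F φ k z) = proj F R z := by
    intro k
    rw [proj_act φ R hR, act_of_mem_ker _ (hK k.2)]
  rw [Finset.sum_congr rfl (fun k _ => this k), Finset.sum_const, Finset.card_univ,
    ← Nat.card_eq_fintype_card, ← Nat.cast_smul_eq_nsmul F, hKF, zero_smul]

omit [Finite A] in
lemma coeff_act (φ : A →* MulAut N) (a : A) (x : F[N]) (n : N) :
    (act F φ a x).coeff n = x.coeff (φ a⁻¹ n) := by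
  induction x using MonoidAlgebra.induction_linear with
  | zero => simp
  | add x y hx hy => simp only [map_add, coeff_add, Finsupp.add_apply, hx, hy]
  | single m r =>
    classical
    rw [act_single, coeff_single, coeff_single, Finsupp.single_apply, Finsupp.single_apply]
    congr 1
    rw [map_inv, MulAut.inv_apply, MulEquiv.eq_symm_apply]

lemma FreeOff.exists_eq_tr [Finite N] {φ : A →* MulAut N} {K : Subgroup A} {R : Subgroup N}
    (h : FreeOff φ K R) {y : F[N]} (hy : ∀ k ∈ K, act F φ k y = y) (hp : proj F R y = 0) :
    ∃ z, y = tr F φ K z := by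
  classical
  let _ := Fintype.ofFinite N
  let _ := Fintype.ofFinite K
  obtain ⟨T, hT⟩ := h.exists_reps
  have hz : ∃ z : F[N], ∀ n, z.coeff n = if n ∈ T then y.coeff n else 0 := by
    refine ⟨ofCoeff (Finsupp.equivFunOnFinite.symm fun n => if n ∈ T then y.coeff n else 0),
      fun n => rfl⟩
  obtain ⟨z, hz⟩ := hz
  refine ⟨z, ?_⟩
  ext n
  have h1 : (tr F φ K z).coeff n = ∑ k : K, (act F φ k z).coeff n := by
    rw [tr, coeff_sum, Finsupp.finsetSum_apply]
  have h2 : ∀ k : K, y.coeff (φ k⁻¹ n) = y.coeff n := by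
    intro k
    rw [← coeff_act, hy k k.2]
  have h3 : ∀ k : K, (act F φ k z).coeff n = if φ (k⁻¹ : K) n ∈ T then y.coeff n else 0 := by
    intro k
    rw [coeff_act, hz, h2]
    rfl
  rw [h1, Finset.sum_congr rfl (fun k _ => h3 k)]
  by_cases hn : n ∈ R
  · have : y.coeff n = 0 := by
      rw [← coeff_proj R y ⟨n, hn⟩, hp]; rfl
    simp [this]
  · obtain ⟨k, hk, huniq⟩ := hT n hn
    rw [Finset.sum_eq_single k⁻¹]
    · rw [inv_inv, if_pos hk]
    · intro l _ hl
      rw [if_neg]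
      intro h4
      exact hl (inv_eq_iff_eq_inv.1 (huniq _ h4))
    · simp

end Trace

section FixedVectors

variable {F : Type} [Field F] {p : ℕ} [ExpChar F p] {n : ℕ}
variable {M : Type} [AddCommGroup M] [Module F M] [FiniteDimensional F M]

/-- Commuting operators of `p`-power order in characteristic `p` have a common fixed vector in any
nonzero invariant subspace. -/
lemma exists_fixed_vector {I : Type} (f : I → End F M) (hcomm : ∀ i j, f i * f j = f j * f i)
    (hf : ∀ i, f i ^ p ^ n = 1) (W : Submodule F M) (hW : W ≠ ⊥)
    (hinv : ∀ i, ∀ w ∈ W, f i w ∈ W) : ∃ w ∈ W, w ≠ 0 ∧ ∀ i, f i w = w := by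
  let S : Set (Submodule F M) := {U | U ≠ ⊥ ∧ U ≤ W ∧ ∀ i, ∀ w ∈ U, f i w ∈ U}
  obtain ⟨U, ⟨hU, hUW, hUinv⟩, hmin⟩ :=
    (wellFounded_lt (α := Submodule F M)).has_min S ⟨W, hW, le_rfl, hinv⟩
  have key : ∀ i, ∀ w ∈ U, f i w = w := by
    intro i
    have : Nontrivial M := by
      obtain ⟨w, _, hw0⟩ := U.exists_mem_ne_zero_of_ne_bot hU
      exact ⟨w, 0, hw0⟩
    have : ExpChar (End F M) p := expChar_of_injective_algebraMap
      (FaithfulSMul.algebraMap_injective F (End F M)) p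
    obtain ⟨g, hg⟩ : ∃ g : End F M, g = f i - 1 := ⟨_, rfl⟩
    have hg' : ∀ w, g w = f i w - w := fun w => by rw [hg]; rfl
    have hnil : g ^ p ^ n = 0 := by
      rw [hg, sub_pow_expChar_pow_of_commute (p := p) n (Commute.one_right (f i)), hf, one_pow,
        sub_self]
    have hpow : ∀ k : ℕ, ∀ w ∈ U, (g ^ k) w ∈ U := by
      intro k
      induction k with
      | zero => intro w hw; simpa using hw
      | succ k ih =>
        intro w hw
        rw [pow_succ', Module.End.mul_apply, hg']
        exact U.sub_mem (hUinv i _ (ih w hw)) (ih w hw)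
    let U' := U ⊓ LinearMap.ker g
    have hU' : U' ≠ ⊥ := by
      obtain ⟨w, hw, hw0⟩ := U.exists_mem_ne_zero_of_ne_bot hU
      classical
      have hex : ∃ k : ℕ, (g ^ k) w = 0 := ⟨p ^ n, by rw [hnil]; rfl⟩
      have hpos : Nat.find hex ≠ 0 := fun h => hw0 (by simpa [h] using Nat.find_spec hex)
      obtain ⟨k, hk⟩ := Nat.exists_eq_succ_of_ne_zero hpos
      intro h
      have hmem : (g ^ k) w ∈ U' := by
        refine ⟨hpow k w hw, ?_⟩
        rw [SetLike.mem_coe, LinearMap.mem_ker, ← Module.End.mul_apply, ← pow_succ']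
        have := Nat.find_spec hex
        rwa [hk] at this
      rw [h, Submodule.mem_bot] at hmem
      exact Nat.find_min hex (by omega) hmem
    have hle : U ≤ U' := by
      by_contra hnot
      refine hmin U' ⟨hU', inf_le_left.trans hUW, ?_⟩
        (lt_of_le_of_ne inf_le_left fun h => hnot h.ge)
      rintro j w ⟨hw, hw'⟩
      refine ⟨hUinv j w hw, ?_⟩
      rw [SetLike.mem_coe, LinearMap.mem_ker, hg', sub_eq_zero] at hw' ⊢
      rw [← Module.End.mul_apply, hcomm, Module.End.mul_apply, hw']
    intro w hw
    have := (hle hw).2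
    rwa [SetLike.mem_coe, LinearMap.mem_ker, hg', sub_eq_zero] at this
  obtain ⟨w, hw, hw0⟩ := U.exists_mem_ne_zero_of_ne_bot hU
  exact ⟨w, hUW hw, hw0, fun i => key i w hw⟩

/-- The sum of the operators of a finite group. -/
noncomputable def opSum {K : Type} [Group K] [Finite K] (u : K →* End F M) : End F M :=
  letI := Fintype.ofFinite K
  ∑ k : K, u k

omit [FiniteDimensional F M] in
lemma opSum_apply_of_fixed {K : Type} [Group K] [Fintype K] (u : K →* End F M) (v : M) :
    opSum u v = ∑ k : K, u k v := by
  rw [opSum, LinearMap.sum_apply]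
  congr!

lemma card_mul_rk_opSum_le {K : Type} [CommGroup K] [Finite K] (hK : ∀ k : K, k ^ p ^ n = 1)
    (u : K →* End F M) (E : End F M) (hE : ∀ k, u k * E = E * u k) :
    Nat.card K * rk (opSum u * E) ≤ rk E := by
  let _ := Fintype.ofFinite K
  set W := LinearMap.range (opSum u * E) with hW
  obtain ⟨s, hs⟩ := (opSum u * E).rangeRestrict.exists_rightInverse_of_surjective
    (LinearMap.range_eq_top.2 (opSum u * E).surjective_rangeRestrict)
  have hs' : ∀ w : W, (opSum u * E) (s w) = w := fun w =>
    congrArg Subtype.val (LinearMap.congr_fun hs w)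
  let Φ : (K → W) →ₗ[F] M :=
    ∑ k : K, u k ∘ₗ E ∘ₗ s ∘ₗ LinearMap.proj k
  have hΦ : ∀ f, Φ f = ∑ k : K, u k (E (s (f k))) := by
    intro f
    simp [Φ, LinearMap.sum_apply]
  have hker : LinearMap.ker Φ = ⊥ := by
    by_contra hne
    let sh : K →* End F (K → W) :=
      { toFun := fun h => LinearMap.funLeft F W (fun k => h * k)
        map_one' := by ext f k; simp [LinearMap.funLeft]
        map_mul' := fun a b => by
          refine LinearMap.ext fun f => funext fun k => ?_
          change f (a * b * k) = f (b * (a * k))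
          rw [mul_comm a b, mul_assoc] }
    obtain ⟨f, hf, hf0, hfix⟩ := exists_fixed_vector (p := p) (n := n) sh
      (fun i j => by rw [← map_mul, mul_comm, map_mul])
      (fun i => by rw [← map_pow, hK, map_one]) _ hne (fun h f hf => by
        rw [LinearMap.mem_ker] at hf ⊢
        rw [hΦ] at hf ⊢
        have : u h (∑ k : K, u k (E (s (sh h f k)))) = 0 := by
          rw [map_sum, ← hf]
          refine Fintype.sum_equiv (Equiv.mulLeft h) _ _ fun k => ?_
          rw [← Module.End.mul_apply, ← map_mul]
          rfl
        have h2 := congrArg (u h⁻¹) this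
        rwa [← Module.End.mul_apply, ← map_mul, inv_mul_cancel, map_one, map_zero] at h2)
    have hconst : ∀ k, f k = f 1 := by
      intro k
      conv_rhs => rw [← hfix k]
      change f k = f (k * 1)
      rw [mul_one]
    apply hf0
    ext k
    rw [hconst k]
    rw [LinearMap.mem_ker, hΦ] at hf
    have h3 : (opSum u * E) (s (f 1)) = 0 := by
      rw [Module.End.mul_apply, opSum_apply_of_fixed, ← hf]
      exact Finset.sum_congr rfl fun k _ => by rw [hconst k]
    rw [hs'] at h3
    simpa using h3
  have hrange : LinearMap.range Φ ≤ LinearMap.range E := by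
    rintro _ ⟨f, rfl⟩
    rw [hΦ]
    refine Submodule.sum_mem _ fun k _ => ⟨u k (s (f k)), ?_⟩
    rw [← Module.End.mul_apply, ← Module.End.mul_apply, hE]
  calc Nat.card K * rk (opSum u * E) = finrank F (K → W) := by
        rw [Module.finrank_pi_fintype, Finset.sum_const, Finset.card_univ, Nat.card_eq_fintype_card]
        rfl
    _ = finrank F (LinearMap.range Φ) :=
        (LinearMap.finrank_range_of_inj (LinearMap.ker_eq_bot.1 hker)).symm
    _ ≤ rk E := Submodule.finrank_mono hrange

end FixedVectors

section Complement

variable {N : Type} [Group N] [Finite N] {A : Type} [CommGroup A]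

lemma Nat.eq_one_of_modEq_of_mul_lt_sq {l a b : ℕ} (hl : 1 < l) (ha1 : 1 < a)
    (ha : a ≡ 1 [MOD l]) (hab : a * b ≡ 1 [MOD l]) (hlt : a * b < l ^ 2) : b = 1 := by
  have hb : b ≡ 1 [MOD l] := by
    have := (ha.mul_right b).symm.trans hab
    rwa [one_mul] at this
  have key : ∀ c, 1 < c → c ≡ 1 [MOD l] → l < c := by
    intro c hc h
    have h1 := (Nat.modEq_iff_dvd' hc.le).1 h.symm
    have := Nat.le_of_dvd (by omega) h1
    omega
  by_contra hne
  rcases Nat.lt_or_ge 1 b with h | h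
  · nlinarith [key a ha1 ha, key b h hb]
  · have : b = 0 := by omega
    subst this
    have := (Nat.modEq_iff_dvd' zero_le_one).1 hb
    simp at this
    omega

open scoped Pointwise in
/-- An action of a `p`-group fixes some Sylow subgroup of a finite group of order prime to `p`. -/
lemma exists_invt_sylow {K : Type} [CommGroup K] {H : Type} [Group H] [Finite H] {p : ℕ}
    [Fact p.Prime] (hK : IsPGroup p K) (ψ : K →* MulAut H) (hp : ¬ p ∣ Nat.card H) (r : ℕ)
    [Fact r.Prime] : ∃ P : Sylow r H, ∀ k, ∀ n ∈ P, ψ k n ∈ P := by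
  let _ : MulDistribMulAction K H := MulDistribMulAction.compHom H ψ
  have h1 : ¬ p ∣ Nat.card (Sylow r H) := fun h =>
    hp (h.trans ((Sylow.card_dvd_index default).trans (Subgroup.index_dvd_card _)))
  obtain ⟨P, hP⟩ := hK.nonempty_fixed_point_of_prime_not_dvd_card _ h1
  refine ⟨P, fun k n hn => ?_⟩
  have h2 : k • P = P := hP k
  have h3 : k • (P : Subgroup H) = P := by
    rw [← Sylow.pointwise_smul_def, h2]
  have h4 : k • n ∈ k • (P : Subgroup H) := Subgroup.smul_mem_pointwise_smul _ _ _ hn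
  rw [h3] at h4
  exact h4

lemma exists_invt_sylow_ge {K : Type} [CommGroup K] {p : ℕ} [Fact p.Prime] (hK : IsPGroup p K)
    (ψ : K →* MulAut N) (hp : ¬ p ∣ Nat.card N) (r : ℕ) [Fact r.Prime] (S : Subgroup N)
    (hS : IsPGroup r S) (hSK : Invt ψ S) :
    ∃ Q, S ≤ Q ∧ IsPGroup r Q ∧ Invt ψ Q ∧ ¬ r ∣ Q.index := by
  obtain ⟨Q, ⟨hSQ, hQr, hQK⟩, hmax⟩ := (wellFounded_gt (α := Subgroup N)).has_min
    {Q | S ≤ Q ∧ IsPGroup r Q ∧ Invt ψ Q} ⟨S, le_rfl, hS, hSK⟩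
  refine ⟨Q, hSQ, hQr, hQK, ?_⟩
  set H := Subgroup.normalizer (Q : Set N) with hH
  have hHK : Invt ψ H := by
    intro k n hn
    rw [hH, Subgroup.mem_normalizer_iff] at hn ⊢
    have hQ' : ∀ k x, ψ k x ∈ Q ↔ x ∈ Q := fun k x =>
      ⟨fun h => by simpa using hQK k⁻¹ _ h, hQK k x⟩
    intro x
    obtain ⟨x, rfl⟩ := (ψ k).surjective x
    rw [← map_mul, ← map_inv, ← map_mul, hQ', hQ']
    exact hn x
  have hpH : ¬ p ∣ Nat.card H := fun h => hp (h.trans H.card_subgroup_dvd_card)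
  obtain ⟨P, hP⟩ := exists_invt_sylow hK (res ψ H hHK) hpH r
  have hQH : Q ≤ H := Subgroup.le_normalizer
  have hQn : (Subgroup.comap H.subtype Q).Normal := Subgroup.normal_in_normalizer
  have hQP : Q.subgroupOf H ≤ P :=
    IsPGroup.le_sylow_of_normal (hQr.comap_of_injective H.subtype H.subtype_injective) P
  have hQP' : Q ≤ (P : Subgroup H).map H.subtype := by
    intro x hx
    exact ⟨⟨x, hQH hx⟩, hQP (Subgroup.mem_subgroupOf.2 hx), rfl⟩
  have heq : Q = (P : Subgroup H).map H.subtype := by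
    by_contra hne
    refine hmax ((P : Subgroup H).map H.subtype) ⟨hSQ.trans hQP', P.2.map _, ?_⟩
      (lt_of_le_of_ne hQP' hne)
    rintro k _ ⟨n, hn, rfl⟩
    exact ⟨res ψ H hHK k n, hP k n hn, rfl⟩
  have heq' : Q.subgroupOf H = P := by
    rw [heq]
    exact Subgroup.comap_map_eq_self_of_injective H.subtype_injective _
  obtain ⟨m, hm⟩ := hQr.exists_card_eq
  have h1 := Sylow.card_quotient_normalizer_modEq_card_quotient hm
  have h2 : ¬ r ∣ (Q.subgroupOf H).index := by
    rw [heq']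
    exact P.not_dvd_index
  intro h3
  exact h2 ((Nat.ModEq.dvd_iff h1 dvd_rfl).2 h3)

lemma exists_invt_complement [Finite A] {p : ℕ} [Fact p.Prime] (hp : ¬ p ∣ Nat.card N)
    (φ : A →* MulAut N) (L : Subgroup A) (R : Subgroup N) (hL : IsPGroup p L) (hL1 : 1 < Nat.card L)
    (hfree : FreeOff φ L R) (hfix : ∀ l ∈ L, ∀ n ∈ R, φ l n = n) (hcore : R.normalCore = ⊥)
    (hR : R ≠ ⊤) (hidx : R.index < Nat.card L ^ 2) :
    ∃ Q : Subgroup N, (∀ l ∈ L, ∀ n ∈ Q, φ l n ∈ Q) ∧ R ⊓ Q = ⊥ ∧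
      ∀ n, ∃ q ∈ Q, ∃ r ∈ R, n = q * r := by
  have hcop : (Nat.card N).Coprime (Nat.card L) := by
    obtain ⟨m, hm⟩ := hL.exists_card_eq
    rw [hm]
    exact Nat.Coprime.pow_right _ (((Fact.out : p.Prime).coprime_iff_not_dvd.2 hp).symm)
  have hmod : ∀ H : Subgroup N, (∀ l ∈ L, ∀ n ∈ H, φ l n ∈ H) →
      R.relIndex H ≡ 1 [MOD Nat.card L] := fun H hH => hfree.index_modEq hfix hH hcop
  have hidx1 : R.index ≠ 1 := fun h => hR (Subgroup.index_eq_one.1 h)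
  obtain ⟨r, hr, hrR⟩ := Nat.exists_prime_and_dvd hidx1
  have : Fact r.Prime := ⟨hr⟩
  obtain ⟨S⟩ : Nonempty (Sylow r R) := inferInstance
  obtain ⟨Q, hSQ, hQr, hQK, hQi⟩ := exists_invt_sylow_ge hL (φ.comp L.subtype) hp r
    ((S : Subgroup R).map R.subtype) (S.2.map _) (by
      rintro l _ ⟨n, hn, rfl⟩
      refine ⟨n, hn, (hfix l l.2 n n.2).symm⟩)
  have hQL : ∀ l ∈ L, ∀ n ∈ Q, φ l n ∈ Q := fun l hl n hn => hQK ⟨l, hl⟩ n hn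
  set T := R ⊓ Q with hT
  have e1 : T.relIndex R * R.index = T.index := Subgroup.relIndex_mul_index inf_le_left
  have e2 : T.relIndex Q * Q.index = T.index := Subgroup.relIndex_mul_index inf_le_right
  have hTQ : T.relIndex Q = R.relIndex Q := Subgroup.inf_relIndex_right R Q
  have hTR : ¬ r ∣ T.relIndex R := by
    intro h
    refine S.not_dvd_index (h.trans (Subgroup.index_dvd_of_le ?_))
    intro x hx
    exact Subgroup.mem_subgroupOf.2 ⟨x.2, hSQ ⟨x, hx, rfl⟩⟩
  obtain ⟨m, hm⟩ := hQr.exists_card_eq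
  obtain ⟨m', -, hm'⟩ := (Nat.dvd_prime_pow hr).1 (hm ▸ Subgroup.relIndex_dvd_card T Q)
  have hq1 : r ∣ T.relIndex Q := by
    have : r ∣ T.relIndex Q * Q.index := by
      rw [e2, ← e1]
      exact hrR.mul_left _
    exact (hr.dvd_mul.1 this).resolve_right hQi
  have hq1' : 1 < T.relIndex Q := by
    have h0 : T.relIndex Q ≠ 0 := by rw [hm']; exact pow_ne_zero _ hr.ne_zero
    exact lt_of_lt_of_le hr.one_lt (Nat.le_of_dvd (Nat.pos_of_ne_zero h0) hq1)
  have hqd : T.relIndex Q ∣ R.index := by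
    have h1 : (T.relIndex Q).Coprime (T.relIndex R) := by
      rw [hm']
      exact Nat.Coprime.pow_left _ (hr.coprime_iff_not_dvd.2 hTR)
    refine h1.dvd_of_dvd_mul_left ?_
    rw [e1, ← e2]
    exact dvd_mul_right _ _
  have hqm : T.relIndex Q ≡ 1 [MOD Nat.card L] := hTQ ▸ hmod Q hQL
  have hRm : R.index ≡ 1 [MOD Nat.card L] := by
    rw [← Subgroup.relIndex_top_right]
    exact hmod ⊤ (fun _ _ _ _ => Subgroup.mem_top _)
  have hRQ : R.index = T.relIndex Q := by
    obtain ⟨k, hk⟩ := hqd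
    rw [hk] at hRm hidx
    rw [hk, Nat.eq_one_of_modEq_of_mul_lt_sq hL1 hq1' hqm hRm hidx, mul_one]
  have hfact : ∀ n, ∃ q ∈ Q, ∃ r ∈ R, n = q * r := by
    let f : Q ⧸ R.subgroupOf Q → N ⧸ R := Quotient.map' (fun q => (q : N)) (by
      intro a b h
      rw [QuotientGroup.leftRel_apply] at h ⊢
      exact h)
    have hf : Function.Injective f := by
      intro a b
      induction a using QuotientGroup.induction_on with | H a =>
      induction b using QuotientGroup.induction_on with | H b =>
      intro h
      have h' : ((a : N) : N ⧸ R) = ((b : N) : N ⧸ R) := h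
      rw [QuotientGroup.eq] at h' ⊢
      exact h'
    have hcard : Nat.card (N ⧸ R) = Nat.card (Q ⧸ R.subgroupOf Q) := by
      change R.index = R.relIndex Q
      rw [hRQ, hTQ]
    have hsurj := ((Nat.bijective_iff_injective_and_card f).2 ⟨hf, hcard.symm⟩).2
    intro n
    obtain ⟨q, hq⟩ := hsurj (n : N ⧸ R)
    induction q using QuotientGroup.induction_on with | H q =>
    have hq' : ((q : N) : N ⧸ R) = (n : N ⧸ R) := hq
    rw [QuotientGroup.eq] at hq'
    exact ⟨q, q.2, _, hq', by group⟩
  have hnorm : Q ≤ Subgroup.normalizer (T : Set N) := by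
    set M := Subgroup.normalizer (T : Set N) ⊓ Q with hM
    have hTM : T ≤ M := le_inf Subgroup.le_normalizer inf_le_right
    have hTL : ∀ l ∈ L, ∀ n ∈ T, φ l n = n := fun l hl n hn => hfix l hl n hn.1
    have hML : ∀ l ∈ L, ∀ n ∈ M, φ l n ∈ M := by
      rintro l hl n ⟨hn, hnQ⟩
      refine ⟨?_, hQL l hl n hnQ⟩
      have hn : n ∈ Subgroup.normalizer (T : Set N) := hn
      change φ l n ∈ Subgroup.normalizer (T : Set N)
      rw [Subgroup.mem_normalizer_iff] at hn ⊢
      have hT' : ∀ x, φ l x ∈ T ↔ x ∈ T := by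
        intro x
        constructor
        · intro h
          have := hTL l hl _ h
          rw [EmbeddingLike.apply_eq_iff_eq] at this
          rwa [this] at h
        · intro h
          rwa [hTL l hl x h]
      intro x
      obtain ⟨x, rfl⟩ := (φ l).surjective x
      rw [← map_mul, ← map_inv, ← map_mul, hT', hT']
      exact hn x
    have hTM' : T = R ⊓ M := le_antisymm (le_inf inf_le_left hTM)
      (inf_le_inf_left _ inf_le_right)
    have hm1 : T.relIndex M ≡ 1 [MOD Nat.card L] := by
      rw [hTM', Subgroup.inf_relIndex_right]
      exact hmod M hML
    have hprod := Subgroup.relIndex_mul_relIndex T M Q hTM inf_le_right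
    have hne : T.relIndex M ≠ 1 := by
      intro h
      rw [Subgroup.relIndex_eq_one] at h
      have hnil : Group.IsNilpotent Q := hQr.isNilpotent
      have hlt : T.subgroupOf Q < ⊤ := by
        rw [lt_top_iff_ne_top, Ne, Subgroup.subgroupOf_eq_top, ← Subgroup.relIndex_eq_one]
        exact hq1'.ne'
      obtain ⟨x, hx, hx'⟩ := SetLike.exists_of_lt
        (Group.normalizerCondition_of_isNilpotent (G := Q) _ hlt)
      apply hx'
      refine Subgroup.mem_subgroupOf.2 (h ⟨?_, x.2⟩)
      change (x : N) ∈ Subgroup.normalizer (T : Set N)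
      rw [Subgroup.mem_normalizer_iff]
      rw [Subgroup.mem_normalizer_iff] at hx
      intro y
      by_cases hy : y ∈ Q
      · exact hx ⟨y, hy⟩
      · refine ⟨fun h => absurd h.2 hy, fun h => absurd ?_ hy⟩
        have := Q.mul_mem (Q.mul_mem (Q.inv_mem x.2) h.2) x.2
        simpa [mul_assoc] using this
    have h0 : T.relIndex M ≠ 0 := Subgroup.index_ne_zero_of_finite
    have hone : M.relIndex Q = 1 := by
      refine Nat.eq_one_of_modEq_of_mul_lt_sq hL1 (by omega) hm1 ?_ ?_
      · rw [hprod]; exact hqm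
      · rw [hprod, ← hRQ]; exact hidx
    exact (Subgroup.relIndex_eq_one.1 hone).trans inf_le_left
  refine ⟨Q, hQL, ?_, hfact⟩
  rw [eq_bot_iff, ← hcore]
  intro t ht n
  obtain ⟨q, hq, r, hr, hn⟩ := hfact n⁻¹
  have hn' : n = r⁻¹ * q⁻¹ := by rw [← mul_inv_rev, ← hn, inv_inv]
  have h1 : q⁻¹ * t * q⁻¹⁻¹ ∈ T :=
    (Subgroup.mem_normalizer_iff.1 (hnorm (Q.inv_mem hq)) t).1 ht
  have h2 := R.mul_mem (R.mul_mem (R.inv_mem hr) h1.1) hr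
  rw [hn']
  simpa [mul_assoc] using h2

end Complement

section Averaging

variable {F : Type} [Field F] {N : Type} [Group N] {A : Type} [CommGroup A]

lemma act_inc_of_mem_ker (φ : A →* MulAut N) (R : Subgroup N) (hR : Invt φ R) {l : A}
    (hl : l ∈ (res φ R hR).ker) (x : F[R]) : act F φ l (inc F R x) = inc F R x := by
  rw [act_inc φ R hR, act_of_mem_ker _ hl]

lemma Compat.commute {φ : A →* MulAut N} {B : Subgroup A} {M : Type} [AddCommGroup M]
    [Module F M] {ρ : F[N] →ₐ[F] End F M} {u : B →* End F M} (h : Compat φ B ρ u) (b : B)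
    {x : F[N]} (hx : act F φ b x = x) : u b * ρ x = ρ x * u b := by
  rw [h b x, hx]

lemma Compat.opSum_commute [Finite A] {φ : A →* MulAut N} {B : Subgroup A} {M : Type}
    [AddCommGroup M] [Module F M] {ρ : F[N] →ₐ[F] End F M} {u : B →* End F M}
    (h : Compat φ B ρ u) {x : F[N]} (hx : ∀ b ∈ B, act F φ b x = x) :
    opSum u * ρ x = ρ x * opSum u := by
  rw [opSum, Finset.sum_mul, Finset.mul_sum]
  exact Finset.sum_congr rfl fun b _ => h.commute b (hx b b.2)

lemma Compat.apply_tr [Finite A] {φ : A →* MulAut N} {B : Subgroup A} {M : Type}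
    [AddCommGroup M] [Module F M] {ρ : F[N] →ₐ[F] End F M} {u : B →* End F M}
    (h : Compat φ B ρ u) (z : F[N]) {v : M} (hv : ∀ b, u b v = v) :
    ρ (tr F φ B z) v = opSum u (ρ z v) := by
  let _ := Fintype.ofFinite B
  rw [opSum_apply_of_fixed, tr, map_sum, LinearMap.sum_apply]
  refine Finset.sum_congr (by congr!) fun b _ => ?_
  rw [h.conj, Module.End.mul_apply, Module.End.mul_apply, hv]

end Averaging

section FreeComplement

variable {F : Type} [Field F] [IsAlgClosed F] {N : Type} [Group N] [Finite N]
  [NeZero (Nat.card N : F)] {A : Type} [CommGroup A] [Finite A] {p : ℕ} [ExpChar F p] {n : ℕ}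

lemma HasBigBlock.of_proj_eq_zero (hA : ∀ a : A, a ^ p ^ n = 1) (φ : A →* MulAut N)
    (R : Subgroup N) (hR : Invt φ R) (hfree : FreeOff φ (res φ R hR).ker R) {dθ : ℕ}
    (θ : Block F R dθ)
    (hθ : Nat.card (θ.stab (res φ R hR)) ≤ dθ * Nat.card (res φ R hR).ker) (i₀ : Fin dθ)
    (c : F[N]) (hc : ∀ x, c * x = x * c) (hcc : c * c = c)
    (hfix : ∀ l ∈ (res φ R hR).ker, act F φ l c = c)
    (hne : inc F R (θ.e i₀ i₀) * c ≠ 0) (hproj : proj F R (inc F R (θ.e i₀ i₀) * c) = 0) :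
    HasBigBlock F φ := by
  obtain ⟨d, β, hβ⟩ := exists_block _ hne
  set L := (res φ R hR).ker with hL
  set e := inc F R (θ.e i₀ i₀) with he
  have hσc : β.σ c = 1 := by
    rcases β.central_idem c hc hcc with h | h
    · rw [β.c_mul_eq_zero_iff] at h
      exact absurd (by rw [map_mul, h, mul_zero]) hβ
    · exact (β.c_mul_eq_c_iff c).1 h
  have hee : β.σ e * β.σ e = β.σ e := by
    rw [← map_mul, he, ← map_mul, θ.e_mul_e]
  have hσ : β.σ (e * c) = β.σ e := by rw [map_mul, hσc, mul_one]
  set B := β.stab φ with hB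
  obtain ⟨u, hu⟩ := β.exists_compat hA φ
  set uC := u.comp (Subgroup.inclusion (inf_le_right : L ⊓ B ≤ B)) with huC
  have huC' : Compat φ (L ⊓ B) β.σ uC := hu.mono inf_le_right
  have hfixR : ∀ k ∈ L ⊓ B, ∀ x, act F φ k (inc F R x) = inc F R x :=
    fun k hk x => act_inc_of_mem_ker φ R hR hk.1 x
  obtain ⟨z, hz⟩ := (hfree.mono (inf_le_left : L ⊓ B ≤ L)).exists_eq_tr (y := e * c)
    (fun k hk => by rw [map_mul (act F φ k), hfix k hk.1, he, hfixR k hk]) hproj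
  obtain ⟨v, ⟨w, hw⟩, hv0, hv⟩ := exists_fixed_vector (p := p) (n := n) (fun k => uC k)
    (fun i j => by rw [← map_mul, mul_comm, map_mul])
    (fun k => by
      rw [← map_pow, show k ^ p ^ n = 1 from Subtype.ext (hA k), map_one])
    (LinearMap.range (β.σ e)) (by
      rw [Ne, LinearMap.range_eq_bot, ← hσ]
      exact hβ)
    (by
      rintro k _ ⟨w, rfl⟩
      refine ⟨uC k w, ?_⟩
      rw [← Module.End.mul_apply, ← Module.End.mul_apply, huC'.commute k (hfixR k k.2 _)])
  have hev : β.σ e v = v := by rw [← hw, ← Module.End.mul_apply, hee]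
  have hv' : v = opSum uC (β.σ z v) := by
    rw [← huC'.apply_tr z hv, ← hz, hσ, hev]
  have key := θ.good (res φ R hR) hθ B (Fin d → F) (β.σ.comp (inc F R)) u (opSum uC)
    (hu.restrict R hR) ⟨fun x => huC'.opSum_commute fun k hk => hfixR k hk x, fun b => by
      rw [opSum, Finset.sum_mul, Finset.mul_sum]
      refine Finset.sum_congr rfl fun k _ => ?_
      rw [huC, MonoidHom.comp_apply, ← map_mul, mul_comm, map_mul]⟩ (by
      intro h0
      have h1 := LinearMap.congr_fun h0 (β.σ z v)
      rw [Module.End.mul_apply, ← hv', AlgHom.comp_apply, ← hev, ← Module.End.mul_apply,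
        ← map_mul, he, ← map_mul, θ.c_mul_e, ← he, hev] at h1
      exact hv0 h1)
  have h2 := card_mul_rk_opSum_le (p := p) (n := n) (fun k => Subtype.ext (hA k)) uC 1
    (fun k => by rw [mul_one, one_mul])
  rw [mul_one, rk_one_fun, mul_comm] at h2
  exact HasBigBlock.of_good φ β (key.trans h2)

lemma mul_central_eq_zero_or_eq (hA : ∀ a : A, a ^ p ^ n = 1) (φ : A →* MulAut N)
    (hφ : ¬ HasBigBlock F φ)
    (R : Subgroup N) (hR : Invt φ R) (hfree : FreeOff φ (res φ R hR).ker R)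
    (hLF : (Nat.card (res φ R hR).ker : F) = 0) {dθ : ℕ}
    (θ : Block F R dθ)
    (hθ : Nat.card (θ.stab (res φ R hR)) ≤ dθ * Nat.card (res φ R hR).ker) (i₀ : Fin dθ)
    (c : F[N]) (hc : ∀ x, c * x = x * c) (hcc : c * c = c)
    (hfix : ∀ l ∈ (res φ R hR).ker, act F φ l c = c) :
    inc F R (θ.e i₀ i₀) * c = 0 ∨ inc F R (θ.e i₀ i₀) * c = inc F R (θ.e i₀ i₀) := by
  set e := inc F R (θ.e i₀ i₀) with he
  have hee : e * e = e := by rw [he, ← map_mul, θ.e_mul_e]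
  have hece : e * c = e * c * e := by rw [mul_assoc, hc, ← mul_assoc, hee]
  have claim : ∀ c : F[N], (∀ x, c * x = x * c) → c * c = c →
      (∀ l ∈ (res φ R hR).ker, act F φ l c = c) → proj F R (e * c) = 0 → e * c = 0 := by
    intro c hc hcc hfix h0
    by_contra hne
    exact hφ (.of_proj_eq_zero hA φ R hR hfree θ hθ i₀ c hc hcc hfix hne h0)
  obtain ⟨α, hα⟩ := θ.e_mul_mul_e i₀ i₀ (proj F R c)
  have hα' : proj F R (e * c) = α • θ.e i₀ i₀ := by
    rw [hece, he, proj_mul_inc, proj_inc_mul, hα]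
  have hfe : ∀ l ∈ (res φ R hR).ker, act F φ l e = e :=
    fun l hl => act_inc_of_mem_ker φ R hR hl _
  have hfec : ∀ l ∈ (res φ R hR).ker, act F φ l (e * c) = e * c := fun l hl => by
    rw [map_mul (act F φ l), hfe l hl, hfix l hl]
  obtain ⟨z, hz⟩ := hfree.exists_eq_tr (y := e * c - α • e)
    (fun l hl => by rw [map_sub, map_smul, hfec l hl, hfe l hl])
    (by rw [map_sub, map_smul, hα', he, proj_inc, sub_self])
  have h1 : proj F R ((e * c - α • e) * (e * c)) = 0 := by
    rw [hz, tr_mul _ _ _ hfec, proj_tr φ R hR _ le_rfl hLF]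
  have hecec : e * c * (e * c) = e * c := by
    rw [← mul_assoc, ← hece, mul_assoc, hcc]
  rw [sub_mul, smul_mul_assoc, ← mul_assoc e e c, hee, hecec, map_sub, map_smul, hα', smul_smul,
    ← sub_smul, smul_eq_zero_iff_left (θ.e_ne_zero _ _), sub_eq_zero] at h1
  have h2 : α = 0 ∨ α = 1 := by
    rcases eq_or_ne α 0 with h | h
    · exact Or.inl h
    · right
      have : α * 1 = α * α := by rw [mul_one]; exact h1
      exact (mul_left_cancel₀ h this).symm
  rcases h2 with rfl | rfl
  · left
    exact claim c hc hcc hfix (by rw [hα', zero_smul])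
  · right
    have := claim (1 - c) (fun x => by rw [sub_mul, mul_sub, hc, one_mul, mul_one])
      (by rw [sub_mul, one_mul, mul_sub, mul_one, hcc, sub_self, sub_zero])
      (fun l hl => by rw [map_sub, map_one, hfix l hl])
      (by rw [mul_sub, mul_one, map_sub, hα', he, proj_inc, one_smul, sub_self])
    rw [mul_sub, mul_one, sub_eq_zero] at this
    exact this.symm

end FreeComplement

section OrbitSum

variable {F : Type} [Field F] {N : Type} [Group N] {A : Type} [CommGroup A] [Finite A]

lemma Block.exists_orbit_sum {d : ℕ} (β : Block F N d) (φ : A →* MulAut N) (L : Subgroup A) {p : ℕ}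
    [Fact p.Prime] (hL : IsPGroup p L) :
    ∃ (k : ℕ) (ĉ : F[N]), (∀ x, ĉ * x = x * ĉ) ∧ ĉ * ĉ = ĉ ∧ (∀ l ∈ L, act F φ l ĉ = ĉ) ∧
      ĉ * β.c = β.c ∧ (k = 0 → L ≤ β.stab φ ∧ ĉ = β.c) ∧
      ∀ (V : Type) [AddCommGroup V] [Module F V] (f : F[N] →ₗ[F] V),
        (∀ l ∈ L, f (act F φ l β.c) = f β.c) → f ĉ = ((p ^ k : ℕ) : F) • f β.c := by
  classical
  let _ : MulAction L F[N] :=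
    { smul := fun l x => act F φ l x
      one_smul := fun x => act_one φ x
      mul_smul := fun a b x => (act_act φ a b x).symm }
  have smul_def : ∀ (l : L) (x : F[N]), l • x = act F φ l x := fun _ _ => rfl
  let O := MulAction.orbit L β.c
  have hOf : Finite O := Set.finite_range _
  let _ : Fintype O := Fintype.ofFinite O
  obtain ⟨k, hk⟩ := hL.card_orbit β.c
  have hmul : ∀ x y : O, x ≠ y → (x : F[N]) * y = 0 := by
    rintro ⟨_, a, rfl⟩ ⟨_, b, rfl⟩ hne
    change act F φ a β.c * act F φ b β.c = 0
    have h1 : act F φ b β.c = act F φ a (act F φ ((a : A)⁻¹ * b) β.c) := by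
      rw [act_act]; congr 2; simp
    rw [h1, ← map_mul (act F φ a), β.c_mul_act_c, map_zero]
    intro h
    rw [β.mem_stab] at h
    apply hne
    apply Subtype.ext
    change act F φ a β.c = act F φ b β.c
    rw [h1, h]
  have hidem : ∀ x : O, (x : F[N]) * x = x := by
    rintro ⟨_, a, rfl⟩
    exact β.act_c_idem φ a
  have hcent : ∀ (x : O) (y : F[N]), (x : F[N]) * y = y * x := by
    rintro ⟨_, a, rfl⟩ y
    exact β.act_c_comm φ a y
  let x₀ : O := ⟨β.c, MulAction.mem_orbit_self _⟩
  have hx : ∀ x : O, (∑ y : O, (y : F[N])) * x = x := by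
    intro x
    rw [Finset.sum_mul, Finset.sum_eq_single x, hidem]
    · intro y _ hy
      exact hmul y x hy
    · simp
  refine ⟨k, ∑ x : O, (x : F[N]), ?_, ?_, ?_, hx x₀, ?_, ?_⟩
  · intro y
    rw [Finset.sum_mul, Finset.mul_sum]
    exact Finset.sum_congr rfl fun x _ => hcent x y
  · rw [Finset.mul_sum]
    exact Finset.sum_congr rfl fun x _ => hx x
  · intro l hl
    rw [map_sum]
    exact Equiv.sum_comp (MulAction.toPerm (α := L) (β := O) ⟨l, hl⟩) (fun x : O => (x : F[N]))
  · intro hk0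
    rw [hk0, pow_zero] at hk
    have hsub : Subsingleton O := (Nat.card_eq_one_iff_unique.1 hk).1
    constructor
    · intro l hl
      exact congrArg Subtype.val
        (hsub.elim (⟨act F φ l β.c, ⟨l, hl⟩, rfl⟩ : O) x₀)
    · rw [Finset.sum_eq_single x₀]
      · exact fun b _ hb => absurd (hsub.elim b x₀) hb
      · simp
  · intro V _ _ f hf
    rw [map_sum, ← hk, Nat.card_eq_fintype_card, Nat.cast_smul_eq_nsmul, ← Finset.card_univ]
    apply Finset.sum_eq_card_nsmul
    rintro ⟨_, a, rfl⟩ _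
    exact hf a a.2

end OrbitSum

section FreeComplement

variable {F : Type} [Field F] [IsAlgClosed F] {N : Type} [Group N] [Finite N]
  [NeZero (Nat.card N : F)] {A : Type} [CommGroup A] [Finite A] {p : ℕ} [Fact p.Prime] [CharP F p]
  {n : ℕ}

lemma Block.fixed_of_σ_ne_zero (hA : ∀ a : A, a ^ p ^ n = 1) (φ : A →* MulAut N)
    (hφ : ¬ HasBigBlock F φ)
    (R : Subgroup N) (hR : Invt φ R) (hfree : FreeOff φ (res φ R hR).ker R)
    (hLF : (Nat.card (res φ R hR).ker : F) = 0) {dθ : ℕ}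
    (θ : Block F R dθ)
    (hθ : Nat.card (θ.stab (res φ R hR)) ≤ dθ * Nat.card (res φ R hR).ker) (i₀ : Fin dθ)
    {d : ℕ} (β : Block F N d) (hβ : β.σ (inc F R (θ.e i₀ i₀)) ≠ 0) :
    (res φ R hR).ker ≤ β.stab φ ∧ inc F R (θ.e i₀ i₀) * β.c = inc F R (θ.e i₀ i₀) := by
  have : ExpChar F p := ExpChar.prime Fact.out
  set e := inc F R (θ.e i₀ i₀) with he
  have hL : IsPGroup p (res φ R hR).ker := fun l => ⟨n, Subtype.ext (hA l)⟩
  obtain ⟨k, ĉ, h1, h2, h3, h4, h5, h6⟩ := β.exists_orbit_sum φ (res φ R hR).ker hL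
  have hec : e * β.c ≠ 0 := by
    rw [← β.c_comm]
    exact fun h => hβ ((β.c_mul_eq_zero_iff e).1 h)
  have heĉ : e * ĉ = e := by
    refine (mul_central_eq_zero_or_eq hA φ hφ R hR hfree hLF θ hθ i₀ ĉ h1 h2 h3).resolve_left ?_
    intro h
    apply hec
    rw [← h4, ← mul_assoc, h, zero_mul]
  have hk : k = 0 := by
    by_contra hk
    have h7 := h6 _ ((proj F R) ∘ₗ LinearMap.mulLeft F e) (by
      intro l hl
      simp only [LinearMap.comp_apply, LinearMap.mulLeft_apply]
      rw [he, proj_inc_mul, proj_inc_mul, proj_act φ R hR, act_of_mem_ker _ hl])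
    simp only [LinearMap.comp_apply, LinearMap.mulLeft_apply] at h7
    rw [heĉ, Nat.cast_pow, CharP.cast_eq_zero, zero_pow hk, zero_smul, he, proj_inc] at h7
    exact θ.e_ne_zero _ _ h7
  obtain ⟨h8, h9⟩ := h5 hk
  exact ⟨h8, h9 ▸ heĉ⟩

omit [Finite N] [NeZero (Nat.card N : F)] [IsAlgClosed F] [Fact p.Prime] [CharP F p] in
lemma Block.rk_lt_card (φ : A →* MulAut N)
    (hφ : ¬ HasBigBlock F φ) (R : Subgroup N) (hR : Invt φ R) {dθ : ℕ} (θ : Block F R dθ)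
    (hθ : Nat.card (θ.stab (res φ R hR)) ≤ dθ * Nat.card (res φ R hR).ker) (i₀ : Fin dθ)
    {d : ℕ} (β : Block F N d) {u : β.stab φ →* End F (Fin d → F)}
    (hu : Compat φ (β.stab φ) β.σ u) :
    rk (β.σ (inc F R (θ.e i₀ i₀))) < Nat.card (res φ R hR).ker := by
  have h1 := θ.card_mul_rk_le (res φ R hR) (β.stab φ) _ u (hu.restrict R hR) 1 (.one _ _) i₀
  have h2 : Nat.card (θ.stab (res φ R hR) ⊓ β.stab φ : Subgroup A) ≤ _ :=
    (Nat.card_mono (Set.toFinite _) inf_le_left).trans hθ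
  rw [mul_one, rk_one_fun, AlgHom.comp_apply] at h1
  set m := rk (β.σ (inc F R (θ.e i₀ i₀))) with hm
  by_contra! hlt
  apply hφ
  refine HasBigBlock.of_good φ β ?_
  have hd := θ.pos
  have hl : 0 < Nat.card (res φ R hR).ker := Nat.card_pos
  have h3 : Nat.card (β.stab φ) * (dθ * m) ≤ d * (dθ * m) :=
    h1.trans (Nat.mul_le_mul le_rfl (h2.trans (Nat.mul_le_mul le_rfl hlt)))
  exact Nat.le_of_mul_le_mul_right h3 (Nat.mul_pos hd (hl.trans_le hlt))

omit [NeZero (Nat.card N : F)] [IsAlgClosed F] [Finite N] in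
lemma Compat.opSum_mul_eq_zero (hA : ∀ a : A, a ^ p ^ n = 1) {φ : A →* MulAut N}
    (R : Subgroup N) (hR : Invt φ R) {dθ : ℕ} (θ : Block F R dθ) (i₀ : Fin dθ)
    {M : Type} [AddCommGroup M] [Module F M] [FiniteDimensional F M] {ρ : F[N] →ₐ[F] End F M}
    {u : (res φ R hR).ker →* End F M} (h : Compat φ (res φ R hR).ker ρ u)
    (hrk : rk (ρ (inc F R (θ.e i₀ i₀))) < Nat.card (res φ R hR).ker) :
    opSum u * ρ (inc F R θ.c) = 0 := by
  have : ExpChar F p := ExpChar.prime Fact.out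
  have hfix : ∀ l ∈ (res φ R hR).ker, ∀ x, act F φ l (inc F R x) = inc F R x :=
    fun l hl x => act_inc_of_mem_ker φ R hR hl x
  have h1 := card_mul_rk_opSum_le (p := p) (n := n) (fun k => Subtype.ext (hA k)) u
    (ρ (inc F R (θ.e i₀ i₀))) (fun k => h.commute k (hfix k k.2 _))
  have h2 : opSum u * ρ (inc F R (θ.e i₀ i₀)) = 0 := by
    by_contra hne
    have := rk_pos hne
    nlinarith
  rw [← θ.sum_e, map_sum, map_sum, Finset.mul_sum]
  refine Finset.sum_eq_zero fun i _ => ?_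
  rw [← θ.e_mul_e i i₀ i, ← θ.e_mul_e i i₀ i₀, map_mul (inc F R), map_mul (inc F R), map_mul ρ,
    map_mul ρ, mul_assoc (ρ _), ← mul_assoc, h.opSum_commute (fun l hl => hfix l hl _), mul_assoc,
    ← mul_assoc (opSum u), h2, zero_mul, mul_zero]

omit [IsAlgClosed F] [NeZero (Nat.card N : F)] [Fact p.Prime] [CharP F p] in
lemma Block.stab_le_stab (φ : A →* MulAut N)
    (R : Subgroup N) (hR : Invt φ R) (hfree : FreeOff φ (res φ R hR).ker R)
    (hLF : (Nat.card (res φ R hR).ker : F) = 0) {dθ : ℕ} (θ : Block F R dθ) (i₀ : Fin dθ)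
    {d : ℕ} (β : Block F N d) {u : β.stab φ →* End F (Fin d → F)}
    (hu : Compat φ (β.stab φ) β.σ u) (hL : (res φ R hR).ker ≤ β.stab φ)
    (hec : inc F R (θ.e i₀ i₀) * β.c = inc F R (θ.e i₀ i₀)) :
    β.stab φ ≤ θ.stab (res φ R hR) := by
  intro b hb
  by_contra hb'
  set e := inc F R (θ.e i₀ i₀) with he
  have hee : e * e = e := by rw [he, ← map_mul, θ.e_mul_e]
  have hfix : ∀ l ∈ (res φ R hR).ker, ∀ x, act F φ l (inc F R x) = inc F R x :=
    fun l hl x => act_inc_of_mem_ker φ R hR hl x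
  set e' := act F φ b e with he'
  have he'R : e' = inc F R (act F (res φ R hR) b (θ.e i₀ i₀)) := by rw [he', he, act_inc φ R hR]
  set b' : β.stab φ := ⟨b, hb⟩ with hb''
  have hact : ∀ l : β.stab φ, ∀ T, act F φ l (β.s T) = β.s (u l * T * u l⁻¹) := by
    intro l T
    have h1 := hu.conj l (β.s T)
    rw [β.σ_s] at h1
    rw [← h1, β.s_σ']
    have h2 : act F φ l β.c = β.c := l.2
    nth_rw 1 [← h2]
    rw [← map_mul, β.c_mul_s]
  have hs : ∀ l (hl : l ∈ (res φ R hR).ker), ∀ T, (∀ b : β.stab φ, (b : A) ∈ (res φ R hR).ker →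
      u b * T = T * u b) → act F φ l (β.s T) = β.s T := by
    intro l hl T hT
    have := hact ⟨l, hL hl⟩ T
    rw [hT ⟨l, hL hl⟩ hl, mul_assoc, ← map_mul, mul_inv_cancel, map_one, mul_one] at this
    exact this
  have hcomm : ∀ a b : β.stab φ, u a * u b = u b * u a := fun a b => by
    rw [← map_mul, mul_comm, map_mul]
  have hce : ∀ b : β.stab φ, (b : A) ∈ (res φ R hR).ker → u b * β.σ e = β.σ e * u b :=
    fun b hb => hu.commute b (hfix b hb _)
  have hce' : ∀ b : β.stab φ, (b : A) ∈ (res φ R hR).ker → u b * β.σ e' = β.σ e' * u b :=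
    fun b hb => hu.commute b (by rw [he'R]; exact hfix b hb _)
  set x := β.s (β.σ e * u b'⁻¹ * β.σ e') with hx
  set y := β.s (β.σ e' * u b' * β.σ e) with hy
  have hxf : ∀ l ∈ (res φ R hR).ker, act F φ l x = x := fun l hl => hs l hl _ fun a ha => by
    rw [mul_assoc, ← mul_assoc, hce a ha, mul_assoc, ← mul_assoc (u a), hcomm, mul_assoc (u _),
      hce' a ha]
    simp only [mul_assoc]
  have hyf : ∀ l ∈ (res φ R hR).ker, act F φ l y = y := fun l hl => hs l hl _ fun a ha => by
    rw [mul_assoc, ← mul_assoc, hce' a ha, mul_assoc, ← mul_assoc (u a), hcomm, mul_assoc (u _),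
      hce a ha]
    simp only [mul_assoc]
  have hσe' : β.σ e' = u b' * β.σ e * u b'⁻¹ := hu.conj b' e
  have huu : u b'⁻¹ * u b' = 1 := by rw [← map_mul, inv_mul_cancel, map_one]
  have hσee : β.σ e * β.σ e = β.σ e := by rw [← map_mul, hee]
  have hxy : x * y = e := by
    have : β.σ e * u b'⁻¹ * β.σ e' * (β.σ e' * u b' * β.σ e) = β.σ e := by
      rw [hσe']
      have h1 : ∀ T, u b'⁻¹ * (u b' * T) = T := fun T => by rw [← mul_assoc, huu, one_mul]
      have h2 : ∀ T, β.σ e * (β.σ e * T) = β.σ e * T := fun T => by rw [← mul_assoc, hσee]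
      simp only [mul_assoc, h1, h2, hσee]
    rw [hx, hy, ← β.s_mul, this, β.s_σ', β.c_comm, hec]
  have hsx : e * x * e' = x := by
    have h1 : β.σ (e * x * e') = β.σ x := by
      rw [map_mul, map_mul, hx, β.σ_s]
      have h2 : β.σ e' * β.σ e' = β.σ e' := by rw [← map_mul, he', ← map_mul, hee]
      rw [mul_assoc, mul_assoc (_ * _), h2, ← mul_assoc, ← mul_assoc, hσee]
    have h3 := congrArg β.s h1
    rw [β.s_σ', β.s_σ'] at h3
    rwa [← mul_assoc, ← mul_assoc, β.c_comm e, hec, hx, β.c_mul_s] at h3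
  have hxp : proj F R x = 0 := by
    have h1 : θ.e i₀ i₀ * act F (res φ R hR) b θ.c = 0 := by
      rw [← θ.e_mul_c i₀ i₀, mul_assoc, θ.c_mul_act_c _ b hb', mul_zero]
    have h2 : act F (res φ R hR) b (θ.e i₀ i₀) =
        act F (res φ R hR) b θ.c * act F (res φ R hR) b (θ.e i₀ i₀) := by
      rw [← map_mul (act F (res φ R hR) b), θ.c_mul_e]
    rw [← hsx, he'R, proj_mul_inc, he, proj_inc_mul, h2, ← mul_assoc, mul_assoc (θ.e i₀ i₀),
      ← θ.act_c_comm, ← mul_assoc, h1, zero_mul, zero_mul]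
  obtain ⟨z, hz⟩ := hfree.exists_eq_tr hxf hxp
  have h0 : proj F R e = 0 := by
    rw [← hxy, hz, tr_mul _ _ _ hyf, proj_tr φ R hR _ le_rfl hLF]
  rw [he, proj_inc] at h0
  exact θ.e_ne_zero _ _ h0

end FreeComplement

section Counting

variable {F : Type} [Field F] {N : Type} [Group N] {R : Subgroup N} {dθ : ℕ} (θ : Block F R dθ)
  (i₀ : Fin dθ)

/-- The linear parametrization of the column `i₀` of a block by coordinate vectors. -/
noncomputable def Block.col {R : Subgroup N} {dθ : ℕ} (θ : Block F R dθ) (i₀ : Fin dθ) :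
    (Fin dθ → F) →ₗ[F] F[R] :=
  Fintype.linearCombination F (fun j => θ.e j i₀)

lemma Block.col_apply (f : Fin dθ → F) : θ.col i₀ f = ∑ j, f j • θ.e j i₀ :=
  Fintype.linearCombination_apply ..

lemma Block.col_mul_e (f : Fin dθ → F) : θ.col i₀ f * θ.e i₀ i₀ = θ.col i₀ f := by
  rw [col_apply, Finset.sum_mul]
  exact Finset.sum_congr rfl fun j _ => by rw [smul_mul_assoc, θ.e_mul_e]

lemma Block.c_mul_col (f : Fin dθ → F) : θ.c * θ.col i₀ f = θ.col i₀ f := by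
  rw [col_apply, Finset.mul_sum]
  exact Finset.sum_congr rfl fun j _ => by rw [mul_smul_comm, θ.c_mul_e]

lemma Block.e_mul_col (f : Fin dθ → F) (k : Fin dθ) :
    θ.e i₀ k * θ.col i₀ f = f k • θ.e i₀ i₀ := by
  rw [col_apply, Finset.mul_sum, Finset.sum_eq_single k]
  · rw [mul_smul_comm, θ.e_mul_e]
  · intro j _ hj
    rw [mul_smul_comm, θ.e_mul_e_of_ne _ _ hj.symm, smul_zero]
  · simp

lemma Block.exists_col (x : F[R]) : ∃ f, x * θ.e i₀ i₀ = θ.col i₀ f := by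
  choose α hα using fun j => θ.e_mul_mul_e j i₀ x
  refine ⟨α, ?_⟩
  rw [col_apply, ← θ.c_mul_e i₀ i₀, ← mul_assoc, ← θ.c_comm, mul_assoc, ← θ.sum_e, Finset.sum_mul]
  exact Finset.sum_congr rfl fun j _ => by rw [← hα, mul_assoc]

lemma Block.col_eq_zero {f : Fin dθ → F} (h : θ.col i₀ f = 0) : f = 0 := by
  funext k
  have := θ.e_mul_col i₀ f k
  rw [h, mul_zero] at this
  exact (smul_eq_zero.1 this.symm).resolve_right (θ.e_ne_zero _ _)

lemma Block.index_mul_le [Finite N] {d : ℕ} (β : Block F N d)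
    (hec : inc F R (θ.e i₀ i₀) * β.c = inc F R (θ.e i₀ i₀)) :
    R.index * dθ ≤ d * rk (β.σ (inc F R (θ.e i₀ i₀))) := by
  classical
  let _ : Fintype (N ⧸ R) := Fintype.ofFinite _
  set e := inc F R (θ.e i₀ i₀) with he
  let Y : (N ⧸ R → Fin dθ → F) →ₗ[F] F[N] :=
    ∑ t : N ⧸ R, LinearMap.mulLeft F (single t.out (1 : F)) ∘ₗ (inc F R).toLinearMap ∘ₗ
      θ.col i₀ ∘ₗ LinearMap.proj t
  have hY : ∀ f, Y f = ∑ t, single t.out (1 : F) * inc F R (θ.col i₀ (f t)) := fun f => by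
    simp [Y, LinearMap.sum_apply]
  have hYe : ∀ f, Y f * e = Y f := fun f => by
    rw [hY, Finset.sum_mul]
    exact Finset.sum_congr rfl fun t _ => by rw [mul_assoc, he, ← map_mul, θ.col_mul_e]
  have hY0 : ∀ f, Y f = 0 → f = 0 := by
    intro f hf
    funext t
    apply θ.col_eq_zero i₀
    have h1 : proj F R (single t.out⁻¹ (1 : F) * Y f) = 0 := by rw [hf, mul_zero, map_zero]
    rw [hY, Finset.mul_sum, map_sum, Finset.sum_eq_single t] at h1
    · rwa [← mul_assoc, single_mul_single, inv_mul_cancel, one_mul, ← one_def, one_mul,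
        proj_inc] at h1
    · intro s _ hs
      rw [← mul_assoc, proj_mul_inc, single_mul_single, proj_single_of_notMem, zero_mul]
      intro h
      rw [← QuotientGroup.eq, QuotientGroup.out_eq', QuotientGroup.out_eq'] at h
      exact hs h.symm
    · simp
  let Λ : (N ⧸ R → Fin dθ → F) →ₗ[F] (LinearMap.range (β.σ e) →ₗ[F] (Fin d → F)) :=
    (LinearMap.lcomp F (Fin d → F) (LinearMap.range (β.σ e)).subtype) ∘ₗ β.σ.toLinearMap ∘ₗ Y
  have hΛ : Function.Injective Λ := by
    rw [injective_iff_map_eq_zero]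
    intro f hf
    apply hY0
    have h1 : β.σ (Y f) = 0 := by
      rw [← hYe, map_mul]
      refine LinearMap.ext fun v => ?_
      exact LinearMap.congr_fun hf ⟨_, v, rfl⟩
    rw [← β.c_mul_eq_zero_iff, β.c_comm, ← hYe, mul_assoc, hec, hYe] at h1
    exact h1
  have h := LinearMap.finrank_le_finrank_of_injective hΛ
  rw [Module.finrank_linearMap, Module.finrank_fin_fun, Module.finrank_pi_fintype,
    Finset.sum_const, Module.finrank_fin_fun, Finset.card_univ, ← Nat.card_eq_fintype_card,
    smul_eq_mul] at h
  rw [mul_comm d]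
  exact h

lemma rk_mul_rk_avg_le [Finite N] {d : ℕ} (β : Block F N d) (Q : Subgroup N)
    (hQ : (Nat.card Q : F) ≠ 0) (hfact : ∀ n, ∃ q ∈ Q, ∃ r ∈ R, n = q * r) :
    rk (β.σ (inc F R (θ.e i₀ i₀))) * rk (β.σ (avg F Q)) ≤ dθ := by
  set e := inc F R (θ.e i₀ i₀) with he
  set q := avg F Q with hq
  have hee : β.σ e * β.σ e = β.σ e := by rw [← map_mul, he, ← map_mul, θ.e_mul_e]
  have hqq : β.σ q * β.σ q = β.σ q := by rw [← map_mul, avg_mul_avg Q hQ]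
  have hex : ∀ x : F[N], ∃ y : F[R], q * x = q * inc F R y := by
    intro x
    induction x using MonoidAlgebra.induction_linear with
    | zero => exact ⟨0, by rw [map_zero]⟩
    | add x y hx hy =>
      obtain ⟨x', hx⟩ := hx
      obtain ⟨y', hy⟩ := hy
      exact ⟨x' + y', by rw [mul_add, hx, hy, map_add, mul_add]⟩
    | single n s =>
      obtain ⟨a, ha, r, hr, rfl⟩ := hfact n
      refine ⟨single ⟨r, hr⟩ s, ?_⟩
      rw [inc_single, ← one_mul s, ← single_mul_single, ← mul_assoc, avg_mul_single Q ha, one_mul]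
  let Ω : (Fin dθ → F) →ₗ[F] End F (Fin d → F) :=
    β.σ.toLinearMap ∘ₗ LinearMap.mulLeft F q ∘ₗ (inc F R).toLinearMap ∘ₗ θ.col i₀
  let J : (LinearMap.range (β.σ e) →ₗ[F] LinearMap.range (β.σ q)) →ₗ[F] End F (Fin d → F) :=
    (LinearMap.lcomp F (Fin d → F) (β.σ e).rangeRestrict) ∘ₗ
      (LinearMap.range (β.σ q)).subtype.compRight F
  have hJ : ∀ T v, J T v = (T ⟨β.σ e v, v, rfl⟩ : Fin d → F) := fun T v => rfl
  have hJi : Function.Injective J := by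
    rw [injective_iff_map_eq_zero]
    intro T hT
    ext1 ⟨_, v, rfl⟩
    apply Subtype.ext
    rw [← hJ, hT]; rfl
  have hJΩ : LinearMap.range J ≤ LinearMap.range Ω := by
    rintro _ ⟨T, rfl⟩
    have h1 : β.σ q * J T * β.σ e = J T := by
      refine LinearMap.ext fun v => ?_
      rw [Module.End.mul_apply, Module.End.mul_apply, hJ, hJ]
      have h2 : (⟨β.σ e (β.σ e v), _, rfl⟩ : LinearMap.range (β.σ e)) = ⟨β.σ e v, v, rfl⟩ :=
        Subtype.ext (LinearMap.congr_fun hee v)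
      rw [h2]
      obtain ⟨w, hw⟩ := (T ⟨β.σ e v, v, rfl⟩).2
      rw [← hw, ← Module.End.mul_apply, hqq]
    obtain ⟨y, hy⟩ := hex (β.s (J T))
    obtain ⟨f, hf⟩ := θ.exists_col i₀ y
    refine ⟨f, ?_⟩
    change β.σ (q * inc F R (θ.col i₀ f)) = J T
    rw [← hf, map_mul (inc F R), ← mul_assoc, ← hy, map_mul, map_mul, β.σ_s, ← he, h1]
  have h1 := Submodule.finrank_mono hJΩ
  rw [LinearMap.finrank_range_of_inj hJi, Module.finrank_linearMap] at h1
  have h2 := LinearMap.finrank_range_le Ω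
  rw [Module.finrank_fin_fun] at h2
  exact h1.trans h2

end Counting

section Fixed

variable {F : Type} [Field F] {N : Type} [Group N] [Finite N] {A : Type} [CommGroup A] [Finite A]
  {p : ℕ} [ExpChar F p] {n : ℕ} {φ : A →* MulAut N} (R : Subgroup N) (hR : Invt φ R)
  {M : Type} [AddCommGroup M] [Module F M] {ρ : F[N] →ₐ[F] End F M}
  {u : (res φ R hR).ker →* End F M}

lemma Compat.eq_zero_of_fixed (h : Compat φ (res φ R hR).ker ρ u)
    (hfree : FreeOff φ (res φ R hR).ker R) (c : F[R]) (hc : opSum u * ρ (inc F R c) = 0)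
    (x : F[N]) (hx : ∀ l ∈ (res φ R hR).ker, act F φ l x = x) (hxp : proj F R x = 1)
    {v : M} (hv : ∀ l, u l v = v) (hcv : ρ (inc F R c) v = v) (hxv : ρ x v = 0) : v = 0 := by
  obtain ⟨z, hz⟩ := hfree.exists_eq_tr (y := 1 - x)
    (fun l hl => by rw [map_sub, map_one, hx l hl]) (by rw [map_sub, proj_one, hxp, sub_self])
  have h1 : opSum u (ρ z v) = v := by
    rw [← h.apply_tr z hv, ← hz, map_sub, map_one, LinearMap.sub_apply, hxv, sub_zero,
      Module.End.one_apply]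
  rw [h.opSum_commute fun l hl => act_inc_of_mem_ker φ R hR hl c] at hc
  rw [← hcv, ← h1, ← Module.End.mul_apply, hc, LinearMap.zero_apply]

lemma Compat.le_rk [FiniteDimensional F M] (hA : ∀ a : A, a ^ p ^ n = 1)
    (h : Compat φ (res φ R hR).ker ρ u)
    (hfree : FreeOff φ (res φ R hR).ker R) {dθ : ℕ} (θ : Block F R dθ) (i₀ : Fin dθ)
    (hc : opSum u * ρ (inc F R θ.c) = 0) (he : ρ (inc F R (θ.e i₀ i₀)) ≠ 0)
    (x : F[N]) (hx : ∀ l ∈ (res φ R hR).ker, act F φ l x = x) (hxp : proj F R x = 1) :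
    dθ ≤ rk (ρ x) := by
  have hfix : ∀ l ∈ (res φ R hR).ker, ∀ x, act F φ l (inc F R x) = inc F R x :=
    fun l hl x => act_inc_of_mem_ker φ R hR hl x
  obtain ⟨w, ⟨w', hw'⟩, hw0, hw⟩ := exists_fixed_vector (p := p) (n := n) (fun k => u k)
    (fun i j => by rw [← map_mul, mul_comm, map_mul])
    (fun k => by
      rw [← map_pow, show k ^ p ^ n = 1 from Subtype.ext (hA k), map_one])
    (LinearMap.range (ρ (inc F R (θ.e i₀ i₀)))) (by rwa [Ne, LinearMap.range_eq_bot])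
    (by
      rintro k _ ⟨w, rfl⟩
      refine ⟨u k w, ?_⟩
      rw [← Module.End.mul_apply, ← Module.End.mul_apply, h.commute k (hfix k k.2 _)])
  have hew : ρ (inc F R (θ.e i₀ i₀)) w = w := by
    rw [← hw', ← Module.End.mul_apply, ← map_mul, ← map_mul, θ.e_mul_e]
  let Φ : (Fin dθ → F) →ₗ[F] LinearMap.range (ρ x) :=
    (ρ x).rangeRestrict ∘ₗ LinearMap.applyₗ w ∘ₗ ρ.toLinearMap ∘ₗ (inc F R).toLinearMap ∘ₗ
      θ.col i₀
  have hΦ : Function.Injective Φ := by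
    rw [injective_iff_map_eq_zero]
    intro f hf
    have h1 : ρ x (ρ (inc F R (θ.col i₀ f)) w) = 0 := congrArg Subtype.val hf
    have h2 := h.eq_zero_of_fixed R hR hfree θ.c hc x hx hxp (fun l => by
      rw [← Module.End.mul_apply, h.commute l (hfix l l.2 _), Module.End.mul_apply, hw]) (by
      rw [← Module.End.mul_apply, ← map_mul, ← map_mul, θ.c_mul_col]) h1
    funext k
    have h3 : ρ (inc F R (θ.e i₀ k * θ.col i₀ f)) w = 0 := by
      rw [map_mul, map_mul, Module.End.mul_apply, h2, map_zero]
    rw [θ.e_mul_col, map_smul, map_smul, LinearMap.smul_apply, hew] at h3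
    exact (smul_eq_zero.1 h3).resolve_right hw0
  have := LinearMap.finrank_le_finrank_of_injective hΦ
  rwa [Module.finrank_fin_fun] at this

omit [Finite A] in
lemma act_avg (Q : Subgroup N) {a : A} (ha : ∀ n ∈ Q, φ a n ∈ Q) :
    act F φ a (avg F Q) = avg F Q := by
  let _ := Fintype.ofFinite Q
  have hinj : Function.Injective (fun y : Q => (⟨φ a y, ha y y.2⟩ : Q)) := by
    intro y z hyz
    exact Subtype.ext ((φ a).injective (congrArg Subtype.val hyz))
  rw [avg, map_smul, map_sum]
  congr 1
  simp only [act_single]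
  exact Fintype.sum_equiv (Equiv.ofBijective _ (Finite.injective_iff_bijective.1 hinj)) _ _
    (fun _ => rfl)

lemma proj_avg (Q : Subgroup N) (hRQ : R ⊓ Q = ⊥) (hQ : (Nat.card Q : F) = 1) :
    proj F R (avg F Q) = 1 := by
  classical
  let _ := Fintype.ofFinite Q
  rw [avg, hQ, inv_one, one_smul, map_sum, Finset.sum_eq_single (1 : Q)]
  · exact proj_one R
  · intro q _ hq
    rw [proj_single_of_notMem]
    intro hqR
    have : (q : N) ∈ R ⊓ Q := ⟨hqR, q.2⟩
    rw [hRQ, Subgroup.mem_bot] at this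
    exact hq (Subtype.ext this)
  · simp

end Fixed

section CoreFree

variable {F : Type} [Field F] [IsAlgClosed F] {N : Type} [Group N] [Finite N]
  {A : Type} [CommGroup A] [Finite A] {p : ℕ} [Fact p.Prime] [CharP F p] {n : ℕ}

lemma neZero_card_of_not_dvd (F : Type) [Field F] {p : ℕ} [CharP F p] {N : Type}
    (hp : ¬ p ∣ Nat.card N) : NeZero (Nat.card N : F) :=
  ⟨fun h => hp ((CharP.cast_eq_zero_iff F p _).1 h)⟩

lemma HasBigBlock.of_core_eq_bot (hp : ¬ p ∣ Nat.card N) (hA : ∀ a : A, a ^ p ^ n = 1)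
    (φ : A →* MulAut N) (R : Subgroup N) (hR : Invt φ R) (hfree : FreeOff φ (res φ R hR).ker R)
    (hL1 : 1 < Nat.card (res φ R hR).ker) (hcore : R.normalCore = ⊥) (hRtop : R ≠ ⊤)
    (h : HasBigBlock F (res φ R hR)) : HasBigBlock F φ := by
  have : ExpChar F p := ExpChar.prime Fact.out
  have : NeZero (Nat.card N : F) := neZero_card_of_not_dvd F hp
  by_contra hφ
  obtain ⟨dθ, θ, hθ⟩ := h
  have hL : IsPGroup p (res φ R hR).ker := fun l => ⟨n, Subtype.ext (hA l)⟩
  have hpL : p ∣ Nat.card (res φ R hR).ker := by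
    obtain ⟨k, hk⟩ := hL.exists_card_eq
    rw [hk] at hL1 ⊢
    exact dvd_pow_self p (by rintro rfl; simp at hL1)
  have hcop : (Nat.card N).Coprime (Nat.card (res φ R hR).ker) := by
    obtain ⟨k, hk⟩ := hL.exists_card_eq
    rw [hk]
    exact Nat.Coprime.pow_right _ (((Fact.out : p.Prime).coprime_iff_not_dvd.2 hp).symm)
  have hLF : (Nat.card (res φ R hR).ker : F) = 0 := (CharP.cast_eq_zero_iff F p _).2 hpL
  have hfixR : ∀ l ∈ (res φ R hR).ker, ∀ n ∈ R, φ l n = n := fun l hl =>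
    (mem_ker_res φ R hR l).1 hl
  let i₀ : Fin dθ := ⟨0, θ.pos⟩
  set e := inc F R (θ.e i₀ i₀) with he
  have he0 : e ≠ 0 := by
    rw [he, Ne, map_eq_zero_iff _ (inc_injective R)]
    exact θ.e_ne_zero _ _
  obtain ⟨d, β, hβ⟩ := exists_block e he0
  obtain ⟨hLB, hec⟩ := Block.fixed_of_σ_ne_zero hA φ hφ R hR hfree hLF θ hθ i₀ β hβ
  obtain ⟨u, hu⟩ := β.exists_compat hA φ
  have hrk := Block.rk_lt_card φ hφ R hR θ hθ i₀ β hu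
  have hBθ := (Nat.card_mono (Set.toFinite _)
    (Block.stab_le_stab φ R hR hfree hLF θ i₀ β hu hLB hec)).trans hθ
  have hidx := θ.index_mul_le i₀ β hec
  have hd : d < Nat.card (β.stab φ) := by
    by_contra! hle
    exact hφ (.of_good φ β hle)
  have hm0 := rk_pos hβ
  have huL := hu.mono hLB
  have hzero := huL.opSum_mul_eq_zero hA R hR θ i₀ hrk
  rw [← he] at hrk hidx
  set m := rk (β.σ e) with hm
  set l := Nat.card (res φ R hR).ker with hl
  have hdl : d < dθ * l := hd.trans_le hBθ
  have hdθ := θ.pos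
  have hidx2 : R.index < l ^ 2 := by
    have h1 : R.index * dθ < l * m * dθ := by
      refine hidx.trans_lt ?_
      calc d * m < dθ * l * m := Nat.mul_lt_mul_of_pos_right hdl hm0
        _ = l * m * dθ := by ring
    have h2 := Nat.lt_of_mul_lt_mul_right h1
    nlinarith
  obtain ⟨Q, hQL, hRQ, hfact⟩ :=
    exists_invt_complement hp φ _ R hL hL1 hfree hfixR hcore hRtop hidx2
  have hQ1 : (Nat.card Q : F) = 1 := by
    have h1 := hfree.index_modEq hfixR hQL hcop
    have h2 := card_inf_mul_relIndex R Q
    rw [hRQ, Subgroup.card_bot, one_mul] at h2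
    rw [h2] at h1
    have h3 := h1.of_dvd hpL
    exact_mod_cast (CharP.natCast_eq_natCast F p).2 h3
  have h1 := huL.le_rk R hR hA hfree θ i₀ hzero hβ (avg F Q)
    (fun a ha => act_avg Q (hQL a ha)) (proj_avg R Q hRQ hQ1)
  have h2 := rk_mul_rk_avg_le θ i₀ β Q (by rw [hQ1]; exact one_ne_zero) hfact
  have hm1 : m = 1 := by
    have h3 : m * dθ ≤ 1 * dθ := by
      rw [one_mul]
      exact (Nat.mul_le_mul le_rfl h1).trans h2
    have := Nat.le_of_mul_le_mul_right h3 hdθ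
    omega
  have hlt : R.index < l := by
    rw [hm1, mul_one] at hidx
    exact Nat.lt_of_mul_lt_mul_right (a := dθ) (by rw [mul_comm l]; exact hidx.trans_lt hdl)
  have hmod : R.index ≡ 1 [MOD l] := by
    rw [← Subgroup.relIndex_top_right]
    exact hfree.index_modEq hfixR (fun _ _ _ _ => Subgroup.mem_top _) hcop
  exact hRtop (Subgroup.index_eq_one.1 (Nat.ModEq.eq_of_lt_of_lt hmod hlt hL1))

end CoreFree

section CoprimeAction

variable {N : Type} [Group N] {A : Type} [CommGroup A]

/-- The subgroup of fixed points of a single element. -/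
def fixPts (φ : A →* MulAut N) (a : A) : Subgroup N where
  carrier := {n | φ a n = n}
  one_mem' := map_one _
  mul_mem' := fun {x y} hx hy => by
    rw [Set.mem_ofPred_eq] at hx hy ⊢
    rw [map_mul, hx, hy]
  inv_mem' := fun {x} hx => by
    rw [Set.mem_ofPred_eq] at hx ⊢
    rw [map_inv, hx]

lemma mem_fixPts (φ : A →* MulAut N) (a : A) (n : N) : n ∈ fixPts φ a ↔ φ a n = n := Iff.rfl

lemma apply_comm (φ : A →* MulAut N) (a b : A) (n : N) : φ a (φ b n) = φ b (φ a n) := by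
  rw [← MulAut.mul_apply, ← MulAut.mul_apply, ← map_mul, mul_comm, map_mul]

lemma invt_fixPts (φ : A →* MulAut N) (a : A) : Invt φ (fixPts φ a) := by
  intro b n hn
  rw [mem_fixPts] at hn ⊢
  rw [apply_comm, hn]

lemma Invt.normalCore {φ : A →* MulAut N} {R : Subgroup N} (hR : Invt φ R) :
    Invt φ R.normalCore := by
  intro a n hn g
  obtain ⟨g, rfl⟩ := (φ a).surjective g
  rw [← map_inv, ← map_mul, ← map_mul]
  exact hR a _ (hn g)

lemma Invt.centralizer {φ : A →* MulAut N} {R : Subgroup N} (hR : Invt φ R) :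
    Invt φ (Subgroup.centralizer (R : Set N)) := by
  intro a n hn
  rw [Subgroup.mem_centralizer_iff] at hn ⊢
  intro r hr
  have h1 := hn (φ a⁻¹ r) (hR a⁻¹ r hr)
  have h2 := congrArg (φ a) h1
  simpa using h2

lemma Invt.sup {φ : A →* MulAut N} {R S : Subgroup N} [S.Normal] (hR : Invt φ R) (hS : Invt φ S) :
    Invt φ (R ⊔ S) := by
  intro a n hn
  rw [Subgroup.mem_sup_of_normal_right] at hn ⊢
  obtain ⟨r, hr, s, hs, rfl⟩ := hn
  exact ⟨_, hR a r hr, _, hS a s hs, (map_mul _ _ _).symm⟩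

lemma Invt.inf {φ : A →* MulAut N} {R S : Subgroup N} (hR : Invt φ R) (hS : Invt φ S) :
    Invt φ (R ⊓ S) :=
  fun a n hn => ⟨hR a n hn.1, hS a n hn.2⟩

lemma apply_eq_self_of_fixed {p : ℕ} [Fact p.Prime] {m : ℕ} (hp : ¬ p ∣ Nat.card N)
    (φ : A →* MulAut N) {a : A} (ha : a ^ p ^ m = 1) {n : N}
    (h : φ a (n⁻¹ * φ a n) = n⁻¹ * φ a n) : φ a n = n := by
  set x := n⁻¹ * φ a n with hx
  have h1 : ∀ k : ℕ, φ (a ^ k) n = n * x ^ k := by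
    intro k
    induction k with
    | zero => simp
    | succ k ih =>
      rw [pow_succ', map_mul, MulAut.mul_apply, ih, map_mul, map_pow, h, pow_succ', ← mul_assoc]
      simp [hx]
  have h2 := h1 (p ^ m)
  rw [ha, map_one, MulAut.one_apply, left_eq_mul] at h2
  have h3 : orderOf x ∣ 1 := by
    have hc : (p ^ m).Coprime (Nat.card N) :=
      Nat.Coprime.pow_left _ ((Fact.out : p.Prime).coprime_iff_not_dvd.2 hp)
    rw [← hc]
    exact Nat.dvd_gcd (orderOf_dvd_of_pow_eq_one h2) (orderOf_dvd_natCard x)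
  rw [Nat.dvd_one, orderOf_eq_one_iff, hx, inv_mul_eq_one] at h3
  exact h3.symm

lemma eq_one_of_ker_eq_bot {φ : A →* MulAut N} (hφ : φ.ker = ⊥) {a : A} (h : ∀ n, φ a n = n) :
    a = 1 := by
  rw [← Subgroup.mem_bot, ← hφ, MonoidHom.mem_ker]
  ext n
  exact h n

lemma apply_eq_self_of_centralizer {p : ℕ} [Fact p.Prime] {m : ℕ} (hp : ¬ p ∣ Nat.card N)
    (φ : A →* MulAut N) {a : A} (ha : a ^ p ^ m = 1) (Z : Subgroup N) [hZn : Z.Normal]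
    (hZ : ∀ z ∈ Z, φ a z = z) (hX : ∀ x ∈ Subgroup.centralizer (Z : Set N), φ a x = x) (n : N) :
    φ a n = n := by
  refine apply_eq_self_of_fixed hp φ ha (hX _ ?_)
  rw [Subgroup.mem_centralizer_iff]
  intro z hz
  have h1 := hZ _ (hZn.conj_mem z hz n)
  rw [map_mul, map_mul, map_inv, hZ z hz] at h1
  rw [mul_inv_eq_iff_eq_mul] at h1
  rw [eq_comm, mul_assoc, h1]
  group

lemma Subgroup.card_lt_of_ne_top [Finite N] {H : Subgroup N} (h : H ≠ ⊤) :
    Nat.card H < Nat.card N :=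
  lt_of_le_of_ne H.card_le_card_group fun h' => h (Subgroup.eq_top_of_card_eq H h')

end CoprimeAction

section Induction

variable {F : Type} [Field F] [IsAlgClosed F] {p : ℕ} [Fact p.Prime] [CharP F p] {m : ℕ}

lemma HasBigBlock.of_central_displacement {N : Type} [Group N] [Finite N] {A : Type} [CommGroup A]
    [Finite A] (hp : ¬ p ∣ Nat.card N) (hA : ∀ a : A, a ^ p ^ m = 1) (φ : A →* MulAut N)
    (hφ : φ.ker = ⊥)
    (ih : ∀ (N' : Type) [Group N'] [Finite N'] (ψ : A →* MulAut N'),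
      Nat.card N' < Nat.card N → ¬ p ∣ Nat.card N' → HasBigBlock F ψ)
    (Y : Subgroup N) (hYtop : Y ≠ ⊤) (hYc : ∀ y ∈ Y, ∀ n, y * n = n * y)
    {b : A} (hb1 : b ≠ 1) (hb : ∀ n, n⁻¹ * φ b n ∈ Y) : HasBigBlock F φ := by
  have : ExpChar F p := ExpChar.prime Fact.out
  have : NeZero (Nat.card N : F) := neZero_card_of_not_dvd F hp
  let δ : N →* N := MonoidHom.mk' (fun n => n⁻¹ * φ b n) fun x y => by
    rw [map_mul, mul_inv_rev]
    have := hYc _ (hb x) y⁻¹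
    calc y⁻¹ * x⁻¹ * (φ b x * φ b y) = y⁻¹ * (x⁻¹ * φ b x) * φ b y := by group
      _ = (x⁻¹ * φ b x) * y⁻¹ * φ b y := by rw [this]
      _ = _ := by group
  have hδ : ∀ n, δ n = n⁻¹ * φ b n := fun _ => rfl
  have hD : Invt φ δ.range := by
    rintro a _ ⟨n, rfl⟩
    refine ⟨φ a n, ?_⟩
    rw [hδ, hδ, map_mul, map_inv, apply_comm]
  have hDY : δ.range ≤ Y := by
    rintro _ ⟨n, rfl⟩
    exact hb n
  have hDK : δ.range ⊓ fixPts φ b = ⊥ := by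
    rw [eq_bot_iff]
    rintro _ ⟨⟨n, rfl⟩, hn⟩
    have hn : φ b (δ n) = δ n := hn
    rw [Subgroup.mem_bot, hδ, apply_eq_self_of_fixed hp φ (hA b) hn, inv_mul_cancel]
  have hprod : ∀ n, ∃ d ∈ δ.range, ∃ k ∈ fixPts φ b, n = d * k := by
    intro n
    have hinj : Function.Injective (fun d : δ.range => (⟨δ d, d, rfl⟩ : δ.range)) := by
      intro x y hxy
      have h1 : δ x = δ y := congrArg Subtype.val hxy
      have h2 : (x : N)⁻¹ * y ∈ δ.range ⊓ fixPts φ b := by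
        refine ⟨δ.range.mul_mem (δ.range.inv_mem x.2) y.2, ?_⟩
        change φ b _ = _
        have h3 : δ ((x : N)⁻¹ * y) = 1 := by rw [map_mul, map_inv, h1, inv_mul_cancel]
        rw [hδ, inv_mul_eq_one] at h3
        exact h3.symm
      rw [hDK, Subgroup.mem_bot, inv_mul_eq_one] at h2
      exact Subtype.ext h2
    obtain ⟨d, hd⟩ := Finite.injective_iff_surjective.1 hinj ⟨δ n, n, rfl⟩
    have hd : δ d = δ n := congrArg Subtype.val hd
    refine ⟨d, d.2, (d : N)⁻¹ * n, ?_, by group⟩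
    have h3 : δ ((d : N)⁻¹ * n) = 1 := by rw [map_mul, map_inv, hd, inv_mul_cancel]
    rw [hδ, inv_mul_eq_one] at h3
    exact h3.symm
  have hKtop : fixPts φ b ≠ ⊤ := fun h =>
    hb1 (eq_one_of_ker_eq_bot hφ fun n => (mem_fixPts φ b n).1 (h ▸ Subgroup.mem_top n))
  have hsub : ∀ (H : Subgroup N) (hH : Invt φ H), H ≠ ⊤ → HasBigBlock F (res φ H hH) :=
    fun H hH h => ih H _ (Subgroup.card_lt_of_ne_top h)
      fun h => hp (h.trans H.card_subgroup_dvd_card)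
  refine .of_prod hA φ δ.range (fixPts φ b) hD (invt_fixPts φ b) hDK
    (fun r hr s _ => hYc r (hDY hr) s) ?_ (hsub _ _ ?_) (hsub _ _ hKtop)
  · rw [eq_bot_iff]
    rintro c ⟨hc1, hc2⟩
    have hc1 := (mem_ker_res _ _ hD c).1 hc1
    have hc2 := (mem_ker_res _ _ (invt_fixPts φ b) c).1 hc2
    refine Subgroup.mem_bot.2 (eq_one_of_ker_eq_bot hφ fun n => ?_)
    obtain ⟨d, hd, k, hk, rfl⟩ := hprod n
    rw [map_mul, hc1 d hd, hc2 k hk]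
  · intro h
    exact hYtop (top_le_iff.1 (h ▸ hDY))

lemma HasBigBlock.of_normal_fixed {N : Type} [Group N] [Finite N] {A : Type} [CommGroup A]
    [Finite A] (hp : ¬ p ∣ Nat.card N) (hA : ∀ a : A, a ^ p ^ m = 1) (φ : A →* MulAut N)
    (hφ : φ.ker = ⊥)
    (ih : ∀ (N' : Type) [Group N'] [Finite N'] (ψ : A →* MulAut N'),
      Nat.card N' < Nat.card N → ¬ p ∣ Nat.card N' → HasBigBlock F ψ)
    (Z : Subgroup N) [hZn : Z.Normal] (hZ : Invt φ Z) (hZbot : Z ≠ ⊥) (hZtop : Z ≠ ⊤) :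
    HasBigBlock F φ := by
  have : ExpChar F p := ExpChar.prime Fact.out
  have : NeZero (Nat.card N : F) := neZero_card_of_not_dvd F hp
  have hsub : ∀ (H : Subgroup N) (hH : Invt φ H), H ≠ ⊤ → HasBigBlock F (res φ H hH) :=
    fun H hH h => ih H _ (Subgroup.card_lt_of_ne_top h)
      fun h => hp (h.trans H.card_subgroup_dvd_card)
  set X := Subgroup.centralizer (Z : Set N) with hX
  have hXi : Invt φ X := hZ.centralizer
  have hXn : X.Normal := Subgroup.normal_centralizer
  have hfaith : ∀ c, (∀ x ∈ X, φ c x = x) → (∀ z ∈ Z, φ c z = z) → c = 1 := fun c h1 h2 =>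
    eq_one_of_ker_eq_bot hφ (apply_eq_self_of_centralizer hp φ (hA c) Z h2 h1)
  have hXZ : ∀ x ∈ X, ∀ z ∈ Z, x * z = z * x := fun x hx z hz =>
    (Subgroup.mem_centralizer_iff.1 hx z hz).symm
  by_cases htop : X ⊔ Z = ⊤
  swap
  · refine .of_subgroup hA φ (X ⊔ Z) (hXi.sup hZ) ?_ (hsub _ _ htop)
    rw [eq_bot_iff]
    intro c hc
    have hc := (mem_ker_res _ _ _ c).1 hc
    exact Subgroup.mem_bot.2 (hfaith c (fun x hx => hc x (Subgroup.mem_sup_left hx))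
      fun z hz => hc z (Subgroup.mem_sup_right hz))
  by_cases hY : X ⊓ Z = ⊥
  · refine .of_prod hA φ X Z hXi hZ hY hXZ ?_ (hsub _ _ ?_) (hsub _ _ hZtop)
    · rw [eq_bot_iff]
      rintro c ⟨hc1, hc2⟩
      exact Subgroup.mem_bot.2 (hfaith c ((mem_ker_res _ _ hXi c).1 hc1)
        ((mem_ker_res _ _ hZ c).1 hc2))
    · intro h
      rw [h, top_inf_eq] at hY
      exact hZbot hY
  have hYi : Invt φ (X ⊓ Z) := hXi.inf hZ
  by_cases hker : (quo φ (X ⊓ Z) hYi).ker = ⊥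
  · refine .of_quotient φ (X ⊓ Z) hYi hker (ih _ _ ?_ ?_)
    · have h1 := Subgroup.card_eq_card_quotient_mul_card_subgroup (X ⊓ Z)
      have h2 := (Subgroup.one_lt_card_iff_ne_bot (X ⊓ Z)).2 hY
      have h3 : 0 < Nat.card (N ⧸ (X ⊓ Z)) := Nat.card_pos
      rw [h1]
      exact lt_mul_of_one_lt_right h3 h2
    · exact fun h => hp (h.trans (Subgroup.card_quotient_dvd_card _))
  · rw [Subgroup.eq_bot_iff_forall] at hker
    push Not at hker
    obtain ⟨b, hb, hb1⟩ := hker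
    refine .of_central_displacement hp hA φ hφ ih (X ⊓ Z) ?_ ?_ hb1 ?_
    · exact fun h => hZtop (top_le_iff.1 (h ▸ inf_le_right))
    · rintro y ⟨hy1, hy2⟩ n
      have hn : n ∈ X ⊔ Z := htop ▸ Subgroup.mem_top n
      rw [Subgroup.mem_sup_of_normal_right] at hn
      obtain ⟨x, hx, z, hz, rfl⟩ := hn
      rw [← mul_assoc, ← hXZ x hx y hy2, mul_assoc, hXZ y hy1 z hz, mul_assoc]
    · intro n
      have := DFunLike.congr_fun (MonoidHom.mem_ker.1 hb) (n : N ⧸ (X ⊓ Z))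
      rw [quo_mk, MulAut.one_apply, eq_comm, QuotientGroup.eq] at this
      exact this

lemma HasBigBlock.of_ker_eq_bot {N : Type} [Group N] [Finite N] {A : Type} [CommGroup A]
    [Finite A] [Nontrivial A] (hp : ¬ p ∣ Nat.card N) (hA : ∀ a : A, a ^ p ^ m = 1)
    (φ : A →* MulAut N) (hφ : φ.ker = ⊥)
    (ih : ∀ (N' : Type) [Group N'] [Finite N'] (ψ : A →* MulAut N'),
      Nat.card N' < Nat.card N → ¬ p ∣ Nat.card N' → HasBigBlock F ψ) :
    HasBigBlock F φ := by
  obtain ⟨a₀, ha₀⟩ := exists_ne (1 : A)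
  obtain ⟨_, ⟨a, ha, rfl⟩, hmax⟩ := (wellFounded_gt (α := Subgroup N)).has_min
    {R | ∃ a, a ≠ 1 ∧ R = fixPts φ a} ⟨_, a₀, ha₀, rfl⟩
  set R := fixPts φ a with hRdef
  have hR : Invt φ R := invt_fixPts φ a
  have haL : a ∈ (res φ R hR).ker := (mem_ker_res φ R hR a).2 fun n hn => hn
  have hfree : FreeOff φ (res φ R hR).ker R := by
    intro l hl hl1 n hn
    have hle : R ≤ fixPts φ l := (mem_ker_res φ R hR l).1 hl
    have : R = fixPts φ l := by
      by_contra hne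
      exact hmax _ ⟨l, hl1, rfl⟩ (lt_of_le_of_ne hle hne)
    rw [this]
    exact hn
  have hRtop : R ≠ ⊤ := fun h =>
    ha (eq_one_of_ker_eq_bot hφ fun n => (mem_fixPts φ a n).1 (hRdef ▸ h ▸ Subgroup.mem_top n))
  by_cases hcore : R.normalCore = ⊥
  · refine .of_core_eq_bot hp hA φ R hR hfree ?_ hcore hRtop
      (ih R _ (Subgroup.card_lt_of_ne_top hRtop) fun h => hp (h.trans R.card_subgroup_dvd_card))
    rw [Subgroup.one_lt_card_iff_ne_bot]
    intro h
    rw [h] at haL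
    exact ha haL
  · exact .of_normal_fixed hp hA φ hφ ih R.normalCore hR.normalCore hcore
      fun h => hRtop (top_le_iff.1 (h ▸ R.normalCore_le))

theorem hasBigBlock_of_coprime (F : Type) [Field F] [IsAlgClosed F] [CharP F p]
    {N : Type} [Group N] [Finite N] {A : Type} [CommGroup A]
    [Finite A] (hp : ¬ p ∣ Nat.card N) (hA : ∀ a : A, a ^ p ^ m = 1) (φ : A →* MulAut N) :
    HasBigBlock F φ := by
  induction hN : Nat.card N using Nat.strong_induction_on generalizing N A with
  | _ k ih =>
    refine .of_faithful φ ?_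
    have hA' : ∀ a : A ⧸ φ.ker, a ^ p ^ m = 1 := by
      intro a
      induction a using QuotientGroup.induction_on with | H a =>
      rw [← QuotientGroup.mk_pow, hA, QuotientGroup.mk_one]
    rcases subsingleton_or_nontrivial (A ⧸ φ.ker) with hs | hs
    · have : NeZero (Nat.card N : F) := neZero_card_of_not_dvd F hp
      obtain ⟨d, β, -⟩ := exists_block (1 : F[N]) one_ne_zero
      refine .of_good _ β ?_
      have := Nat.card_of_subsingleton (1 : β.stab (QuotientGroup.kerLift φ))
      rw [this]
      exact β.pos
    · refine .of_ker_eq_bot hp hA' _ ((MonoidHom.ker_eq_bot_iff _).2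
        (QuotientGroup.kerLift_injective φ)) ?_
      intro N' _ _ ψ hlt hp'
      exact ih _ (hN ▸ hlt) hp' hA' ψ rfl

end Induction

section Final

lemma fdim_eq_finrank (F : Type) [Field F] (G : Type) [Group G] (S : Type) [AddCommGroup S]
    [Module F[G] S] [inst : Module F S] [IsScalarTower F F[G] S] : fdim F G S = finrank F S := by
  unfold fdim
  have : Module.compHom S (algebraMap F F[G]) = inst :=
    Module.ext' _ _ fun r x => algebraMap_smul F[G] r x
  rw [this]

lemma exists_simple_of_hasBigBlock (F : Type) [Field F] (G : Type) [Group G] [Finite G]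
    (N : Subgroup G) [hN : N.Normal]
    (A : Type) [CommGroup A] [Finite A] (ι : A →* G)
    (hker : ((MulAut.conjNormal (H := N)).comp ι).ker = ⊥)
    (hbig : HasBigBlock F ((MulAut.conjNormal (H := N)).comp ι)) :
    ∃ (S : Type) (_ : AddCommGroup S) (_ : Module (MonoidAlgebra F G) S),
      IsSimpleModule (MonoidAlgebra F G) S ∧ Nat.card A ≤ fdim F G S := by
  obtain ⟨d, β, hβ⟩ := hbig
  have hgood := β.good _ hβ
  set φ := (MulAut.conjNormal (H := N)).comp ι with hφ
  set c := inc F N β.c with hc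
  have hcc : c * c = c := by rw [hc, ← map_mul, β.c_mul_c]
  have hc0 : c ≠ 0 := by
    rw [hc, Ne, map_eq_zero_iff _ (inc_injective N)]
    exact β.c_ne_zero
  have hI : Ideal.span {1 - c} ≠ ⊤ := by
    intro h
    rw [Ideal.eq_top_iff_one, Ideal.mem_span_singleton'] at h
    obtain ⟨y, hy⟩ := h
    have := congrArg (· * c) hy
    simp only [mul_assoc, sub_mul, one_mul, hcc, sub_self, mul_zero] at this
    exact hc0 this.symm
  obtain ⟨m, hm, hle⟩ := Ideal.exists_le_maximal _ hI
  have hcm : 1 - c ∈ m := hle (Ideal.mem_span_singleton_self _)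
  have hfin : FiniteDimensional F (F[G] ⧸ m) :=
    Module.Finite.of_surjective (m.mkQ.restrictScalars F) m.mkQ_surjective
  refine ⟨F[G] ⧸ m, inferInstance, inferInstance, isSimpleModule_iff_isCoatom.2 hm.out, ?_⟩
  rw [fdim_eq_finrank]
  let r : F[G] →ₐ[F] End F (F[G] ⧸ m) := Algebra.lsmul F F (F[G] ⧸ m)
  let u : (⊤ : Subgroup A) →* End F (F[G] ⧸ m) :=
    (r : F[G] →* End F (F[G] ⧸ m)).comp
      ((MonoidAlgebra.of F G).comp (ι.comp (⊤ : Subgroup A).subtype))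
  have key := hgood ⊤ (F[G] ⧸ m) (r.comp (inc F N)) u 1 ?_ (.one _ _) ?_
  · rw [hker, bot_inf_eq, Subgroup.card_bot, mul_one, Subgroup.card_top] at key
    exact key.trans (rk_le_finrank _)
  · intro b x
    have h : ∀ x : F[N], single (ι b) (1 : F) * inc F N x =
        inc F N (act F φ b x) * single (ι b) (1 : F) := by
      intro x
      induction x using MonoidAlgebra.induction_linear with
      | zero => simp
      | add x y hx hy => simp only [map_add, mul_add, add_mul, hx, hy]
      | single n s =>
        simp [single_mul_single, hφ]
    change r (single (ι b) 1) * r (inc F N x) = r (inc F N (act F φ b x)) * r (single (ι b) 1)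
    rw [← map_mul, ← map_mul, h]
  · rw [mul_one]
    intro h0
    have h1 : r c (Submodule.Quotient.mk 1) = 0 := by
      change (r.comp (inc F N)) β.c _ = 0
      rw [h0]; rfl
    change c • (Submodule.Quotient.mk 1 : F[G] ⧸ m) = 0 at h1
    rw [← Submodule.Quotient.mk_smul, Submodule.Quotient.mk_eq_zero, smul_eq_mul, mul_one] at h1
    apply hm.ne_top
    rw [Ideal.eq_top_iff_one]
    have := m.add_mem hcm h1
    rwa [sub_add_cancel] at this

end Final

/-- Corollary 2: if `G` is a finite group admitting a normal `p'`-subgroup `N` with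
`C_G(N) ≤ N` (i.e. `F*(G)` is a `p'`-group), and `A` is an abelian `p`-subgroup of `G`
of maximal order, then there is a simple `FG`-module `S` with `dim S ≥ |A|`. -/
theorem simple_module_dim_ge_card_abelian_of_pPrime_fitting
    (p : ℕ) (hp : p.Prime)
    (F : Type) [Field F] [IsAlgClosed F] [CharP F p]
    (G : Type) [Group G] [Finite G]
    (N : Subgroup G) (hN : N.Normal) (hN' : Nat.Coprime (Nat.card N) p)
    (hNC : Subgroup.centralizer (N : Set G) ≤ N)
    (A : Subgroup G) (hAp : IsPGroup p A) (hAab : IsMulCommutative A)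
    (hAmax : ∀ B : Subgroup G, IsPGroup p B → IsMulCommutative B →
      Nat.card B ≤ Nat.card A) :
    ∃ (S : Type) (_ : AddCommGroup S) (_ : Module (MonoidAlgebra F G) S),
      IsSimpleModule (MonoidAlgebra F G) S ∧
      Nat.card A ≤ fdim F G S := by
  have : Fact p.Prime := ⟨hp⟩
  have : ExpChar F p := ExpChar.prime hp
  have : NeZero (Nat.card N : F) := by
    refine ⟨fun h => ?_⟩
    rw [CharP.cast_eq_zero_iff F p] at h
    exact hp.one_lt.ne' (Nat.dvd_one.1 (hN' ▸ Nat.dvd_gcd h dvd_rfl))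
  let _ : CommGroup A := { A.toGroup with mul_comm := hAab.is_comm.comm }
  refine exists_simple_of_hasBigBlock F G N A A.subtype ?_ ?_
  · rw [eq_bot_iff]
    intro a ha
    have h1 : ∀ n ∈ N, (a : G) * n = n * a := by
      intro n hn
      have := DFunLike.congr_fun (MonoidHom.mem_ker.1 ha) (⟨n, hn⟩ : N)
      have := congrArg Subtype.val this
      simpa [mul_inv_eq_iff_eq_mul] using this
    have h2 : (a : G) ∈ N := hNC (Subgroup.mem_centralizer_iff.2 fun n hn => (h1 n hn).symm)
    obtain ⟨k, hk⟩ := hAp a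
    have h3 : orderOf (a : G) ∣ p ^ k :=
      orderOf_dvd_of_pow_eq_one (by simpa using congrArg Subtype.val hk)
    have h4 : orderOf (a : G) ∣ Nat.card N := Subgroup.orderOf_dvd_natCard _ h2
    have h5 : orderOf (a : G) ∣ 1 := (Nat.Coprime.pow_right k hN') ▸ Nat.dvd_gcd h4 h3
    rw [Nat.dvd_one, orderOf_eq_one_iff] at h5
    exact Subtype.ext h5
  · obtain ⟨n, hn⟩ := hAp.exists_card_eq
    exact hasBigBlock_of_coprime F (p := p) (m := n)
      (fun h => hp.one_lt.ne' (Nat.dvd_one.1 (hN' ▸ Nat.dvd_gcd h dvd_rfl)))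
      (fun a => by rw [← hn]; exact pow_card_eq_one') _
end

section
/- Let p be a prime, F an algebraically closed field of characteristic p, and G a finite group with a normal abelian subgroup N of order coprime to p such that G/N is a p-group. Then the dimension of every simple FG-module is a power of p that divides [G : N]. -/
open Module

/-- A finite `p`-group acting linearly on a nonzero vector space of characteristic `p` fixes a
nonzero vector. -/
theorem IsPGroup.exists_ne_zero_forall_apply_eq {p : ℕ} [Fact p.Prime] {F H V : Type*} [Field F]
    [CharP F p] [Group H] [Finite H] (hH : IsPGroup p H) [AddCommGroup V] [Module F V]
    [Nontrivial V] (ρ : Representation F H V) : ∃ v ≠ 0, ∀ h, ρ h v = v := by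
  obtain ⟨u, hu⟩ := exists_ne (0 : V)
  have hpV (x : V) : p • x = 0 := by
    rw [← Nat.cast_smul_eq_nsmul F, CharP.cast_eq_zero, zero_smul]
  let A : AddSubgroup V := .closure (Set.range fun h ↦ ρ h u)
  have hA (h : H) : A ≤ A.comap (ρ h).toAddMonoidHom := (AddSubgroup.closure_le _).mpr <| by
    rintro _ ⟨k, rfl⟩
    exact AddSubgroup.subset_closure ⟨h * k, by simp⟩
  have : AddGroup.FG A := by
    rw [AddGroup.fg_iff_addSubgroup_fg, AddSubgroup.fg_iff]
    exact ⟨_, rfl, Set.finite_range _⟩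
  have : Finite A := AddCommGroup.finite_of_fg_isAddTorsion _ fun x ↦
    isOfFinAddOrder_iff_nsmul_eq_zero.mpr ⟨p, (Fact.out : p.Prime).pos, Subtype.ext (hpV x)⟩
  let _ : MulAction H A :=
    { smul h x := ⟨ρ h x, hA h x.2⟩
      one_smul x := Subtype.ext <| by change ρ 1 (x : V) = x; simp
      mul_smul g h x := Subtype.ext <| by change ρ (g * h) (x : V) = ρ g (ρ h x); simp }
  have smul_coe (h : H) (x : A) : ((h • x : A) : V) = ρ h x := rfl
  let u' : A := ⟨u, AddSubgroup.subset_closure ⟨1, by simp⟩⟩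
  have hcard : p ∣ Nat.card A := by
    rw [← addOrderOf_eq_prime (x := u') (Subtype.ext (hpV u)) (by simpa [u', Subtype.ext_iff])]
    exact addOrderOf_dvd_natCard _
  obtain ⟨b, hb, hb0⟩ := hH.exists_fixed_point_of_prime_dvd_card_of_fixed_point A hcard
    (a := 0) fun h ↦ Subtype.ext <| by simp [smul_coe]
  refine ⟨b, fun h ↦ hb0 (Subtype.ext h.symm), fun h ↦ ?_⟩
  rw [← smul_coe, hb h]

/-- A finite-dimensional nonzero representation of a commutative group over an algebraically closed
field has a simultaneous eigenvector. -/
theorem Representation.exists_ne_zero_forall_apply_eq_smul {F N V : Type*} [Field F] [IsAlgClosed F]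
    [CommGroup N] [AddCommGroup V] [Module F V] [Nontrivial V] [FiniteDimensional F V]
    (ρ : Representation F N V) : ∃ v ≠ 0, ∃ χ : N → F, ∀ n, ρ n v = χ n • v := by
  have : Nontrivial ρ.asModule := inferInstanceAs (Nontrivial V)
  have : Module.Finite F ρ.asModule := inferInstanceAs (Module.Finite F V)
  have : IsArtinian (MonoidAlgebra F N) ρ.asModule := isArtinian_of_tower F inferInstance
  obtain ⟨L, hL⟩ := IsAtomic.exists_atom (Submodule (MonoidAlgebra F N) ρ.asModule)
  have : IsSimpleModule (MonoidAlgebra F N) L := isSimpleModule_iff_isAtom.mpr hL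
  have : Module.Finite F L := .of_injective (L.subtype.restrictScalars F) L.injective_subtype
  have hrank := IsSimpleModule.finrank_eq_one_of_isMulCommutative (MonoidAlgebra F N) L F
  obtain ⟨x, hx0, hx⟩ := finrank_eq_one_iff'.mp hrank
  choose χ hχ using fun n ↦ hx (MonoidAlgebra.of F N n • x)
  refine ⟨ρ.asModuleEquiv x, by simpa using hx0, χ, fun n ↦ ?_⟩
  have := congr(ρ.asModuleEquiv ($(hχ n) : ρ.asModule))
  simpa using! this.symm

/-- Nonzero simultaneous eigenvectors of commuting endomorphisms with pairwise distinct systems of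
eigenvalues are linearly independent. -/
theorem Module.End.linearIndependent_of_forall_apply_eq_smul {F N ι V : Type*} [Field F]
    [AddCommGroup V] [Module F V] (f : N → End F V) (hf : ∀ i j, Commute (f i) (f j))
    (w : ι → V) (hw : ∀ i, w i ≠ 0) (χ : ι → N → F) (hχ : Function.Injective χ)
    (h : ∀ i n, f n (w i) = χ i n • w i) : LinearIndependent F w := by
  have key := (independent_iInf_maxGenEigenspace_of_forall_mapsTo f
    fun i j φ ↦ mapsTo_maxGenEigenspace_of_comm (hf j i) φ).comp hχ
  refine key.linearIndependent _ (fun i ↦ ?_) hw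
  simp only [Function.comp_apply, Submodule.mem_iInf]
  exact fun n ↦ (mem_maxGenEigenspace _ _ _).mpr ⟨1, by simp [h]⟩

/-- A Sylow `p`-subgroup together with a normal subgroup of `p`-power index generates the group. -/
theorem Sylow.sup_eq_top_of_isPGroup_quotient {p : ℕ} [Fact p.Prime] {G : Type*} [Group G]
    [Finite G] (P : Sylow p G) {N : Subgroup G} [N.Normal] (h : IsPGroup p (G ⧸ N)) :
    (P : Subgroup G) ⊔ N = ⊤ := by
  obtain ⟨m, hm⟩ := IsPGroup.iff_card.mp h
  have hcop : Nat.Coprime (P : Subgroup G).index N.index := by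
    rw [show N.index = p ^ m from hm]
    exact (((Fact.out : p.Prime).coprime_iff_not_dvd.mpr P.not_dvd_index).symm).pow_right m
  exact Subgroup.index_eq_one.mp <| Nat.eq_one_of_dvd_coprimes hcop
    (Subgroup.index_dvd_of_le le_sup_left) (Subgroup.index_dvd_of_le le_sup_right)

/-- The order of a Sylow `p`-subgroup divides the index of any subgroup of order prime to `p`. -/
theorem Sylow.card_dvd_index_of_coprime {p : ℕ} [Fact p.Prime] {G : Type*} [Group G]
    [Finite G] (P : Sylow p G) {N : Subgroup G} (h : Nat.Coprime (Nat.card N) p) :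
    Nat.card P ∣ N.index := by
  obtain ⟨m, hm⟩ := IsPGroup.iff_card.mp P.isPGroup'
  have hcop : Nat.Coprime (Nat.card P) (Nat.card N) := hm ▸ (h.pow_right m).symm
  exact hcop.dvd_of_dvd_mul_left (N.card_mul_index ▸ (P : Subgroup G).card_subgroup_dvd_card)

/-- The stabilizer of a function on a normal subgroup under conjugation. -/
def conjStabilizer {G F : Type*} [Group G] (N : Subgroup G) [N.Normal] (χ : N → F) :
    Subgroup G where
  carrier := {g | ∀ n, χ (MulAut.conjNormal g n) = χ n}
  one_mem' n := by simp
  mul_mem' {g h} hg hh n := by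
    rw [map_mul, MulAut.mul_apply, hg, hh]
  inv_mem' {g} hg n := by
    rw [← hg, ← MulAut.mul_apply, ← map_mul, mul_inv_cancel, map_one, MulAut.one_apply]

theorem mem_conjStabilizer {G F : Type*} [Group G] {N : Subgroup G} [N.Normal] {χ : N → F} {g : G} :
    g ∈ conjStabilizer N χ ↔ ∀ n, χ (MulAut.conjNormal g n) = χ n :=
  Iff.rfl

/-- Translating a simultaneous eigenvector of a normal subgroup conjugates its eigenvalues. -/
theorem Representation.apply_apply_eq_smul {F G V : Type*} [Field F] [Group G] [AddCommGroup V]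
    [Module F V] (ρ : Representation F G V) {N : Subgroup G} [N.Normal] {χ : N → F} {v : V}
    (hv : ∀ n : N, ρ n v = χ n • v) (g : G) (n : N) :
    ρ n (ρ g v) = χ (MulAut.conjNormal g⁻¹ n) • ρ g v := by
  rw [← map_smul, ← hv, ← Module.End.mul_apply, ← Module.End.mul_apply, ← map_mul, ← map_mul]
  simp [mul_assoc]

/-- A simultaneous eigenvector of `N` can be chosen to be fixed by the elements of a `p`-subgroup
stabilizing its system of eigenvalues. -/
theorem Representation.exists_eigenvector_fixed {p : ℕ} [Fact p.Prime] {F G V : Type*}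
    [Field F] [CharP F p] [Group G] [Finite G] [AddCommGroup V]
    [Module F V] (ρ : Representation F G V) {N H : Subgroup G} [N.Normal] (hH : IsPGroup p H)
    {χ : N → F} (hχ : H ≤ conjStabilizer N χ) {u : V} (hu0 : u ≠ 0)
    (hu : ∀ n : N, ρ n u = χ n • u) :
    ∃ v ≠ 0, (∀ n : N, ρ n v = χ n • v) ∧ ∀ h ∈ H, ρ h v = v := by
  let W : Submodule F V := ⨅ n : N, End.eigenspace (ρ n) (χ n)
  have mem_W {v : V} : v ∈ W ↔ ∀ n : N, ρ n v = χ n • v := by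
    simp only [W, Submodule.mem_iInf, End.mem_eigenspace_iff]
  have hW (h : H) : W ≤ W.comap (ρ h) := fun v hv ↦ mem_W.mpr fun n ↦ by
    rw [ρ.apply_apply_eq_smul (mem_W.mp hv), hχ (H.inv_mem h.2)]
  have : Nontrivial W := ⟨⟨u, mem_W.mpr hu⟩, 0, by simpa [Subtype.ext_iff]⟩
  let σ : Representation F H W :=
    { toFun h := (ρ h).restrict (hW h)
      map_one' := by ext; simp
      map_mul' g h := by ext; simp }
  obtain ⟨v, hv0, hv⟩ := hH.exists_ne_zero_forall_apply_eq σ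
  exact ⟨v, by simpa using hv0, mem_W.mp v.2, fun h hh ↦ congrArg Subtype.val (hv ⟨h, hh⟩)⟩

/-- Let `N` be a normal abelian subgroup of `G` of order prime to `p` with `G ⧸ N` a `p`-group. An
irreducible representation of `G` in characteristic `p` has dimension a power of `p` dividing the
index of `N`. -/
theorem Representation.finrank_eq_pow_and_dvd_index {p : ℕ} [Fact p.Prime] {F G V : Type*}
    [Field F] [IsAlgClosed F] [CharP F p] [Group G] [Finite G] [AddCommGroup V] [Module F V]
    [Nontrivial V] [FiniteDimensional F V] (ρ : Representation F G V)
    (hρ : ∀ W : Submodule F V, (∀ g, W ≤ W.comap (ρ g)) → W = ⊥ ∨ W = ⊤)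
    (N : Subgroup G) [N.Normal] [IsMulCommutative N] (hcop : Nat.Coprime (Nat.card N) p)
    (hquot : IsPGroup p (G ⧸ N)) : ∃ k : ℕ, finrank F V = p ^ k ∧ p ^ k ∣ N.index := by
  let _ : CommGroup N := { mul_comm := mul_comm' }
  let σ : Representation F N V := ρ.comp N.subtype
  obtain ⟨u, hu0, χ, hu⟩ := σ.exists_ne_zero_forall_apply_eq_smul
  obtain ⟨P⟩ : Nonempty (Sylow p G) := inferInstance
  obtain ⟨v, hv0, hvN, hvP⟩ := ρ.exists_eigenvector_fixed
    (H := P ⊓ conjStabilizer N χ) P.isPGroup'.to_inf_left inf_le_right hu0 hu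
  let H : Subgroup P := (conjStabilizer N χ).subgroupOf P
  let w (q : P ⧸ H) : V := ρ q.out v
  have hw (g : P) : w g = ρ g v := by
    obtain ⟨h, hh⟩ := QuotientGroup.mk_out_eq_mul H g
    have := hvP h ⟨h.1.2, h.2⟩
    simp only [w, hh, Subgroup.coe_mul, map_mul, End.mul_apply, this]
  have hinj : Function.Injective fun (q : P ⧸ H) (n : N) ↦
      χ (MulAut.conjNormal (q.out : G)⁻¹ n) := by
    intro q r hqr
    rw [← q.out_eq', ← r.out_eq']
    refine QuotientGroup.eq.mpr (mem_conjStabilizer.mpr fun n ↦ ?_)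
    have := congrFun hqr (MulAut.conjNormal (r.out : G) n)
    simp only [← MulAut.mul_apply, ← map_mul, inv_mul_cancel, map_one, MulAut.one_apply] at this
    exact this
  have hli : LinearIndependent F w := by
    refine End.linearIndependent_of_forall_apply_eq_smul σ (fun i j ↦ ?_) w (fun q hq ↦ hv0 ?_)
      _ hinj fun q n ↦ ρ.apply_apply_eq_smul hvN q.out n
    · rw [Commute, SemiconjBy, ← map_mul, ← map_mul, mul_comm]
    · simpa [w] using congr(ρ (q.out : G)⁻¹ $hq)
  let U : Submodule F V := Submodule.span F (Set.range w)
  have hUP (a : P) : U ≤ U.comap (ρ a) := Submodule.span_le.mpr <| by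
    rintro _ ⟨q, rfl⟩
    exact Submodule.subset_span ⟨(a * q.out : P), by rw [hw]; simp [w]⟩
  have hUN (n : N) : U ≤ U.comap (ρ n) := Submodule.span_le.mpr <| by
    rintro _ ⟨q, rfl⟩
    rw [SetLike.mem_coe, Submodule.mem_comap, ρ.apply_apply_eq_smul hvN]
    exact U.smul_mem _ (Submodule.subset_span ⟨q, rfl⟩)
  have hU : U = ⊤ := by
    refine (hρ U fun g x hx ↦ ?_).resolve_left fun h ↦ ?_
    · obtain ⟨a, ha, n, hn, rfl⟩ := Subgroup.mem_sup_of_normal_right.mp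
        (P.sup_eq_top_of_isPGroup_quotient hquot ▸ Subgroup.mem_top g)
      rw [Submodule.mem_comap, map_mul]
      exact hUP ⟨a, ha⟩ (hUN ⟨n, hn⟩ hx)
    · have : w (1 : P) ∈ U := Submodule.subset_span ⟨_, rfl⟩
      exact hli.ne_zero _ (by simpa [h] using this)
  have hrank : finrank F V = H.index := finrank_eq_nat_card_basis (.mk hli hU.ge)
  obtain ⟨k, hk⟩ := P.isPGroup'.index H
  exact ⟨k, hrank.trans hk, hk ▸ H.index_dvd_card.trans (P.card_dvd_index_of_coprime hcop)⟩

/-- If `F` is an algebraically closed field of characteristic `p` and `G` is a finite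
group with a normal abelian subgroup `N` of order coprime to `p` such that `G/N` is a
`p`-group, then the dimension of every simple `F[G]`-module is a power of `p` dividing
`[G : N]`. -/
theorem simple_dim_pow_dvd_index
    (p : ℕ) (hp : p.Prime) (F : Type) [Field F] [IsAlgClosed F] [CharP F p]
    (G : Type) [Group G] [Finite G] (N : Subgroup G) [N.Normal]
    (hNab : IsMulCommutative N) (hcop : Nat.Coprime (Nat.card N) p)
    (hquot : IsPGroup p (G ⧸ N)) :
    ∀ (S : Type) (_ : AddCommGroup S) (_ : Module (MonoidAlgebra F G) S),
      IsSimpleModule (MonoidAlgebra F G) S →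
      ∃ k : ℕ, fdim F G S = p ^ k ∧ p ^ k ∣ N.index := by
  intro S _ _ hS
  have : Fact p.Prime := ⟨hp⟩
  let _ : Module F S := Module.compHom S (algebraMap F (MonoidAlgebra F G))
  have : IsScalarTower F (MonoidAlgebra F G) S := .of_algebraMap_smul fun _ _ ↦ rfl
  have : Nontrivial S := IsSimpleModule.nontrivial (MonoidAlgebra F G) S
  have : Module.Finite F (MonoidAlgebra F G) := inferInstance
  have : Module.Finite F S := .trans (MonoidAlgebra F G) S
  refine (Representation.ofModule' (k := F) (G := G) S).finrank_eq_pow_and_dvd_index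
    (fun W hW ↦ ?_) N hcop hquot
  let W' : Submodule (MonoidAlgebra F G) S :=
    { W with
      smul_mem' a x hx := by
        induction a using MonoidAlgebra.induction_on with
        | of g => exact hW g hx
        | add a b ha hb => rw [add_smul]; exact W.add_mem ha hb
        | smul r a ha => rw [smul_assoc]; exact W.smul_mem r ha }
  refine (eq_bot_or_eq_top W').imp (fun h ↦ ?_) fun h ↦ ?_ <;>
    exact SetLike.coe_injective congr(($h : Set S))
end

section
/- Let p be a prime, F an algebraically closed field of characteristic p, and G a finite group with a normal abelian subgroup N of order coprime to p such that G/N is a p-group. Suppose there exists a group homomorphism λ : N → Fˣ whose stabilizer in G, under the action (g · λ)(n) = λ(g⁻¹ n g), equals N (i.e., the G-orbit of λ has size [G : N]). Then there exists a simple FG-module of dimension exactly [G : N]. -/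
theorem fdim_asModule {F : Type} [Field F] {G : Type} [Group G] {V : Type} [AddCommGroup V]
    [Module F V] (ρ : Representation F G V) : fdim F G ρ.asModule = Module.finrank F V := by
  have hmod : Module.compHom ρ.asModule (algebraMap F (MonoidAlgebra F G)) =
      (inferInstance : Module F ρ.asModule) :=
    Module.ext' _ _ fun r x => algebraMap_smul (MonoidAlgebra F G) r x
  rw [fdim, hmod]
  exact ρ.asModuleEquiv.finrank_eq

namespace Representation

section OfCharacter

variable {k H : Type*} [CommRing k] [Group H]

/-- The one-dimensional representation on which a group acts through a linear character. -/
def ofCharacter (χ : H →* kˣ) : Representation k H k :=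
  (Algebra.lmul k k : k →* Module.End k k).comp ((Units.coeHom k).comp χ)

@[simp]
theorem ofCharacter_apply (χ : H →* kˣ) (h : H) (x : k) : ofCharacter χ h x = χ h * x := rfl

end OfCharacter

variable {k G : Type*} [Field k] [Group G] {N : Subgroup G}

theorem coindV_ofCharacter_mul {χ : N →* kˣ} (f : coindV N.subtype (ofCharacter χ)) (n : N)
    (g : G) : f.1 (n * g) = χ n * f.1 g :=
  f.2 n g

theorem coe_coind_ofCharacter_apply {χ : N →* kˣ} (h : G)
    (f : coindV N.subtype (ofCharacter χ)) (g : G) :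
    (coind N.subtype (ofCharacter χ) h f).1 g = f.1 (g * h) :=
  rfl

theorem mul_out_inv_mem (N : Subgroup G) (g : G) :
    g * (Quotient.mk (QuotientGroup.rightRel N) g).out⁻¹ ∈ N :=
  QuotientGroup.rightRel_apply.mp (Quotient.mk_out (s := QuotientGroup.rightRel N) g)

/-- A function in the representation coinduced from a linear character is determined by
arbitrary values on representatives of the right cosets. -/
noncomputable def coindVOfCharacterEquiv (χ : N →* kˣ) :
    coindV N.subtype (ofCharacter χ) ≃ₗ[k] (Quotient (QuotientGroup.rightRel N) → k) where
  toFun f q := f.1 q.out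
  map_add' _ _ := rfl
  map_smul' _ _ := rfl
  invFun φ := ⟨fun g => χ ⟨_, mul_out_inv_mem N g⟩ * φ (Quotient.mk _ g), fun n g => by
    have hq : Quotient.mk (QuotientGroup.rightRel N) (n * g) = Quotient.mk _ g :=
      Quotient.sound (QuotientGroup.rightRel_apply.mpr (by simp))
    have hn : (⟨n * g * (Quotient.mk (QuotientGroup.rightRel N) (n * g)).out⁻¹,
        mul_out_inv_mem N _⟩ : N) = n * ⟨_, mul_out_inv_mem N g⟩ := by
      ext
      simp [hq, mul_assoc]
    simp only [Subgroup.subtype_apply, ofCharacter_apply]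
    rw [hn, hq, map_mul, Units.val_mul, mul_assoc]⟩
  left_inv f := by
    ext g
    have := coindV_ofCharacter_mul f ⟨_, mul_out_inv_mem N g⟩
      (Quotient.mk (QuotientGroup.rightRel N) g).out
    simpa using this.symm
  right_inv φ := by
    ext q
    have hn : (⟨q.out * (Quotient.mk (QuotientGroup.rightRel N) q.out).out⁻¹,
        mul_out_inv_mem N _⟩ : N) = 1 := by
      ext
      simp
    change (χ ⟨q.out * (Quotient.mk (QuotientGroup.rightRel N) q.out).out⁻¹,
      mul_out_inv_mem N _⟩ : k) * φ (Quotient.mk _ q.out) = φ q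
    rw [hn, Quotient.out_eq, map_one, Units.val_one, one_mul]

theorem finrank_coindV_ofCharacter [Finite G] (χ : N →* kˣ) :
    Module.finrank k (coindV N.subtype (ofCharacter χ)) = N.index := by
  have := Fintype.ofFinite (Quotient (QuotientGroup.rightRel N))
  rw [(coindVOfCharacterEquiv χ).finrank_eq, Module.finrank_fintype_fun_eq_card,
    ← Nat.card_eq_fintype_card, Subgroup.index,
    Nat.card_congr (QuotientGroup.quotientRightRelEquivQuotientLeftRel N)]

open Classical in
/-- The extension by zero of a linear character, as an element of its coinduced representation. -/
noncomputable def extendCharacter (χ : N →* kˣ) : coindV N.subtype (ofCharacter χ) :=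
  ⟨fun g => if h : g ∈ N then χ ⟨g, h⟩ else 0, fun n g => by
    by_cases h : g ∈ N
    · have hn : (⟨n * g, N.mul_mem n.2 h⟩ : N) = n * ⟨g, h⟩ := rfl
      simp [h, hn, N.mul_mem_cancel_left n.2]
    · simp [h, N.mul_mem_cancel_left n.2]⟩

theorem extendCharacter_apply_of_mem (χ : N →* kˣ) {g : G} (h : g ∈ N) :
    (extendCharacter χ).1 g = χ ⟨g, h⟩ :=
  dif_pos h

theorem extendCharacter_apply_of_notMem (χ : N →* kˣ) {g : G} (h : g ∉ N) :
    (extendCharacter χ).1 g = 0 :=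
  dif_neg h

theorem card_smul_eq_sum_coind_extendCharacter [Fintype G] (χ : N →* kˣ)
    (f : coindV N.subtype (ofCharacter χ)) :
    (Nat.card N : k) • f =
      ∑ h : G, f.1 h⁻¹ • coind N.subtype (ofCharacter χ) h (extendCharacter χ) := by
  classical
  ext g
  have key : ∀ h : G, f.1 h⁻¹ * (extendCharacter χ).1 (g * h) =
      if g * h ∈ N then f.1 g else 0 := by
    intro h
    split_ifs with hm
    · rw [extendCharacter_apply_of_mem χ hm, mul_comm, ← coindV_ofCharacter_mul]
      simp
    · rw [extendCharacter_apply_of_notMem χ hm, mul_zero]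
  have hsum : ∑ h : G, (if g * h ∈ N then f.1 g else 0) = Nat.card N * f.1 g := by
    rw [Fintype.sum_equiv (Equiv.mulLeft g) (fun h => if g * h ∈ N then f.1 g else 0)
      (fun h => if h ∈ N then f.1 g else 0) fun _ => rfl,
      ← Finset.sum_filter, Finset.sum_const, nsmul_eq_mul, ← Fintype.card_subtype, ← Nat.card_eq_fintype_card]
  simpa [key, Finset.sum_apply, -coind_apply, coe_coind_ofCharacter_apply] using hsum.symm

section Normal

variable [N.Normal]

theorem sum_inv_smul_coind [Fintype N] (χ : N →* kˣ)
    (hχ : ∀ g : G, χ.comp (MulAut.conjNormal g).toMonoidHom = χ → g ∈ N)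
    (f : coindV N.subtype (ofCharacter χ)) (hcomm : IsMulCommutative N) :
    ∑ n : N, ((χ n)⁻¹ : kˣ).1 • coind N.subtype (ofCharacter χ) n f =
      (Nat.card N * f.1 1) • extendCharacter χ := by
  ext g
  have key : ∀ n : N, ((χ n)⁻¹ : kˣ).1 * f.1 (g * n) =
      ((Units.coeHom k).comp (χ.comp (MulAut.conjNormal g).toMonoidHom * χ⁻¹)) n * f.1 g := by
    intro n
    have := coindV_ofCharacter_mul f (MulAut.conjNormal g n) g
    rw [MulAut.conjNormal_apply, inv_mul_cancel_right] at this
    rw [this]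
    simp only [MonoidHom.comp_apply, MonoidHom.mul_apply, MonoidHom.inv_apply,
      Units.coeHom_apply, Units.val_mul, MulEquiv.coe_toMonoidHom]
    ring
  have hsum : ∑ n : N, ((χ n)⁻¹ : kˣ).1 * f.1 (g * n) =
      Nat.card N * f.1 1 * (extendCharacter χ).1 g := by
    simp_rw [key, ← Finset.sum_mul]
    by_cases hg : g ∈ N
    · have hconj : ∀ n : N, MulAut.conjNormal g n = n := fun n => by
        ext
        have := congrArg Subtype.val (hcomm.is_comm.comm (⟨g, hg⟩ : N) n)
        simp only [Subgroup.coe_mul] at this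
        rw [MulAut.conjNormal_apply, this, mul_inv_cancel_right]
      have hf := coindV_ofCharacter_mul f ⟨g, hg⟩ 1
      rw [mul_one] at hf
      rw [extendCharacter_apply_of_mem χ hg, hf]
      simp [hconj]
      ring
    · rw [extendCharacter_apply_of_notMem χ hg, sum_hom_units_eq_zero, zero_mul, mul_zero]
      intro h
      refine hg (hχ g (MonoidHom.ext fun n => ?_))
      have := DFunLike.congr_fun h n
      rw [MonoidHom.comp_apply, Units.coeHom_apply, MonoidHom.one_apply, Units.val_eq_one,
        MonoidHom.mul_apply, MonoidHom.inv_apply, mul_inv_eq_one] at this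
      exact this
  simpa [Finset.sum_apply, -coind_apply, coe_coind_ofCharacter_apply] using hsum

/-- Coinducing a linear character of an abelian normal subgroup yields an irreducible
representation if the character is fixed only by the subgroup itself. -/
theorem isIrreducible_coind_ofCharacter [Finite G] (hcomm : IsMulCommutative N)
    (hcard : (Nat.card N : k) ≠ 0) (χ : N →* kˣ)
    (hχ : ∀ g : G, χ.comp (MulAut.conjNormal g).toMonoidHom = χ → g ∈ N) :
    IsIrreducible (coind N.subtype (ofCharacter χ)) := by
  have := Fintype.ofFinite G
  have := Fintype.ofFinite N
  have hext : extendCharacter χ ≠ 0 := fun h => by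
    have h1 := extendCharacter_apply_of_mem χ N.one_mem
    rw [h] at h1
    exact (χ ⟨1, N.one_mem⟩).ne_zero h1.symm
  have htop : ∀ W : Subrepresentation (coind N.subtype (ofCharacter χ)),
      ∀ f ∈ W.toSubmodule, f ≠ 0 → W = ⊤ := by
    intro W f hf hf0
    obtain ⟨g, hg⟩ : ∃ g, f.1 g ≠ 0 := by
      by_contra! h
      exact hf0 (Subtype.ext (funext h))
    have hext_mem : extendCharacter χ ∈ W.toSubmodule := by
      have hmem := W.toSubmodule.sum_mem (t := Finset.univ) fun (n : N) _ =>
        W.toSubmodule.smul_mem ((χ n)⁻¹ : kˣ).1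
          (W.apply_mem_toSubmodule n (W.apply_mem_toSubmodule g hf))
      rw [sum_inv_smul_coind χ hχ _ hcomm] at hmem
      refine (W.toSubmodule.smul_mem_iff (mul_ne_zero hcard ?_)).mp hmem
      rwa [coe_coind_ofCharacter_apply, one_mul]
    refine Subrepresentation.toSubmodule_injective (eq_top_iff.mpr fun f' _ => ?_)
    rw [← W.toSubmodule.smul_mem_iff hcard, card_smul_eq_sum_coind_extendCharacter]
    exact W.toSubmodule.sum_mem fun h _ =>
      W.toSubmodule.smul_mem _ (W.apply_mem_toSubmodule h hext_mem)
  refine { exists_pair_ne := ⟨⊥, ⊤, fun h => hext ?_⟩, eq_bot_or_eq_top := fun W => ?_ }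
  · have hmem : extendCharacter χ ∈
        (⊤ : Subrepresentation (coind N.subtype (ofCharacter χ))).toSubmodule :=
      Submodule.mem_top
    rw [← h] at hmem
    exact (Submodule.mem_bot k).mp hmem
  · by_cases hW : W.toSubmodule = ⊥
    · exact Or.inl (Subrepresentation.toSubmodule_injective hW)
    · obtain ⟨f, hf, hf0⟩ := W.toSubmodule.ne_bot_iff.mp hW
      exact Or.inr (htop W f hf hf0)

end Normal

end Representation


/-- If `F` is an algebraically closed field of characteristic `p`, `G` is a finite group
with a normal abelian subgroup `N` of order coprime to `p` with `G/N` a `p`-group, and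
there is a homomorphism `λ : N → Fˣ` whose stabilizer in `G` (under the conjugation
action on characters) is exactly `N`, then there is a simple `F[G]`-module of dimension
exactly `[G : N]`. -/
theorem exists_simple_module_dim_eq_index_of_regular_character
    (p : ℕ) (hp : p.Prime) (F : Type) [Field F] [IsAlgClosed F] [CharP F p]
    (G : Type) [Group G] [Finite G] (N : Subgroup G) [hN : N.Normal]
    (hNab : IsMulCommutative N) (hcop : Nat.Coprime (Nat.card N) p)
    (hquot : IsPGroup p (G ⧸ N))
    (lam : ↥N →* Fˣ)
    (hstab : ∀ g : G,
      (∀ n : N, lam ⟨g⁻¹ * ↑n * g, by simpa using hN.conj_mem ↑n n.2 g⁻¹⟩ = lam n) →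
      g ∈ N) :
    ∃ (S : Type) (_ : AddCommGroup S) (_ : Module (MonoidAlgebra F G) S),
      IsSimpleModule (MonoidAlgebra F G) S ∧ fdim F G S = N.index := by
  have hcard : (Nat.card N : F) ≠ 0 := fun h =>
    hp.coprime_iff_not_dvd.mp hcop.symm ((CharP.cast_eq_zero_iff F p _).mp h)
  have hreg : ∀ g : G, lam.comp (MulAut.conjNormal g).toMonoidHom = lam → g ∈ N := by
    refine fun g hg => inv_mem_iff.mp (hstab g⁻¹ fun n => ?_)
    rw [← DFunLike.congr_fun hg n]
    exact congrArg lam (Subtype.ext (by simp))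
  let ρ := Representation.coind N.subtype (Representation.ofCharacter lam)
  refine ⟨ρ.asModule, inferInstance, inferInstance, ?_, ?_⟩
  · exact ρ.irreducible_iff_isSimpleModule_asModule.mp
      (Representation.isIrreducible_coind_ofCharacter hNab hcard lam hreg)
  · rw [fdim_asModule, Representation.finrank_coindV_ofCharacter]
end

section
/- Let G be a finite group with trivial Frattini subgroup, Φ(G) = 1, and let N be a nilpotent normal subgroup of G. Then N is abelian and the exponent of N is squarefree. In particular, the Fitting subgroup of G is abelian of squarefree exponent (a direct product of elementary abelian groups for various primes). -/
open Subgroup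

/-- In a finite group, the Frattini subgroup of a normal subgroup is contained in the Frattini
subgroup of the whole group. -/
theorem map_frattini_le_frattini {G : Type*} [Group G] [Finite G] (N : Subgroup G) [N.Normal] :
    (frattini N).map N.subtype ≤ frattini G := by
  set K := (frattini N).map N.subtype with hK
  have hKN : K ≤ N := map_subtype_le _
  refine le_iInf₂ fun M hM => ?_
  by_contra hKM
  have hsup : M ⊔ K = ⊤ := hM.2 _ (left_lt_sup.2 hKM)
  have hN : M.subgroupOf N ⊔ frattini N = ⊤ := by
    rw [eq_top_iff]
    rintro ⟨n, hn⟩ -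
    have hmem : n ∈ M ⊔ K := hsup ▸ mem_top n
    rw [← SetLike.mem_coe, mul_normal] at hmem
    obtain ⟨m, hm, k, hk, rfl⟩ := hmem
    obtain ⟨k, hk, rfl⟩ := hk
    have hmN : m ∈ N := by simpa using N.mul_mem hn (N.inv_mem k.2)
    have hm' : (⟨m, hmN⟩ : N) ∈ M.subgroupOf N := mem_subgroupOf.2 hm
    exact mul_mem_sup hm' hk
  have hNM : N ≤ M := subgroupOf_eq_top.1 (frattini_nongenerating hN)
  exact hKM (hKN.trans hNM)

/-- The quotient of a group by a normal maximal subgroup has no nontrivial proper subgroups. -/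
theorem IsCoatom.isSimpleOrder_subgroup_quotient {H : Type*} [Group H] {M : Subgroup H}
    (hM : IsCoatom M) [M.Normal] : IsSimpleOrder (Subgroup (H ⧸ M)) := by
  have hnt : Nontrivial (H ⧸ M) := QuotientGroup.nontrivial_iff.2 hM.1
  refine ⟨fun K => ?_⟩
  have hle : M ≤ K.comap (QuotientGroup.mk' M) := QuotientGroup.le_comap_mk' M K
  have hinj := comap_injective (QuotientGroup.mk'_surjective M)
  rcases hle.eq_or_lt with h | h
  · exact .inl (hinj (by rw [← h, MonoidHom.comap_bot, QuotientGroup.ker_mk']))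
  · exact .inr (hinj (by rw [hM.2 _ h, comap_top]))

/-- A nontrivial finite group without nontrivial proper subgroups has prime order. -/
theorem Group.prime_natCard_of_isSimpleOrder_subgroup {Q : Type*} [Group Q] [Finite Q]
    [IsSimpleOrder (Subgroup Q)] : (Nat.card Q).Prime := by
  have hnt : Nontrivial Q := Subgroup.nontrivial_iff.1 inferInstance
  have hp := Nat.minFac_prime (Finite.one_lt_card (α := Q)).ne'
  have := Fact.mk hp
  obtain ⟨x, hx⟩ := exists_prime_orderOf_dvd_card' (G := Q) _ (Nat.minFac_dvd (Nat.card Q))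
  have hz : zpowers x = ⊤ := (eq_bot_or_eq_top _).resolve_left fun h => by
    rw [zpowers_eq_bot] at h
    rw [h, orderOf_one] at hx
    exact hp.ne_one hx.symm
  rw [← Subgroup.card_top (G := Q), ← hz, Nat.card_zpowers, hx]
  exact hp

/-- If `p ^ 2` divides `n` for a prime `p`, then every prime divisor of `n` divides `n / p`. -/
theorem Nat.Prime.dvd_div_of_mul_self_dvd {n p q : ℕ} (hp : p.Prime) (hpn : p * p ∣ n)
    (hq : q.Prime) (hqn : q ∣ n) : q ∣ n / p := by
  obtain ⟨k, rfl⟩ := hpn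
  rw [mul_assoc, Nat.mul_div_cancel_left _ hp.pos]
  rw [mul_assoc] at hqn
  rcases hq.dvd_mul.1 hqn with h | h
  · exact h.trans (dvd_mul_right _ _)
  · exact h

/-- A finite nilpotent group with trivial Frattini subgroup is abelian of squarefree exponent. -/
theorem isMulCommutative_and_squarefree_exponent_of_frattini_eq_bot
    {H : Type*} [Group H] [Finite H] [hnil : Group.IsNilpotent H] (hH : frattini H = ⊥) :
    IsMulCommutative H ∧ Squarefree (Monoid.exponent H) := by
  have hnormal : ∀ M : Subgroup H, IsCoatom M → M.Normal :=
    (Group.isNilpotent_of_finite_tfae.out 0 2).1 hnil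
  have hbot : ∀ x : H, (∀ M : Subgroup H, IsCoatom M → x ∈ M) → x = 1 := fun x hx => by
    rw [← mem_bot, ← hH, frattini, Order.radical]
    exact mem_iInf.2 fun M => mem_iInf.2 (hx M)
  have hprime : ∀ M : Subgroup H, IsCoatom M → M.index.Prime := fun M hM => by
    have := hnormal M hM
    have := hM.isSimpleOrder_subgroup_quotient
    exact Group.prime_natCard_of_isSimpleOrder_subgroup
  constructor
  · refine ⟨⟨fun x y => ?_⟩⟩
    rw [← commutatorElement_eq_one_iff_mul_comm]
    refine hbot _ fun M hM => ?_
    have := hnormal M hM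
    have := Fact.mk (hprime M hM)
    have hcyc : IsCyclic (H ⧸ M) := isCyclic_of_prime_card (p := M.index) rfl
    rw [← QuotientGroup.eq_one_iff]
    have hc := mul_comm' (x : H ⧸ M) (y : H ⧸ M)
    exact commutatorElement_eq_one_iff_mul_comm.2 hc
  · rw [Nat.squarefree_iff_prime_squarefree]
    intro p hp hpn
    have hpos : 0 < Monoid.exponent H := Monoid.exponent_pos.2 Monoid.ExponentExists.of_finite
    have hdvd : Monoid.exponent H ∣ Monoid.exponent H / p := by
      refine Monoid.exponent_dvd_of_forall_pow_eq_one fun x => hbot _ fun M hM => ?_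
      have := hnormal M hM
      by_cases hxM : x ∈ M
      · exact M.pow_mem hxM _
      have hord : orderOf (x : H ⧸ M) = M.index :=
        ((Nat.dvd_prime (hprime M hM)).1 (orderOf_dvd_natCard _)).resolve_left
          fun h => hxM ((QuotientGroup.eq_one_iff x).1 (orderOf_eq_one_iff.1 h))
      have hidx : M.index ∣ Monoid.exponent H := hord ▸
        (orderOf_map_dvd (QuotientGroup.mk' M) x).trans (Monoid.order_dvd_exponent x)
      rw [← QuotientGroup.eq_one_iff, QuotientGroup.mk_pow, ← orderOf_dvd_iff_pow_eq_one, hord]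
      exact hp.dvd_div_of_mul_self_dvd hpn (hprime M hM) hidx
    have hle := Nat.le_of_dvd (Nat.div_pos (Nat.le_of_dvd hpos
      ((dvd_mul_right p p).trans hpn)) hp.pos) hdvd
    exact (Nat.div_lt_self hpos hp.one_lt).not_ge hle

/-- If `G` is a finite group with trivial Frattini subgroup, then every nilpotent normal
subgroup `N` of `G` is abelian of squarefree exponent. -/
theorem nilpotent_normal_abelian_squarefree_exponent_of_frattini_eq_bot
    (G : Type) [Group G] [Finite G] (hG : frattini G = ⊥)
    (N : Subgroup G) (hN : N.Normal) (hnil : Group.IsNilpotent ↥N) :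
    IsMulCommutative ↥N ∧ Squarefree (Monoid.exponent ↥N) := by
  refine isMulCommutative_and_squarefree_exponent_of_frattini_eq_bot ?_
  rw [← map_eq_bot_iff_of_injective _ N.subtype_injective, ← le_bot_iff, ← hG]
  exact map_frattini_le_frattini N
end
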